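/- Let H be a non-semisimple Hopf algebra of dimension 4p over an algebraically closed field k of characteristic zero, p an odd prime. Then every 2-dimensional simple H-module V is not self-dual, i.e. V is not isomorphic to its left dual V^∨. -/

import Mathlib

namespace SmallHopf

open scoped TensorProduct
open Coalgebra HopfAlgebra

section Twist

variable {k K M : Type} [Field k] [Ring K] [HopfAlgebra k K] [AddCommGroup M] [Module k M]

/-- The map `x ⊗ m ↦ x₁ ⊗ f(x₂) m`. -/
noncomputable def twistL (f : K →ₗ[k] Module.End k M) : K ⊗[k] M →ₗ[k] K ⊗[k] M :=
  (TensorProduct.lift f).lTensor K ∘ₗ (TensorProduct.assoc k K K M).toLinearMap ∘ₗ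
    (comul (R := k) (A := K)).rTensor M

theorem twistL_tmul (f : K →ₗ[k] Module.End k M) (x : K) (m : M) :
    twistL f (x ⊗ₜ m) = (f.flip m).lTensor K (comul x) := by
  simp only [twistL, LinearMap.comp_apply, LinearMap.rTensor_tmul, LinearEquiv.coe_coe]
  induction comul (R := k) x with
  | zero => simp
  | tmul a b => simp
  | add a b ha hb => simp only [TensorProduct.add_tmul, map_add, ha, hb]

theorem twistL_comp (f g h : K →ₗ[k] Module.End k M)
    (H : ∀ x, LinearMap.mul' k _ (TensorProduct.map f g (comul x)) = h x) :
    twistL f ∘ₗ twistL g = twistL h := by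
  refine TensorProduct.ext' fun x m => ?_
  rw [LinearMap.comp_apply, twistL_tmul, twistL_tmul]
  set u : K ⊗[k] K →ₗ[k] M :=
    (LinearMap.applyₗ (R := k) m) ∘ₗ LinearMap.mul' k _ ∘ₗ TensorProduct.map f g with hu
  have h1 : ∀ z : K ⊗[k] K, twistL f ((g.flip m).lTensor K z) =
      u.lTensor K (TensorProduct.assoc k K K K ((comul (R := k)).rTensor K z)) := by
    intro z
    induction z with
    | zero => simp
    | add a b ha hb => simp only [map_add, ha, hb]
    | tmul a b =>
      simp only [LinearMap.lTensor_tmul, LinearMap.flip_apply, twistL_tmul,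
        LinearMap.rTensor_tmul]
      induction comul (R := k) a with
      | zero => simp
      | tmul a b => simp [hu]
      | add a b ha hb => simp only [TensorProduct.add_tmul, map_add, ha, hb]
  rw [h1, coassoc_apply, ← LinearMap.comp_apply, ← LinearMap.lTensor_comp]
  congr 2
  ext x
  simp [hu, H]

theorem twistL_counit (h : K →ₗ[k] Module.End k M)
    (H : ∀ x, h x = counit (R := k) x • 1) : twistL h = LinearMap.id := by
  refine TensorProduct.ext' fun x m => ?_
  rw [twistL_tmul]
  have : h.flip m = (LinearMap.toSpanSingleton k M m) ∘ₗ counit := by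
    ext y; simp [H]
  rw [this, LinearMap.lTensor_comp, LinearMap.comp_apply, lTensor_counit_comul]
  simp

end Twist

section Rep

variable {k K : Type} [Field k] [Ring K] [HopfAlgebra k K]
  {M N P : Type} [AddCommGroup M] [Module k M] [AddCommGroup N] [Module k N]
  [AddCommGroup P] [Module k P]

/-- The action of `K ⊗ K` on a tensor product of representations. -/
noncomputable def tens2 (ρ : K →ₐ[k] Module.End k M) (σ : K →ₐ[k] Module.End k N) :
    K ⊗[k] K →ₐ[k] Module.End k (M ⊗[k] N) :=
  (Module.endTensorEndAlgHom (R := k) (S := k) (A := k)).comp (Algebra.TensorProduct.map ρ σ)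

theorem tens2_tmul (ρ : K →ₐ[k] Module.End k M) (σ : K →ₐ[k] Module.End k N) (a b : K) :
    tens2 ρ σ (a ⊗ₜ b) = TensorProduct.map (ρ a) (σ b) := rfl

/-- The tensor product of two representations of a Hopf algebra. -/
noncomputable def tens (ρ : K →ₐ[k] Module.End k M) (σ : K →ₐ[k] Module.End k N) :
    K →ₐ[k] Module.End k (M ⊗[k] N) :=
  (tens2 ρ σ).comp (Bialgebra.comulAlgHom k K)

theorem tens_apply (ρ : K →ₐ[k] Module.End k M) (σ : K →ₐ[k] Module.End k N) (a : K) :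
    tens ρ σ a = tens2 ρ σ (comul a) := rfl

/-- The tensor product of a representation with a vector space. -/
noncomputable def rtriv (ρ : K →ₐ[k] Module.End k M) (N : Type) [AddCommGroup N] [Module k N] :
    K →ₐ[k] Module.End k (M ⊗[k] N) :=
  AlgHom.ofLinearMap (LinearMap.rTensorHom N ∘ₗ ρ.toLinearMap)
    (by simp [Module.End.one_eq_id])
    (by intro x y; simp [Module.End.mul_eq_comp, LinearMap.rTensor_comp])

theorem rtriv_apply (ρ : K →ₐ[k] Module.End k M) (a : K) :
    rtriv ρ N a = (ρ a).rTensor N := rfl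

variable (k K) in
/-- The regular representation. -/
noncomputable def regRep : K →ₐ[k] Module.End k K := Algebra.lmul k K

theorem regRep_apply (a b : K) : regRep k K a b = a * b := rfl

theorem twistL_tens (ρ : K →ₐ[k] Module.End k M) (a : K) :
    twistL ρ.toLinearMap ∘ₗ rtriv (regRep k K) M a =
      tens (regRep k K) ρ a ∘ₗ twistL ρ.toLinearMap := by
  refine TensorProduct.ext' fun x m => ?_
  simp only [LinearMap.comp_apply, rtriv_apply, LinearMap.rTensor_tmul, regRep_apply,
    twistL_tmul, tens_apply, Bialgebra.comul_mul]
  induction comul (R := k) a with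
  | zero => simp
  | add a b ha hb => simp only [add_mul, map_add, ha, hb, LinearMap.add_apply]
  | tmul a b =>
    induction comul (R := k) x with
    | zero => simp
    | add a b ha hb => simp only [mul_add, map_add, ha, hb]
    | tmul c d => simp [tens2_tmul, regRep_apply]

/-- `K ⊗ M` is isomorphic to a multiple of the regular representation. -/
noncomputable def twistEquiv (ρ : K →ₐ[k] Module.End k M) : K ⊗[k] M ≃ₗ[k] K ⊗[k] M :=
  LinearEquiv.ofLinearMap (twistL ρ.toLinearMap) (twistL (ρ.toLinearMap ∘ₗ antipode k))
    (by
      rw [twistL_comp _ _ ((Algebra.linearMap k _) ∘ₗ counit), twistL_counit]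
      · intro x; simp [Algebra.algebraMap_eq_smul_one]
      · intro x
        have := congrArg ρ (mul_antipode_lTensor_comul_apply (R := k) x)
        rw [AlgHom.commutes] at this
        rw [LinearMap.comp_apply, Algebra.linearMap_apply, ← this]
        induction comul (R := k) x with
        | zero => simp
        | add a b ha hb => simp only [map_add, ha, hb]
        | tmul a b => simp)
    (by
      rw [twistL_comp _ _ ((Algebra.linearMap k _) ∘ₗ counit), twistL_counit]
      · intro x; simp [Algebra.algebraMap_eq_smul_one]
      · intro x
        have := congrArg ρ (mul_antipode_rTensor_comul_apply (R := k) x)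
        rw [AlgHom.commutes] at this
        rw [LinearMap.comp_apply, Algebra.linearMap_apply, ← this]
        induction comul (R := k) x with
        | zero => simp
        | add a b ha hb => simp only [map_add, ha, hb]
        | tmul a b => simp)

theorem twistEquiv_apply (ρ : K →ₐ[k] Module.End k M) (z : K ⊗[k] M) :
    twistEquiv ρ z = twistL ρ.toLinearMap z := rfl

/-- A linear map commutes with two representations. -/
def Intertwines (ρ : K →ₐ[k] Module.End k M) (σ : K →ₐ[k] Module.End k N) (f : M →ₗ[k] N) :
    Prop := ∀ a m, f (ρ a m) = σ a (f m)

theorem twistEquiv_intertwines (ρ : K →ₐ[k] Module.End k M) :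
    Intertwines (rtriv (regRep k K) M) (tens (regRep k K) ρ) (twistEquiv ρ).toLinearMap :=
  fun a m => LinearMap.congr_fun (twistL_tens ρ a) m

/-- The invariants of a representation. -/
def invts (ρ : K →ₐ[k] Module.End k M) : Submodule k M where
  carrier := {m | ∀ a, ρ a m = counit (R := k) a • m}
  zero_mem' := by simp
  add_mem' := by intro a b ha hb c; simp [ha c, hb c]
  smul_mem' := by intro a b hb c; rw [map_smul, hb c, smul_comm]

variable (k K) in
/-- The space of left integrals. -/
noncomputable def leftInt : Submodule k K := invts (regRep k K)

theorem mem_leftInt (x : K) : x ∈ leftInt k K ↔ ∀ a, a * x = counit (R := k) a • x := Iff.rfl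

end Rep

section Rep

variable {k K : Type} [Field k] [Ring K] [HopfAlgebra k K]
  {M N P : Type} [AddCommGroup M] [Module k M] [AddCommGroup N] [Module k N]
  [AddCommGroup P] [Module k P]

theorem Intertwines.mem_invts {ρ : K →ₐ[k] Module.End k M} {σ : K →ₐ[k] Module.End k N}
    {f : M →ₗ[k] N} (hf : Intertwines ρ σ f) {m : M} (hm : m ∈ invts ρ) : f m ∈ invts σ := by
  intro a
  rw [← hf, hm a, map_smul]

theorem finrank_invts_equiv {ρ : K →ₐ[k] Module.End k M} {σ : K →ₐ[k] Module.End k N}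
    (e : M ≃ₗ[k] N) (h : Intertwines ρ σ e.toLinearMap) :
    Module.finrank k (invts ρ) = Module.finrank k (invts σ) := by
  have : (invts ρ).map e.toLinearMap = invts σ := by
    ext n
    constructor
    · rintro ⟨m, hm, rfl⟩
      exact h.mem_invts hm
    · intro hn
      refine ⟨e.symm n, fun a => e.injective ?_, by simp⟩
      have := h a (e.symm n)
      simp only [LinearEquiv.coe_coe, LinearEquiv.apply_symm_apply] at this
      rw [this, hn a]
      simp
  rw [← this]
  exact (LinearEquiv.finrank_map_eq e _).symm

theorem finrank_invts_rtriv [FiniteDimensional k M] [FiniteDimensional k N]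
    (ρ : K →ₐ[k] Module.End k M) :
    Module.finrank k (invts (rtriv ρ N)) = Module.finrank k (invts ρ) * Module.finrank k N := by
  apply le_antisymm
  · let b := Module.finBasis k N
    let e := TensorProduct.equivFinsuppOfBasisRight (M := M) b
    have key : ∀ a z i, e (rtriv ρ N a z) i = ρ a (e z i) := by
      intro a z i
      induction z with
      | zero => simp
      | add x y hx hy => simp only [map_add, Finsupp.add_apply, hx, hy]
      | tmul x y => simp [e, rtriv_apply]
    let f : invts (rtriv ρ N) →ₗ[k] (Fin (Module.finrank k N) → invts ρ) :=
      LinearMap.pi fun i => (Finsupp.lapply i ∘ₗ e.toLinearMap).restrict (by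
        intro z hz a
        simp only [LinearMap.comp_apply, LinearEquiv.coe_coe, Finsupp.lapply_apply]
        rw [← key, hz a]
        simp)
    have hf : Function.Injective f := by
      intro z w hzw
      apply Subtype.ext
      apply e.injective
      ext i
      exact congrArg Subtype.val (congrFun hzw i)
    refine (LinearMap.finrank_le_finrank_of_injective hf).trans ?_
    rw [Module.finrank_pi_fintype]
    simp [mul_comm]
  · rw [← Module.finrank_tensorProduct]
    let f : (invts ρ) ⊗[k] N →ₗ[k] invts (rtriv ρ N) :=
      LinearMap.codRestrict _ ((invts ρ).subtype.rTensor N) (by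
        intro z a
        induction z with
        | zero => simp
        | add x y hx hy => simp only [map_add, hx, hy, smul_add]
        | tmul x y =>
          simp only [LinearMap.rTensor_tmul, Submodule.subtype_apply, rtriv_apply]
          rw [x.2 a, TensorProduct.smul_tmul'])
    have hf : Function.Injective f := by
      intro z w hzw
      apply Module.Flat.rTensor_preserves_injective_linearMap (M := N) (invts ρ).subtype
        Subtype.val_injective
      exact congrArg Subtype.val hzw
    exact LinearMap.finrank_le_finrank_of_injective hf

/-- The coregular representation on the dual. -/
noncomputable def coregRep : K →ₐ[k] Module.End k (Module.Dual k K) :=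
  AlgHom.ofLinearMap
    ((LinearMap.llcomp k K K k).flip ∘ₗ (LinearMap.mul k K) ∘ₗ antipode k)
    (by ext f x; simp)
    (by intro a b; ext f x; simp [HopfAlgebra.antipode_mul_antidistrib, mul_assoc])

theorem coregRep_apply (a : K) (f : Module.Dual k K) (x : K) :
    coregRep a f x = f (antipode k a * x) := rfl

/-- The operator attached to a tensor. -/
noncomputable def tensOp [FiniteDimensional k K] :
    K ⊗[k] Module.Dual k K ≃ₗ[k] Module.End k K :=
  (TensorProduct.comm k _ _).trans (dualTensorHomEquiv k K K)

theorem tensOp_tmul [FiniteDimensional k K] (a : K) (f : Module.Dual k K) (x : K) :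
    tensOp (a ⊗ₜ f) x = f x • a := by
  simp [tensOp]

/-- The two-sided operation `T ↦ a T(S(b) x)`. -/
noncomputable def opAct (T : Module.End k K) (x : K) : K ⊗[k] K →ₗ[k] K :=
  TensorProduct.lift ((LinearMap.mul k K).compl₂
    (T ∘ₗ LinearMap.mulRight k x ∘ₗ antipode k))

theorem opAct_tmul (T : Module.End k K) (x a b : K) :
    opAct T x (a ⊗ₜ b) = a * T (antipode k b * x) := by
  simp [opAct]

theorem tensOp_tens [FiniteDimensional k K] (a : K) (z : K ⊗[k] Module.Dual k K) (x : K) :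
    tensOp (tens (regRep k K) coregRep a z) x = opAct (tensOp z) x (comul a) := by
  rw [tens_apply]
  induction comul (R := k) a with
  | zero => simp
  | add c d hc hd => simp only [map_add, LinearMap.add_apply, hc, hd]
  | tmul c d =>
    rw [tens2_tmul, opAct_tmul]
    induction z with
    | zero => simp
    | add u v hu hv => simp only [map_add, LinearMap.add_apply, hu, hv, mul_add]
    | tmul u v =>
      simp [tensOp_tmul, regRep_apply, coregRep_apply]

theorem opAct_iff (T : Module.End k K) :
    (∀ a x, opAct T x (comul a) = counit (R := k) a • T x) ↔ ∀ a x, T (a * x) = a * T x := by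
  constructor
  · intro h a x
    let G : K ⊗[k] (K ⊗[k] K) →ₗ[k] K :=
      TensorProduct.lift ((LinearMap.mul k K).compl₂
        (T ∘ₗ LinearMap.mulRight k x ∘ₗ LinearMap.mul' k K ∘ₗ (antipode k).rTensor K))
    have hG : ∀ a b c, G (a ⊗ₜ (b ⊗ₜ c)) = a * T (antipode k b * c * x) := by
      intro a b c; simp [G]
    have h1 : ∀ z : K ⊗[k] K, G ((comul (R := k)).lTensor K z) =
        LinearMap.mulRight k (T x) (TensorProduct.rid k K ((counit (R := k)).lTensor K z)) := by
      intro z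
      induction z with
      | zero => simp
      | add u v hu hv => simp only [map_add, hu, hv]
      | tmul u v =>
        have : ∀ w : K ⊗[k] K, G (u ⊗ₜ w) =
            u * T (LinearMap.mul' k K ((antipode k).rTensor K w) * x) := by
          intro w; simp [G]
        rw [LinearMap.lTensor_tmul, this, mul_antipode_rTensor_comul_apply]
        simp [Algebra.algebraMap_eq_smul_one]
    have h2 : ∀ z : K ⊗[k] K,
        G (TensorProduct.assoc k K K K ((comul (R := k)).rTensor K z)) =
        T (TensorProduct.lid k K ((counit (R := k)).rTensor K z) * x) := by
      intro z
      induction z with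
      | zero => simp
      | add u v hu hv => simp only [map_add, hu, hv, add_mul]
      | tmul u v =>
        have : ∀ w : K ⊗[k] K, G (TensorProduct.assoc k K K K (w ⊗ₜ v)) =
            opAct T (v * x) w := by
          intro w
          induction w with
          | zero => simp
          | add u v hu hv => simp only [TensorProduct.add_tmul, map_add, hu, hv]
          | tmul a b => simp [hG, opAct_tmul, mul_assoc]
        rw [LinearMap.rTensor_tmul, this, h]
        simp
    have h3 := h2 (comul a)
    rw [coassoc_apply, h1, rTensor_counit_comul, lTensor_counit_comul] at h3
    simpa using h3.symm
  · intro h a x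
    have h1 : ∀ z : K ⊗[k] K, opAct T x z =
        LinearMap.mul' k K ((antipode k).lTensor K z) * T x := by
      intro z
      induction z with
      | zero => simp
      | add u v hu hv => simp only [map_add, hu, hv, add_mul]
      | tmul u v => simp [opAct_tmul, h, mul_assoc]
    rw [h1, mul_antipode_lTensor_comul_apply]
    simp [Algebra.algebraMap_eq_smul_one]

theorem tensOp_mem_invts [FiniteDimensional k K] (z : K ⊗[k] Module.Dual k K) :
    z ∈ invts (tens (regRep k K) coregRep) ↔ ∀ a x, tensOp z (a * x) = a * tensOp z x := by
  rw [← opAct_iff]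
  constructor
  · intro h a x
    rw [← tensOp_tens, h a, map_smul, LinearMap.smul_apply]
  · intro h a
    apply tensOp.injective
    ext x
    rw [tensOp_tens, h, map_smul, LinearMap.smul_apply]

theorem finrank_invts_coreg [FiniteDimensional k K] :
    Module.finrank k (invts (tens (regRep k K) (coregRep (k := k) (K := K)))) =
      Module.finrank k K := by
  apply le_antisymm
  · let f : invts (tens (regRep k K) (coregRep (k := k) (K := K))) →ₗ[k] K :=
      (LinearMap.applyₗ (R := k) (1 : K)) ∘ₗ tensOp.toLinearMap ∘ₗ Submodule.subtype _
    refine LinearMap.finrank_le_finrank_of_injective (f := f) ?_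
    intro z w hzw
    apply Subtype.ext
    apply tensOp.injective
    ext x
    have h1 := (tensOp_mem_invts z.1).1 z.2 x 1
    have h2 := (tensOp_mem_invts w.1).1 w.2 x 1
    rw [mul_one] at h1 h2
    rw [h1, h2]
    exact congrArg (x * ·) hzw
  · let f : K →ₗ[k] invts (tens (regRep k K) (coregRep (k := k) (K := K))) :=
      LinearMap.codRestrict _ (tensOp.symm.toLinearMap ∘ₗ (LinearMap.mul k K).flip) (by
        intro c
        rw [tensOp_mem_invts]
        intro a x
        simp [mul_assoc])
    refine LinearMap.finrank_le_finrank_of_injective (f := f) ?_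
    intro z w hzw
    have := tensOp.symm.injective (congrArg Subtype.val hzw)
    simpa using LinearMap.congr_fun this 1

theorem finrank_leftInt [FiniteDimensional k K] [Nontrivial K] :
    Module.finrank k (leftInt k K) = 1 := by
  have h1 := finrank_invts_equiv _ (twistEquiv_intertwines (coregRep (k := k) (K := K)))
  rw [finrank_invts_coreg, finrank_invts_rtriv, Subspace.dual_finrank_eq] at h1
  have : 0 < Module.finrank k K := Module.finrank_pos
  exact Nat.eq_of_mul_eq_mul_right this (by rw [one_mul]; exact h1)

theorem exists_leftInt [FiniteDimensional k K] [Nontrivial K] :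
    ∃ Λ ∈ leftInt k K, Λ ≠ 0 ∧ ∀ x ∈ leftInt k K, ∃ c : k, c • Λ = x := by
  obtain ⟨v, hv, h⟩ := finrank_eq_one_iff'.1 (finrank_leftInt (k := k) (K := K))
  refine ⟨v, v.2, fun h => hv (Subtype.ext h), fun x hx => ?_⟩
  obtain ⟨c, hc⟩ := h ⟨x, hx⟩
  exact ⟨c, congrArg Subtype.val hc⟩

theorem antipode_surjective [FiniteDimensional k K] [Nontrivial K] :
    Function.Surjective (antipode k : K →ₗ[k] K) := by
  obtain ⟨Λ, hΛ, hΛ0, -⟩ := exists_leftInt (k := k) (K := K)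
  rw [← LinearMap.range_eq_top]
  by_contra hne
  obtain ⟨φ, hφ, hφ'⟩ := Submodule.exists_dual_map_eq_bot_of_lt_top
    (lt_top_iff_ne_top.2 hne) inferInstance
  have hφ0 : ∀ x, φ (antipode k x) = 0 := by
    intro x
    have : φ (antipode k x) ∈ (LinearMap.range (antipode k : K →ₗ[k] K)).map φ :=
      ⟨_, ⟨x, rfl⟩, rfl⟩
    rw [hφ'] at this
    simpa using this
  have h1 : Λ ⊗ₜ[k] φ ∈ invts (rtriv (regRep k K) (Module.Dual k K)) := by
    intro a
    rw [rtriv_apply, LinearMap.rTensor_tmul, hΛ a, TensorProduct.smul_tmul']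
  have h2 := (twistEquiv_intertwines (coregRep (k := k) (K := K))).mem_invts h1
  rw [LinearEquiv.coe_coe, tensOp_mem_invts] at h2
  have h3 : tensOp (twistEquiv coregRep (Λ ⊗ₜ[k] φ)) 1 = 0 := by
    rw [twistEquiv_apply, twistL_tmul]
    induction comul (R := k) Λ with
    | zero => simp
    | add a b ha hb => simp only [map_add, LinearMap.add_apply, ha, hb, add_zero]
    | tmul a b =>
      rw [LinearMap.lTensor_tmul, tensOp_tmul, LinearMap.flip_apply]
      simp [coregRep_apply, hφ0]
  have h4 : twistEquiv coregRep (Λ ⊗ₜ[k] φ) = 0 := by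
    apply tensOp.injective
    ext x
    have := h2 x 1
    rw [mul_one, h3, mul_zero] at this
    simp [this]
  rw [LinearEquiv.map_eq_zero_iff] at h4
  obtain ⟨y, hy⟩ : ∃ y, φ y ≠ 0 := by
    by_contra! h
    exact hφ (LinearMap.ext h)
  have h5 := congrArg (fun z => tensOp z y) h4
  simp only [tensOp_tmul, map_zero, LinearMap.zero_apply] at h5
  exact (smul_ne_zero hy hΛ0) h5

theorem antipode_bijective [FiniteDimensional k K] [Nontrivial K] :
    Function.Bijective (antipode k : K →ₗ[k] K) :=
  ⟨LinearMap.injective_iff_surjective.2 antipode_surjective, antipode_surjective⟩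

end Rep

section Rep

variable {k K : Type} [Field k] [Ring K] [HopfAlgebra k K]
  {M N P Q : Type} [AddCommGroup M] [Module k M] [AddCommGroup N] [Module k N]
  [AddCommGroup P] [Module k P] [AddCommGroup Q] [Module k Q]

theorem Intertwines.comp {ρ : K →ₐ[k] Module.End k M} {σ : K →ₐ[k] Module.End k N}
    {τ : K →ₐ[k] Module.End k P} {f : M →ₗ[k] N} {g : N →ₗ[k] P}
    (hg : Intertwines σ τ g) (hf : Intertwines ρ σ f) : Intertwines ρ τ (g ∘ₗ f) := by
  intro a m
  simp [hf a m, hg a]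

theorem Intertwines.symm {ρ : K →ₐ[k] Module.End k M} {σ : K →ₐ[k] Module.End k N}
    {e : M ≃ₗ[k] N} (h : Intertwines ρ σ e.toLinearMap) :
    Intertwines σ ρ e.symm.toLinearMap := by
  intro a m
  apply e.injective
  have := h a (e.symm m)
  simp only [LinearEquiv.coe_coe, LinearEquiv.apply_symm_apply] at this ⊢
  exact this.symm

theorem Intertwines.tens {ρ : K →ₐ[k] Module.End k M} {σ : K →ₐ[k] Module.End k N}
    {ρ' : K →ₐ[k] Module.End k P} {σ' : K →ₐ[k] Module.End k Q}
    {f : M →ₗ[k] N} {g : P →ₗ[k] Q} (hf : Intertwines ρ σ f) (hg : Intertwines ρ' σ' g) :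
    Intertwines (tens ρ ρ') (tens σ σ') (TensorProduct.map f g) := by
  intro a z
  rw [tens_apply, tens_apply]
  induction comul (R := k) a with
  | zero => simp
  | add c d hc hd => simp only [map_add, LinearMap.add_apply, hc, hd]
  | tmul c d =>
    induction z with
    | zero => simp
    | add u v hu hv => simp only [map_add, hu, hv]
    | tmul u v =>
      simp [tens2_tmul, hf c u, hg d v]

theorem intertwines_id (ρ : K →ₐ[k] Module.End k M) : Intertwines ρ ρ LinearMap.id :=
  fun _ _ => rfl

theorem intertwines_assoc (ρ : K →ₐ[k] Module.End k M) (σ : K →ₐ[k] Module.End k N)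
    (τ : K →ₐ[k] Module.End k P) :
    Intertwines (tens (tens ρ σ) τ) (tens ρ (tens σ τ))
      (TensorProduct.assoc k M N P).toLinearMap := by
  intro a z
  rw [tens_apply, tens_apply]
  let G : K ⊗[k] (K ⊗[k] K) →ₗ[k] Module.End k (M ⊗[k] (N ⊗[k] P)) :=
    (Module.endTensorEndAlgHom (R := k) (S := k) (A := k)).toLinearMap ∘ₗ
      TensorProduct.map ρ.toLinearMap (tens2 σ τ).toLinearMap
  have hG : ∀ a w, G (a ⊗ₜ w) = TensorProduct.map (ρ a) (tens2 σ τ w) := fun a w => rfl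
  have h1 : ∀ w : K ⊗[k] K, tens2 ρ (tens σ τ) w = G ((comul (R := k)).lTensor K w) := by
    intro w
    induction w with
    | zero => simp
    | add u v hu hv => simp only [map_add, hu, hv]
    | tmul u v => rw [LinearMap.lTensor_tmul, hG, tens2_tmul, tens_apply]
  have h2 : ∀ w : K ⊗[k] K,
      (TensorProduct.assoc k M N P).toLinearMap ∘ₗ tens2 (tens ρ σ) τ w =
      G (TensorProduct.assoc k K K K ((comul (R := k)).rTensor K w)) ∘ₗ
        (TensorProduct.assoc k M N P).toLinearMap := by
    intro w
    induction w with
    | zero => simp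
    | add u v hu hv => simp only [map_add, LinearMap.comp_add, LinearMap.add_comp, hu, hv]
    | tmul u v =>
      rw [LinearMap.rTensor_tmul, tens2_tmul, tens_apply]
      induction comul (R := k) u with
      | zero => simp
      | add c d hc hd =>
        simp only [map_add, TensorProduct.map_add_left, TensorProduct.add_tmul,
          LinearMap.comp_add, LinearMap.add_comp, hc, hd]
      | tmul c d =>
        rw [TensorProduct.assoc_tmul, hG, tens2_tmul, tens2_tmul]
        refine TensorProduct.ext_threefold fun x y z => ?_
        simp
  rw [h1, ← coassoc_apply]
  exact LinearMap.congr_fun (h2 _) z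

theorem intertwines_assoc_rtriv (ρ : K →ₐ[k] Module.End k M) (σ : K →ₐ[k] Module.End k N) :
    Intertwines (rtriv (tens ρ σ) P) (tens ρ (rtriv σ P))
      (TensorProduct.assoc k M N P).toLinearMap := by
  intro a z
  rw [tens_apply, rtriv_apply, tens_apply]
  induction comul (R := k) a with
  | zero => simp
  | add c d hc hd =>
    simp only [map_add, LinearMap.rTensor_add, LinearMap.add_apply, hc, hd]
  | tmul c d =>
    rw [tens2_tmul, tens2_tmul, rtriv_apply]
    refine LinearMap.congr_fun (f := (TensorProduct.assoc k M N P).toLinearMap ∘ₗ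
      (TensorProduct.map (ρ c) (σ d)).rTensor P)
      (g := TensorProduct.map (ρ c) ((σ d).rTensor P) ∘ₗ
        (TensorProduct.assoc k M N P).toLinearMap) ?_ z
    refine TensorProduct.ext_threefold fun x y z => ?_
    simp

/-- If `Z ⊗ W` is a multiple of `Z`, then `(Y ⊗ Z) ⊗ W` is a multiple of `Y ⊗ Z`. -/
theorem exists_untwist {ρ : K →ₐ[k] Module.End k M} {σ : K →ₐ[k] Module.End k N}
    {τ : K →ₐ[k] Module.End k P} (e : N ⊗[k] P ≃ₗ[k] N ⊗[k] P)
    (he : Intertwines (rtriv σ P) (tens σ τ) e.toLinearMap) :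
    ∃ e' : (M ⊗[k] N) ⊗[k] P ≃ₗ[k] (M ⊗[k] N) ⊗[k] P,
      Intertwines (rtriv (tens ρ σ) P) (tens (tens ρ σ) τ) e'.toLinearMap := by
  refine ⟨(TensorProduct.assoc k M N P).trans
    ((TensorProduct.congr (LinearEquiv.refl k M) e).trans (TensorProduct.assoc k M N P).symm), ?_⟩
  exact (intertwines_assoc ρ σ τ).symm.comp
    (((intertwines_id ρ).tens he).comp (intertwines_assoc_rtriv ρ σ))

section Right

variable [FiniteDimensional k K] [Nontrivial K]

variable (k K) in
/-- The inverse of the antipode of a finite-dimensional Hopf algebra. -/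
noncomputable def antipodeEquiv : K ≃ₗ[k] K :=
  LinearEquiv.ofBijective (antipode k) antipode_bijective

theorem antipode_symm (x : K) : antipode k ((antipodeEquiv k K).symm x) = x :=
  (antipodeEquiv k K).apply_symm_apply x

theorem sum_antipode_symm (x : K) :
    LinearMap.mul' k K ((antipodeEquiv k K).symm.toLinearMap.rTensor K
      (TensorProduct.comm k K K (comul x))) = algebraMap k K (counit x) := by
  apply antipode_bijective (k := k) (K := K) |>.1
  have : ∀ z : K ⊗[k] K, antipode k (LinearMap.mul' k K
      ((antipodeEquiv k K).symm.toLinearMap.rTensor K (TensorProduct.comm k K K z))) =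
      LinearMap.mul' k K ((antipode k).rTensor K z) := by
    intro z
    induction z with
    | zero => simp
    | add u v hu hv => simp only [map_add, hu, hv]
    | tmul u v => simp [antipode_mul_antidistrib, antipode_symm]
  rw [this, mul_antipode_rTensor_comul_apply]
  simp [Algebra.algebraMap_eq_smul_one]

/-- The map `x ⊗ y ↦ x₁ y ⊗ x₂`. -/
noncomputable def twistR (ρ : K →ₐ[k] Module.End k M) : K ⊗[k] M →ₗ[k] M ⊗[k] K :=
  TensorProduct.lift (LinearMap.lcomp k (M ⊗[k] K) (comul (R := k) (A := K)) ∘ₗ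
    LinearMap.rTensorHom K ∘ₗ ρ.toLinearMap.flip).flip

omit [FiniteDimensional k K] [Nontrivial K] in
theorem twistR_tmul (ρ : K →ₐ[k] Module.End k M) (x : K) (m : M) :
    twistR ρ (x ⊗ₜ m) = (ρ.toLinearMap.flip m).rTensor K (comul x) := by
  rfl

omit [FiniteDimensional k K] [Nontrivial K] in
theorem twistR_intertwines (ρ : K →ₐ[k] Module.End k M) :
    Intertwines (rtriv (regRep k K) M) (tens ρ (regRep k K)) (twistR ρ) := by
  intro a z
  induction z with
  | zero => simp
  | add u v hu hv => simp only [map_add, hu, hv]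
  | tmul x m =>
    simp only [rtriv_apply, LinearMap.rTensor_tmul, regRep_apply,
      twistR_tmul, tens_apply, Bialgebra.comul_mul]
    induction comul (R := k) a with
    | zero => simp
    | add a b ha hb => simp only [add_mul, map_add, ha, hb, LinearMap.add_apply]
    | tmul a b =>
      induction comul (R := k) x with
      | zero => simp
      | add a b ha hb => simp only [mul_add, map_add, ha, hb]
      | tmul c d => simp [tens2_tmul, regRep_apply]

theorem twistR_injective (ρ : K →ₐ[k] Module.End k M) : Function.Injective (twistR ρ) := by
  let T := (antipodeEquiv k K).symm.toLinearMap
  let C : M ⊗[k] K →ₗ[k] K ⊗[k] M :=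
    (TensorProduct.comm k M K).toLinearMap ∘ₗ
      TensorProduct.lift ((LinearMap.lcomp k (M ⊗[k] K) (comul (R := k) (A := K))) ∘ₗ
      LinearMap.rTensorHom K ∘ₗ (ρ.toLinearMap ∘ₗ T).flip)
  have hC : ∀ m x, C (m ⊗ₜ x) = TensorProduct.comm k M K
      (((ρ.toLinearMap ∘ₗ T).flip m).rTensor K (comul x)) := fun m x => rfl
  suffices h : C ∘ₗ twistR ρ = LinearMap.id by
    exact Function.LeftInverse.injective (g := C) (fun z => LinearMap.congr_fun h z)
  refine TensorProduct.ext' fun x m => ?_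
  rw [LinearMap.comp_apply, twistR_tmul]
  let G : K ⊗[k] (K ⊗[k] K) →ₗ[k] K ⊗[k] M :=
    (TensorProduct.comm k M K).toLinearMap ∘ₗ
    (ρ.toLinearMap.flip m ∘ₗ LinearMap.mul' k K ∘ₗ T.rTensor K ∘ₗ
      (TensorProduct.comm k K K).toLinearMap).rTensor K ∘ₗ
      (TensorProduct.assoc k K K K).symm.toLinearMap
  have hG : ∀ z c, G (TensorProduct.assoc k K K K (z ⊗ₜ c)) = c ⊗ₜ ρ (LinearMap.mul' k K (T.rTensor K
      (TensorProduct.comm k K K z))) m := by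
    intro z c
    simp [G]
  have h1 : ∀ z : K ⊗[k] K, C ((ρ.toLinearMap.flip m).rTensor K z) =
      G ((comul (R := k)).lTensor K z) := by
    intro z
    induction z with
    | zero => simp
    | add u v hu hv => simp only [map_add, hu, hv]
    | tmul u v =>
      rw [LinearMap.rTensor_tmul, LinearMap.lTensor_tmul, hC]
      induction comul (R := k) v with
      | zero => simp
      | add c d hc hd => simp only [TensorProduct.tmul_add, map_add, hc, hd]
      | tmul c d =>
        have := hG (u ⊗ₜ c) d
        rw [TensorProduct.assoc_tmul] at this
        rw [this]
        simp
  have h2 : ∀ z : K ⊗[k] K, G (TensorProduct.assoc k K K K ((comul (R := k)).rTensor K z)) =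
      (TensorProduct.lid k K ((counit (R := k)).rTensor K z)) ⊗ₜ m := by
    intro z
    induction z with
    | zero => simp
    | add u v hu hv => simp only [map_add, hu, hv, TensorProduct.add_tmul]
    | tmul u v =>
      rw [LinearMap.rTensor_tmul, hG, sum_antipode_symm]
      simp [Algebra.algebraMap_eq_smul_one, TensorProduct.smul_tmul]
  rw [h1, ← coassoc_apply, h2, rTensor_counit_comul]
  simp

/-- `M ⊗ K` is isomorphic to a multiple of the regular representation. -/
noncomputable def twistREquiv [FiniteDimensional k M] (ρ : K →ₐ[k] Module.End k M) :
    K ⊗[k] M ≃ₗ[k] M ⊗[k] K :=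
  LinearEquiv.ofInjectiveOfFinrankEq (twistR ρ) (twistR_injective ρ)
    (by simp [mul_comm])

theorem twistREquiv_intertwines [FiniteDimensional k M] (ρ : K →ₐ[k] Module.End k M) :
    Intertwines (rtriv (regRep k K) M) (tens ρ (regRep k K)) (twistREquiv ρ).toLinearMap :=
  twistR_intertwines ρ

end Right

end Rep

section NZ

variable {k K : Type} [Field k] [Ring K] [HopfAlgebra k K]

variable (k K) in
/-- A superadditive measure of the multiplicity of the regular representation. -/
structure SizeFn where
  size : ∀ (M : Type) [AddCommGroup M] [Module k M] (_ : K →ₐ[k] Module.End k M), ℝ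
  reg : ℝ
  size_regRep : size K (regRep k K) = reg
  size_equiv : ∀ {M N : Type} [AddCommGroup M] [Module k M] [AddCommGroup N] [Module k N]
    (ρ : K →ₐ[k] Module.End k M) (σ : K →ₐ[k] Module.End k N) (e : M ≃ₗ[k] N),
    Intertwines ρ σ e.toLinearMap → size M ρ = size N σ
  size_rtriv : ∀ {M N : Type} [AddCommGroup M] [Module k M] [AddCommGroup N] [Module k N]
    [FiniteDimensional k M] [FiniteDimensional k N] (ρ : K →ₐ[k] Module.End k M),
    size (M ⊗[k] N) (rtriv ρ N) = size M ρ * Module.finrank k N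
  size_exact : ∀ {M N P : Type} [AddCommGroup M] [Module k M] [AddCommGroup N] [Module k N]
    [AddCommGroup P] [Module k P] [FiniteDimensional k N]
    (ρ : K →ₐ[k] Module.End k M) (σ : K →ₐ[k] Module.End k N) (τ : K →ₐ[k] Module.End k P)
    (f : M →ₗ[k] N) (g : N →ₗ[k] P), Function.Injective f → Function.Surjective g →
    Function.Exact f g → Intertwines ρ σ f → Intertwines σ τ g →
    size M ρ + size P τ ≤ size N σ
  size_lower : ∀ {M : Type} [AddCommGroup M] [Module k M] [FiniteDimensional k M]
    (ρ : K →ₐ[k] Module.End k M), -(Module.finrank k M : ℝ) ≤ size M ρ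

variable {F : Type} [Ring F] [HopfAlgebra k F]

/-- Restriction of the regular representation along a bialgebra map. -/
noncomputable def resReg (i : K →ₐc[k] F) : K →ₐ[k] Module.End k F :=
  (regRep k F).comp (i : K →ₐ[k] F)

theorem resReg_apply (i : K →ₐc[k] F) (a : K) (x : F) : resReg i a x = i a * x := rfl

theorem tens_comp {M N : Type} [AddCommGroup M] [Module k M] [AddCommGroup N] [Module k N]
    (i : K →ₐc[k] F) (ρ : F →ₐ[k] Module.End k M) (σ : F →ₐ[k] Module.End k N) (a : K) :
    tens (ρ.comp (i : K →ₐ[k] F)) (σ.comp (i : K →ₐ[k] F)) a = tens ρ σ (i a) := by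
  rw [tens_apply, tens_apply, ← CoalgHomClass.map_comp_comul_apply]
  induction comul (R := k) a with
  | zero => simp
  | add a b ha hb => simp only [map_add, ha, hb]
  | tmul a b => rfl

/-- The quotient of the restricted regular representation by the image. -/
noncomputable def quotReg (i : K →ₐc[k] F) :
    K →ₐ[k] Module.End k (F ⧸ LinearMap.range (i : K →ₐ[k] F).toLinearMap) :=
  AlgHom.ofLinearMap
    { toFun := fun a => Submodule.mapQ _ _ (resReg i a) (by
        rintro _ ⟨b, rfl⟩
        exact ⟨a * b, by simp [resReg_apply]⟩)
      map_add' := by intro a b; apply Submodule.linearMap_qext; ext x; simp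
      map_smul' := by intro a b; apply Submodule.linearMap_qext; ext x; simp }
    (by apply Submodule.linearMap_qext; ext x; simp)
    (by intro a b; apply Submodule.linearMap_qext; ext x; simp)

theorem mkQ_intertwines (i : K →ₐc[k] F) :
    Intertwines (resReg i) (quotReg i)
      (LinearMap.range (i : K →ₐ[k] F).toLinearMap).mkQ := fun _ _ => rfl

theorem incl_intertwines (i : K →ₐc[k] F) :
    Intertwines (regRep k K) (resReg i) (i : K →ₐ[k] F).toLinearMap := by
  intro a x
  simp [resReg_apply, regRep_apply]

variable [FiniteDimensional k K] [Nontrivial K] [FiniteDimensional k F] [Nontrivial F]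

theorem SizeFn.step (s : SizeFn k K) (i : K →ₐc[k] F) (hi : Function.Injective i)
    {Y : Type} [AddCommGroup Y] [Module k Y] [FiniteDimensional k Y]
    (ρ : K →ₐ[k] Module.End k Y) :
    s.reg * Module.finrank k Y * Module.finrank k F +
      s.size _ (tens (tens ρ (quotReg i)) (resReg i)) ≤
      s.size _ (tens ρ (resReg i)) * Module.finrank k F := by
  have h1 : s.size _ (tens (tens ρ (regRep k K)) (resReg i)) =
      s.reg * Module.finrank k Y * Module.finrank k F := by
    obtain ⟨e, he⟩ := exists_untwist (ρ := ρ) (twistEquiv (resReg i))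
      (twistEquiv_intertwines (resReg i))
    rw [← s.size_equiv _ _ e he, s.size_rtriv,
      ← s.size_equiv _ _ _ (twistREquiv_intertwines ρ), s.size_rtriv, s.size_regRep]
  have h2 : s.size _ (tens (tens ρ (resReg i)) (resReg i)) =
      s.size _ (tens ρ (resReg i)) * Module.finrank k F := by
    have hInt : Intertwines (rtriv (resReg i) F) (tens (resReg i) (resReg i))
        (twistEquiv (regRep k F)).toLinearMap := by
      intro a z
      have := twistEquiv_intertwines (regRep k F) (i a) z
      rw [← tens_comp] at this
      exact this
    obtain ⟨e, he⟩ := exists_untwist (ρ := ρ) (twistEquiv (regRep k F)) hInt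
    rw [← s.size_equiv _ _ e he, s.size_rtriv]
  rw [← h1, ← h2]
  have hex : Function.Exact (i : K →ₐ[k] F).toLinearMap
      (LinearMap.range (i : K →ₐ[k] F).toLinearMap).mkQ :=
    LinearMap.exact_map_mkQ_range _
  have hs := Submodule.mkQ_surjective (LinearMap.range (i : K →ₐ[k] F).toLinearMap)
  refine s.size_exact _ _ _
    (((i : K →ₐ[k] F).toLinearMap.lTensor Y).rTensor F)
    (((LinearMap.range (i : K →ₐ[k] F).toLinearMap).mkQ.lTensor Y).rTensor F) ?_ ?_ ?_ ?_ ?_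
  · exact Module.Flat.rTensor_preserves_injective_linearMap _
      (Module.Flat.lTensor_preserves_injective_linearMap _ hi)
  · exact LinearMap.rTensor_surjective _ (LinearMap.lTensor_surjective _ hs)
  · exact rTensor_exact _ (lTensor_exact _ hex hs) (LinearMap.lTensor_surjective _ hs)
  · exact (((intertwines_id ρ).tens (incl_intertwines i)).tens (intertwines_id _))
  · exact (((intertwines_id ρ).tens (mkQ_intertwines i)).tens (intertwines_id _))

theorem SizeFn.le_size (s : SizeFn k K) (i : K →ₐc[k] F) (hi : Function.Injective i) :
    s.reg * Module.finrank k F ≤ s.size F (resReg i) * Module.finrank k K := by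
  set N : ℝ := ((Module.finrank k F : ℕ) : ℝ) with hN
  set κ : ℝ := ((Module.finrank k K : ℕ) : ℝ) with hκ
  have hN0 : 0 < N := by rw [hN]; exact_mod_cast Module.finrank_pos
  have hκ0 : 0 < κ := by rw [hκ]; exact_mod_cast Module.finrank_pos
  have hκN : Module.finrank k K ≤ Module.finrank k F :=
    LinearMap.finrank_le_finrank_of_injective (f := (i : K →ₐ[k] F).toLinearMap) hi
  have hκN' : κ ≤ N := by rw [hN, hκ]; exact_mod_cast hκN
  have hquot : (Module.finrank k (F ⧸ LinearMap.range (i : K →ₐ[k] F).toLinearMap) : ℝ) = N - κ := by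
    have h := Submodule.finrank_quotient_add_finrank (LinearMap.range (i : K →ₐ[k] F).toLinearMap)
    rw [LinearMap.finrank_range_of_inj (f := (i : K →ₐ[k] F).toLinearMap) hi] at h
    rw [hN, hκ, ← h]
    push_cast
    ring
  have key : ∀ n : ℕ, ∀ (Y : Type) [AddCommGroup Y] [Module k Y] [FiniteDimensional k Y]
      (ρ : K →ₐ[k] Module.End k Y),
      (s.reg * N / κ + (1 - κ / N) ^ n * (-N - s.reg * N / κ)) * Module.finrank k Y ≤
        s.size _ (tens ρ (resReg i)) := by
    intro n
    induction n with
    | zero =>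
      intro Y _ _ _ ρ
      have := s.size_lower (tens ρ (resReg i))
      rw [Module.finrank_tensorProduct] at this
      push_cast at this
      rw [← hN] at this
      refine le_trans (le_of_eq ?_) this
      ring
    | succ n ih =>
      intro Y _ _ _ ρ
      have h1 := s.step i hi ρ
      have h2 := ih _ (tens ρ (quotReg i))
      rw [Module.finrank_tensorProduct] at h2
      push_cast at h2
      rw [hquot] at h2
      have h3 := (add_le_add_right h2 (s.reg * Module.finrank k Y * Module.finrank k F)).trans h1
      rw [← hN] at h3
      refine le_of_mul_le_mul_right (le_trans (le_of_eq ?_) h3) hN0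
      have hA : s.reg * N / κ * κ = s.reg * N := div_mul_cancel₀ _ hκ0.ne'
      have hq : (1 - κ / N) * N = N - κ := by rw [sub_mul, div_mul_cancel₀ _ hN0.ne', one_mul]
      generalize s.reg * N / κ = A at *
      generalize 1 - κ / N = q at *
      linear_combination Module.finrank k Y * hA +
        q ^ n * (-N - A) * Module.finrank k Y * hq
  have lim : Filter.Tendsto (fun n : ℕ => s.reg * N / κ + (1 - κ / N) ^ n * (-N - s.reg * N / κ))
      Filter.atTop (nhds (s.reg * N / κ + 0 * (-N - s.reg * N / κ))) := by
    refine tendsto_const_nhds.add (Filter.Tendsto.mul_const _ ?_)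
    apply tendsto_pow_atTop_nhds_zero_of_lt_one
    · rw [sub_nonneg, div_le_one hN0]; exact hκN'
    · have := div_pos hκ0 hN0
      linarith
  let tr : K →ₐ[k] Module.End k k :=
    (Algebra.lmul k k).comp (Bialgebra.counitAlgHom k K)
  have hlid : Intertwines (tens tr (resReg i)) (resReg i) (TensorProduct.lid k F).toLinearMap := by
    intro a z
    rw [tens_apply]
    have : ∀ w, TensorProduct.lid k F (tens2 tr (resReg i) w z) =
        resReg i (TensorProduct.lid k K ((counit (R := k)).rTensor K w))
          (TensorProduct.lid k F z) := by
      intro w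
      induction w with
      | zero => simp
      | add a b ha hb => simp only [map_add, LinearMap.add_apply, ha, hb]
      | tmul a b =>
        induction z with
        | zero => simp
        | add a b ha hb => simp only [map_add, ha, hb]
        | tmul u v =>
          simp only [tens2_tmul, TensorProduct.map_tmul, TensorProduct.lid_tmul,
            LinearMap.rTensor_tmul, map_smul, LinearMap.smul_apply, tr, AlgHom.comp_apply,
            Bialgebra.counitAlgHom_apply]
          exact mul_smul (counit (R := k) a) u _ |>.trans (smul_comm _ _ _)
    rw [LinearEquiv.coe_coe, this, rTensor_counit_comul]
    simp
  have hfin := le_of_tendsto' lim fun n => by simpa using key n k tr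
  rw [s.size_equiv _ _ _ hlid, zero_mul, add_zero, div_le_iff₀ hκ0] at hfin
  exact hfin

end NZ

section NZ

variable {k K : Type} [Field k] [Ring K] [HopfAlgebra k K]

theorem finrank_range_rTensor {M N P : Type} [AddCommGroup M] [Module k M] [AddCommGroup N]
    [Module k N] [AddCommGroup P] [Module k P] (f : M →ₗ[k] P) :
    Module.finrank k (LinearMap.range (f.rTensor N)) =
      Module.finrank k (LinearMap.range f) * Module.finrank k N := by
  have h : f.rTensor N = (LinearMap.range f).subtype.rTensor N ∘ₗ f.rangeRestrict.rTensor N := by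
    rw [← LinearMap.rTensor_comp]
    rfl
  rw [h, LinearMap.range_comp_of_range_eq_top, LinearMap.finrank_range_of_inj,
    Module.finrank_tensorProduct]
  · exact Module.Flat.rTensor_preserves_injective_linearMap _ Subtype.val_injective
  · exact LinearMap.range_eq_top.2 (LinearMap.rTensor_surjective _ f.surjective_rangeRestrict)

variable [FiniteDimensional k K] [Nontrivial K]

theorem finrank_span_eq_one {Λ : K} (hΛ : Λ ∈ leftInt k K) (h0 : Λ ≠ 0) :
    Module.finrank k (LinearMap.range (regRep k K Λ)) = 1 := by
  have h1 : LinearMap.range (regRep k K Λ) ≤ leftInt k K := by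
    rintro _ ⟨x, rfl⟩ a
    rw [regRep_apply, regRep_apply, ← mul_assoc, (mem_leftInt _).1 hΛ a, smul_mul_assoc]
  have h2 := Submodule.finrank_mono h1
  rw [finrank_leftInt] at h2
  refine le_antisymm h2 (Module.finrank_pos_iff_exists_ne_zero.2
    ⟨⟨Λ, 1, by rw [regRep_apply, mul_one]⟩, fun h => h0 (congrArg Subtype.val h)⟩)

/-- The rank of the action of a left integral. -/
noncomputable def rkSize (Λ : K) (hΛ : Λ ∈ leftInt k K) (h0 : Λ ≠ 0) : SizeFn k K where
  size M _ _ ρ := Module.finrank k (LinearMap.range (ρ Λ))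
  reg := 1
  size_regRep := by
    rw [finrank_span_eq_one hΛ h0, Nat.cast_one]
  size_equiv := by
    intro M N _ _ _ _ ρ σ e h
    have : σ Λ = e.toLinearMap ∘ₗ ρ Λ ∘ₗ e.symm.toLinearMap := by
      ext n
      simpa using (h Λ (e.symm n)).symm
    rw [this, LinearMap.range_comp, LinearMap.range_comp_of_range_eq_top _ (by simp)]
    exact_mod_cast (LinearEquiv.finrank_map_eq e _).symm
  size_rtriv := by
    intro M N _ _ _ _ _ _ ρ
    rw [rtriv_apply, finrank_range_rTensor]
    push_cast
    rfl
  size_exact := by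
    intro M N P _ _ _ _ _ _ _ ρ σ τ f g hf hg hfg hρ hσ
    have h1 : (LinearMap.range (ρ Λ)).map f ≤ LinearMap.range (σ Λ) := by
      rintro _ ⟨_, ⟨m, rfl⟩, rfl⟩
      exact ⟨f m, (hρ Λ m).symm⟩
    have h2 : (LinearMap.range (σ Λ)).map g = LinearMap.range (τ Λ) := by
      ext p
      constructor
      · rintro ⟨_, ⟨m, rfl⟩, rfl⟩
        exact ⟨g m, (hσ Λ m).symm⟩
      · rintro ⟨p, rfl⟩
        obtain ⟨n, rfl⟩ := hg p
        exact ⟨_, ⟨n, rfl⟩, hσ Λ n⟩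
    have h3 := LinearMap.finrank_range_add_finrank_ker (g.domRestrict (LinearMap.range (σ Λ)))
    rw [LinearMap.range_domRestrict, h2] at h3
    have h4 : Module.finrank k (LinearMap.range (ρ Λ)) ≤
        Module.finrank k (LinearMap.ker (g.domRestrict (LinearMap.range (σ Λ)))) := by
      have hm : ∀ x : LinearMap.range (ρ Λ), f x ∈ LinearMap.range (σ Λ) := fun x =>
        h1 ⟨x, x.2, rfl⟩
      let φ : LinearMap.range (ρ Λ) →ₗ[k] LinearMap.ker (g.domRestrict (LinearMap.range (σ Λ))) :=
        LinearMap.codRestrict _ (LinearMap.codRestrict _ (f.domRestrict _) hm) (by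
          intro x
          exact hfg.apply_apply_eq_zero x.1)
      refine LinearMap.finrank_le_finrank_of_injective (f := φ) ?_
      intro x y hxy
      apply Subtype.ext
      apply hf
      exact congrArg (fun z => z.1.1) hxy
    have h5 : Module.finrank k (LinearMap.range (ρ Λ)) + Module.finrank k (LinearMap.range (τ Λ)) ≤
        Module.finrank k (LinearMap.range (σ Λ)) := by omega
    exact_mod_cast h5
  size_lower := by
    intro M _ _ _ ρ
    have : (0 : ℝ) ≤ Module.finrank k M := by positivity
    have : (0 : ℝ) ≤ Module.finrank k (LinearMap.range (ρ Λ)) := by positivity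
    linarith

variable (k K) in
/-- Minus the dimension of the invariants. -/
noncomputable def invSize : SizeFn k K where
  size M _ _ ρ := -(Module.finrank k (invts ρ) : ℝ)
  reg := -1
  size_regRep := by
    rw [show Module.finrank k (invts (regRep k K)) = 1 from finrank_leftInt, Nat.cast_one]
  size_equiv := by
    intro M N _ _ _ _ ρ σ e h
    rw [finrank_invts_equiv e h]
  size_rtriv := by
    intro M N _ _ _ _ _ _ ρ
    rw [finrank_invts_rtriv]
    push_cast
    ring
  size_exact := by
    intro M N P _ _ _ _ _ _ _ ρ σ τ f g hf hg hfg hρ hσ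
    have hP : FiniteDimensional k P := Module.Finite.of_surjective g hg
    have hM : FiniteDimensional k M := Module.Finite.of_injective f hf
    have h3 := LinearMap.finrank_range_add_finrank_ker (g.domRestrict (invts σ))
    have h2 : Module.finrank k (LinearMap.range (g.domRestrict (invts σ))) ≤
        Module.finrank k (invts τ) := by
      apply Submodule.finrank_mono
      rintro _ ⟨x, rfl⟩
      exact hσ.mem_invts x.2
    have h4 : Module.finrank k (LinearMap.ker (g.domRestrict (invts σ))) ≤
        Module.finrank k (invts ρ) := by
      have h5 : Module.finrank k (LinearMap.ker (g.domRestrict (invts σ))) ≤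
          Module.finrank k ((invts ρ).map f) := by
        let φ : LinearMap.ker (g.domRestrict (invts σ)) →ₗ[k] (invts ρ).map f :=
          LinearMap.codRestrict _ ((invts σ).subtype ∘ₗ Submodule.subtype _) (by
            intro x
            obtain ⟨m, hm⟩ := (hfg x.1.1).1 x.2
            refine ⟨m, fun a => hf ?_, hm⟩
            rw [hρ, hm, x.1.2 a, map_smul, hm])
        refine LinearMap.finrank_le_finrank_of_injective (f := φ) ?_
        intro x y hxy
        apply Subtype.ext
        apply Subtype.ext
        exact congrArg (fun z => z.1) hxy
      exact h5.trans (Submodule.finrank_map_le _ _)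
    have h6 : Module.finrank k (invts σ) ≤
        Module.finrank k (invts ρ) + Module.finrank k (invts τ) := by omega
    have h7 : (Module.finrank k (invts σ) : ℝ) ≤
        Module.finrank k (invts ρ) + Module.finrank k (invts τ) := by exact_mod_cast h6
    linarith
  size_lower := by
    intro M _ _ _ ρ
    have : Module.finrank k (invts ρ) ≤ Module.finrank k M := Submodule.finrank_le _
    have : (Module.finrank k (invts ρ) : ℝ) ≤ Module.finrank k M := by exact_mod_cast this
    linarith

variable {F : Type} [Ring F] [HopfAlgebra k F] [FiniteDimensional k F] [Nontrivial F]

theorem finrank_invts_resReg (i : K →ₐc[k] F) (hi : Function.Injective i) :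
    Module.finrank k (invts (resReg i)) * Module.finrank k K = Module.finrank k F := by
  obtain ⟨Λ, hΛ, h0, -⟩ := exists_leftInt (k := k) (K := K)
  have h1 := (rkSize Λ hΛ h0).le_size i hi
  have h2 := (invSize k K).le_size i hi
  simp only [rkSize, invSize] at h1 h2
  have h3 : Module.finrank k (LinearMap.range (resReg i Λ)) ≤
      Module.finrank k (invts (resReg i)) := by
    apply Submodule.finrank_mono
    rintro _ ⟨x, rfl⟩ a
    rw [resReg_apply, resReg_apply, ← mul_assoc, ← map_mul, (mem_leftInt _).1 hΛ a, map_smul,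
      smul_mul_assoc]
  have h4 : Module.finrank k F ≤
      Module.finrank k (LinearMap.range (resReg i Λ)) * Module.finrank k K := by
    have : (Module.finrank k F : ℝ) ≤
      Module.finrank k (LinearMap.range (resReg i Λ)) * Module.finrank k K := by linarith
    exact_mod_cast this
  have h5 : Module.finrank k (invts (resReg i)) * Module.finrank k K ≤ Module.finrank k F := by
    have : (Module.finrank k (invts (resReg i)) : ℝ) * Module.finrank k K ≤
      Module.finrank k F := by linarith
    exact_mod_cast this
  exact le_antisymm h5 (h4.trans (Nat.mul_le_mul_right _ h3))

theorem finrank_dvd (i : K →ₐc[k] F) (hi : Function.Injective i) :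
    Module.finrank k K ∣ Module.finrank k F :=
  Dvd.intro_left _ (finrank_invts_resReg i hi)

end NZ

section DualHopf

variable {k H : Type} [Field k] [Ring H] [HopfAlgebra k H]

variable (k H) in
/-- The linear dual of a Hopf algebra, with the convolution product. -/
def DualH : Type := WithConv (H →ₗ[k] k)

noncomputable instance : Ring (DualH k H) := inferInstanceAs (Ring (WithConv (H →ₗ[k] k)))

noncomputable instance : Algebra k (DualH k H) :=
  inferInstanceAs (Algebra k (WithConv (H →ₗ[k] k)))

/-- The functional underlying an element of the dual. -/
noncomputable def toDual : DualH k H ≃ₗ[k] (H →ₗ[k] k) where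
  toFun f := WithConv.ofConv f
  invFun f := WithConv.toConv f
  map_add' _ _ := rfl
  map_smul' _ _ := rfl
  left_inv _ := rfl
  right_inv _ := rfl

theorem dualH_ext {f g : DualH k H} (h : ∀ x, toDual f x = toDual g x) : f = g :=
  toDual.injective (LinearMap.ext h)

theorem dualH_one (x : H) : toDual (1 : DualH k H) x = counit (R := k) x := rfl

theorem dualH_mul (f g : DualH k H) (a : H) :
    toDual (f * g) a = LinearMap.mul' k k (TensorProduct.map (toDual f) (toDual g) (comul a)) :=
  rfl

instance [FiniteDimensional k H] : FiniteDimensional k (DualH k H) :=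
  Module.Finite.equiv (toDual (k := k) (H := H)).symm

theorem finrank_dualH : Module.finrank k (DualH k H) = Module.finrank k H := by
  rw [(toDual (k := k) (H := H)).finrank_eq]
  exact Subspace.dual_finrank_eq

instance : Nontrivial (DualH k H) := ⟨⟨1, 0, fun h => by
  have := dualH_one (k := k) (1 : H)
  simp [h] at this⟩⟩

variable [FiniteDimensional k H]

/-- Tensors of functionals as functionals on tensors. -/
noncomputable def ev2 : DualH k H ⊗[k] DualH k H ≃ₗ[k] (H ⊗[k] H →ₗ[k] k) :=
  TensorProduct.congr toDual toDual ≪≫ₗ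
    TensorProduct.dualDistribEquiv k H H

theorem ev2_tmul (f g : DualH k H) (a b : H) :
    ev2 (f ⊗ₜ g) (a ⊗ₜ b) = toDual f a * toDual g b := rfl

/-- Triple tensors of functionals as functionals on triple tensors. -/
noncomputable def ev3 : DualH k H ⊗[k] (DualH k H ⊗[k] DualH k H) ≃ₗ[k]
    (H ⊗[k] (H ⊗[k] H) →ₗ[k] k) :=
  TensorProduct.congr toDual ev2 ≪≫ₗ
    TensorProduct.dualDistribEquiv k H (H ⊗[k] H)

theorem ev3_tmul (f : DualH k H) (z : DualH k H ⊗[k] DualH k H) (a : H) (b : H ⊗[k] H) :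
    ev3 (f ⊗ₜ z) (a ⊗ₜ b) = toDual f a * ev2 z b := rfl

theorem ev2_ext {z w : DualH k H ⊗[k] DualH k H}
    (h : ∀ a b, ev2 z (a ⊗ₜ b) = ev2 w (a ⊗ₜ b)) : z = w :=
  ev2.injective (TensorProduct.ext' h)

theorem ev3_ext {z w : DualH k H ⊗[k] (DualH k H ⊗[k] DualH k H)}
    (h : ∀ a b c, ev3 z (a ⊗ₜ (b ⊗ₜ c)) = ev3 w (a ⊗ₜ (b ⊗ₜ c))) : z = w := by
  apply ev3.injective
  ext a b c
  exact h a b c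

noncomputable instance : CoalgebraStruct k (DualH k H) where
  comul := ev2.symm.toLinearMap ∘ₗ
    (LinearMap.lcomp k k (LinearMap.mul' k H)) ∘ₗ
      toDual.toLinearMap
  counit := (LinearMap.applyₗ (R := k) (1 : H)) ∘ₗ toDual.toLinearMap

theorem ev2_comul (f : DualH k H) (a b : H) :
    ev2 (comul (R := k) f) (a ⊗ₜ b) = toDual f (a * b) := by
  simp [comul]

theorem dualH_counit (f : DualH k H) : counit (R := k) f = toDual f 1 := rfl

noncomputable instance : Coalgebra k (DualH k H) where
  coassoc := by
    ext1 f
    have h1 : ∀ (z : DualH k H ⊗[k] DualH k H) (a b c : H),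
        ev3 (TensorProduct.assoc k _ _ _ (comul.rTensor _ z)) (a ⊗ₜ (b ⊗ₜ c)) =
          ev2 z ((a * b) ⊗ₜ c) := by
      intro z a b c
      induction z with
      | zero => simp
      | add u v hu hv => simp only [map_add, LinearMap.add_apply, hu, hv]
      | tmul u v =>
        rw [LinearMap.rTensor_tmul, ev2_tmul, ← ev2_comul]
        induction comul (R := k) u with
        | zero => simp
        | add u v hu hv => simp only [TensorProduct.add_tmul, map_add, LinearMap.add_apply, hu, hv,
            add_mul]
        | tmul u w => simp [ev3_tmul, ev2_tmul, mul_assoc]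
    have h2 : ∀ (z : DualH k H ⊗[k] DualH k H) (a b c : H),
        ev3 (comul.lTensor _ z) (a ⊗ₜ (b ⊗ₜ c)) =
          ev2 z (a ⊗ₜ (b * c)) := by
      intro z a b c
      induction z with
      | zero => simp
      | add u v hu hv => simp only [map_add, LinearMap.add_apply, hu, hv]
      | tmul u v => simp [ev3_tmul, ev2_tmul, ev2_comul]
    refine ev3_ext fun a b c => ?_
    simp only [LinearMap.comp_apply, LinearEquiv.coe_coe]
    rw [h1, h2, ev2_comul, ev2_comul, mul_assoc]
  rTensor_counit_comp_comul := by
    ext1 f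
    apply (TensorProduct.lid k _).injective
    refine dualH_ext fun x => ?_
    have h1 : ∀ z : DualH k H ⊗[k] DualH k H,
        toDual (TensorProduct.lid k _ (counit.rTensor _ z)) x = ev2 z (1 ⊗ₜ x) := by
      intro z
      induction z with
      | zero => simp
      | add u v hu hv => simp only [map_add, LinearMap.add_apply, hu, hv]
      | tmul u v => simp [ev2_tmul, dualH_counit]
    simp [h1, ev2_comul]
  lTensor_counit_comp_comul := by
    ext1 f
    apply (TensorProduct.rid k _).injective
    refine dualH_ext fun x => ?_
    have h1 : ∀ z : DualH k H ⊗[k] DualH k H,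
        toDual (TensorProduct.rid k _ (counit.lTensor _ z)) x = ev2 z (x ⊗ₜ 1) := by
      intro z
      induction z with
      | zero => simp
      | add u v hu hv => simp only [map_add, LinearMap.add_apply, hu, hv]
      | tmul u v => simp [ev2_tmul, dualH_counit, mul_comm]
    simp [h1, ev2_comul]

theorem ev2_mul_tmul (z : DualH k H ⊗[k] DualH k H) (w : DualH k H ⊗[k] DualH k H) (a b : H) :
    ev2 (z * w) (a ⊗ₜ b) = LinearMap.mul' k k (TensorProduct.map (ev2 z) (ev2 w)
      (TensorProduct.tensorTensorTensorComm k H H H H (comul a ⊗ₜ comul b))) := by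
  induction z with
  | zero => simp
  | add u v hu hv => simp only [add_mul, map_add, LinearMap.add_apply, hu, hv,
      TensorProduct.map_add_left]
  | tmul f g =>
    induction w with
    | zero => simp
    | add u v hu hv => simp only [mul_add, map_add, LinearMap.add_apply, hu, hv,
      TensorProduct.map_add_right]
    | tmul f' g' =>
      rw [Algebra.TensorProduct.tmul_mul_tmul, ev2_tmul]
      rw [dualH_mul, dualH_mul]
      induction comul (R := k) a with
      | zero => simp
      | add u v hu hv => simp only [TensorProduct.add_tmul, map_add, add_mul, hu, hv]
      | tmul u v =>
        induction comul (R := k) b with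
        | zero => simp
        | add u v hu hv => simp only [TensorProduct.tmul_add, map_add, mul_add, hu, hv]
        | tmul u' v' => simp [ev2_tmul]; ring

theorem dualH_mul_apply (f g : DualH k H) (a : H) :
    toDual (f * g) a = ev2 (f ⊗ₜ g) (comul a) := by
  rw [dualH_mul]
  induction comul (R := k) a with
  | zero => simp
  | add u v hu hv => simp only [map_add, hu, hv]
  | tmul u v => simp [ev2_tmul]

noncomputable instance : Bialgebra k (DualH k H) :=
  Bialgebra.mk' k (DualH k H)
    (by simp [dualH_counit, dualH_one])
    (by intro f g; rw [dualH_counit, dualH_mul_apply, Bialgebra.comul_one]; rfl)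
    (by
      refine ev2_ext fun a b => ?_
      rw [ev2_comul, Algebra.TensorProduct.one_def, ev2_tmul]
      simp [dualH_one])
    (by
      intro f g
      refine ev2_ext fun a b => ?_
      rw [ev2_comul, ev2_mul_tmul, dualH_mul_apply, Bialgebra.comul_mul]
      induction comul (R := k) a with
      | zero => simp
      | add u v hu hv => simp only [TensorProduct.add_tmul, map_add, add_mul, hu, hv]
      | tmul u v =>
        induction comul (R := k) b with
        | zero => simp
        | add u v hu hv => simp only [TensorProduct.tmul_add, map_add, mul_add, hu, hv]
        | tmul u' v' => simp [ev2_tmul, ev2_comul])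

noncomputable instance : HopfAlgebra k (DualH k H) where
  antipode := toDual.symm.toLinearMap ∘ₗ
    (LinearMap.lcomp k k (antipode k)) ∘ₗ
      toDual.toLinearMap
  mul_antipode_rTensor_comul := by
    ext1 f
    refine dualH_ext fun x => ?_
    have h1 : ∀ z : DualH k H ⊗[k] DualH k H, toDual (LinearMap.mul' k _
        ((toDual.symm.toLinearMap ∘ₗ LinearMap.lcomp k k (antipode k) ∘ₗ
          toDual.toLinearMap).rTensor _ z)) x =
        ev2 z ((antipode k).rTensor H (comul x)) := by
      intro z
      induction z with
      | zero => simp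
      | add u v hu hv => simp only [map_add, LinearMap.add_apply, hu, hv]
      | tmul u v =>
        rw [LinearMap.rTensor_tmul, LinearMap.mul'_apply, dualH_mul]
        induction comul (R := k) x with
        | zero => simp
        | add u v hu hv => simp only [map_add, hu, hv]
        | tmul a b => simp [ev2_tmul]
    have h2 : ∀ z : H ⊗[k] H, ev2 (comul (R := k) f) z = toDual f (LinearMap.mul' k H z) := by
      intro z
      induction z with
      | zero => simp
      | add u v hu hv => simp only [map_add, hu, hv]
      | tmul u v => simp [ev2_comul]
    simp only [LinearMap.comp_apply]
    rw [h1, h2, mul_antipode_rTensor_comul_apply]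
    simp [Algebra.algebraMap_eq_smul_one, dualH_counit, dualH_one, mul_comm]
  mul_antipode_lTensor_comul := by
    ext1 f
    refine dualH_ext fun x => ?_
    have h1 : ∀ z : DualH k H ⊗[k] DualH k H, toDual (LinearMap.mul' k _
        ((toDual.symm.toLinearMap ∘ₗ LinearMap.lcomp k k (antipode k) ∘ₗ
          toDual.toLinearMap).lTensor _ z)) x =
        ev2 z ((antipode k).lTensor H (comul x)) := by
      intro z
      induction z with
      | zero => simp
      | add u v hu hv => simp only [map_add, LinearMap.add_apply, hu, hv]
      | tmul u v =>
        rw [LinearMap.lTensor_tmul, LinearMap.mul'_apply, dualH_mul]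
        induction comul (R := k) x with
        | zero => simp
        | add u v hu hv => simp only [map_add, hu, hv]
        | tmul a b => simp [ev2_tmul]
    have h2 : ∀ z : H ⊗[k] H, ev2 (comul (R := k) f) z = toDual f (LinearMap.mul' k H z) := by
      intro z
      induction z with
      | zero => simp
      | add u v hu hv => simp only [map_add, hu, hv]
      | tmul u v => simp [ev2_comul]
    simp only [LinearMap.comp_apply]
    rw [h1, h2, mul_antipode_lTensor_comul_apply]
    simp [Algebra.algebraMap_eq_smul_one, dualH_counit, dualH_one, mul_comm]

theorem dualH_antipode (f : DualH k H) (x : H) :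
    toDual (antipode k f) x = toDual f (antipode k x) := rfl

end DualHopf

section SubHopf

variable {k F : Type} [Field k] [Ring F] [HopfAlgebra k F]

/-- The map `A ⊗ A → F ⊗ F` for a subalgebra `A` of `F`. -/
noncomputable def incl2 (A : Subalgebra k F) : A ⊗[k] A →ₐ[k] F ⊗[k] F :=
  Algebra.TensorProduct.map A.val A.val

theorem incl2_tmul (A : Subalgebra k F) (a b : A) : incl2 A (a ⊗ₜ b) = (a : F) ⊗ₜ (b : F) := rfl

theorem incl2_injective (A : Subalgebra k F) : Function.Injective (incl2 A) :=
  TensorProduct.map_injective_of_flat_flat A.val.toLinearMap A.val.toLinearMap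
    Subtype.val_injective Subtype.val_injective

/-- A subalgebra stable under the comultiplication and the antipode. -/
class IsSubHopf (A : Subalgebra k F) : Prop where
  comul_mem : ∀ x ∈ A, comul (R := k) x ∈ (incl2 A).range
  antipode_mem : ∀ x ∈ A, antipode k x ∈ A

variable (A : Subalgebra k F) [IsSubHopf A]

noncomputable instance : CoalgebraStruct k A where
  comul := (LinearEquiv.ofInjective (incl2 A).toLinearMap (incl2_injective A)).symm.toLinearMap ∘ₗ
    ((comul (R := k) (A := F)) ∘ₗ A.val.toLinearMap).codRestrict _
      fun x => IsSubHopf.comul_mem x.1 x.2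
  counit := counit ∘ₗ A.val.toLinearMap

variable {A}

theorem incl2_comul (x : A) : incl2 A (comul (R := k) x) = comul (R := k) (x : F) :=
  congrArg Subtype.val (LinearEquiv.apply_symm_apply
    (LinearEquiv.ofInjective (incl2 A).toLinearMap (incl2_injective A)) _)

theorem subHopf_counit (x : A) : counit (R := k) x = counit (R := k) (x : F) := rfl

theorem subHopf_comul_eq {x : A} {z : A ⊗[k] A} (h : incl2 A z = comul (R := k) (x : F)) :
    comul (R := k) x = z :=
  incl2_injective A (by rw [incl2_comul, h])

set_option synthInstance.maxHeartbeats 200000 in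
noncomputable instance : Coalgebra k A where
  coassoc := by
    ext1 x
    have hinj : Function.Injective (TensorProduct.map A.val.toLinearMap (incl2 A).toLinearMap) :=
      TensorProduct.map_injective_of_flat_flat A.val.toLinearMap (incl2 A).toLinearMap
        Subtype.val_injective (incl2_injective A)
    have h1 : ∀ z : A ⊗[k] A, TensorProduct.map A.val.toLinearMap (incl2 A).toLinearMap
        (TensorProduct.assoc k _ _ _ (comul.rTensor _ z)) =
          TensorProduct.assoc k _ _ _ (comul.rTensor _ (incl2 A z)) := by
      intro z
      induction z with
      | zero => simp
      | add u v hu hv => simp only [map_add, hu, hv]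
      | tmul u v =>
        rw [LinearMap.rTensor_tmul, incl2_tmul, LinearMap.rTensor_tmul, ← incl2_comul]
        induction comul (R := k) u with
        | zero => simp
        | add u v hu hv => simp only [TensorProduct.add_tmul, map_add, hu, hv]
        | tmul u w => simp [incl2_tmul]
    have h2 : ∀ z : A ⊗[k] A, TensorProduct.map A.val.toLinearMap (incl2 A).toLinearMap
        (comul.lTensor _ z) = comul.lTensor _ (incl2 A z) := by
      intro z
      induction z with
      | zero => simp
      | add u v hu hv => simp only [map_add, hu, hv]
      | tmul u v => simp [incl2_tmul, incl2_comul]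
    apply hinj
    simp only [LinearMap.comp_apply, LinearEquiv.coe_coe]
    rw [h1, h2, incl2_comul, coassoc_apply]
  rTensor_counit_comp_comul := by
    ext1 x
    apply (TensorProduct.lid k _).injective
    have h1 : ∀ z : A ⊗[k] A, (TensorProduct.lid k _ (counit.rTensor _ z) : A) =
        TensorProduct.lid k F (counit.rTensor _ (incl2 A z)) := by
      intro z
      induction z with
      | zero => simp
      | add u v hu hv => simp only [map_add, hu, hv, Subalgebra.coe_add]
      | tmul u v => simp [incl2_tmul, subHopf_counit]
    apply Subtype.ext
    rw [LinearMap.comp_apply, h1, incl2_comul, rTensor_counit_comul]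
    simp
  lTensor_counit_comp_comul := by
    ext1 x
    apply (TensorProduct.rid k _).injective
    have h1 : ∀ z : A ⊗[k] A, (TensorProduct.rid k _ (counit.lTensor _ z) : A) =
        TensorProduct.rid k F (counit.lTensor _ (incl2 A z)) := by
      intro z
      induction z with
      | zero => simp
      | add u v hu hv => simp only [map_add, hu, hv, Subalgebra.coe_add]
      | tmul u v => simp [incl2_tmul, subHopf_counit]
    apply Subtype.ext
    rw [LinearMap.comp_apply, h1, incl2_comul, lTensor_counit_comul]
    simp

noncomputable instance : Bialgebra k A :=
  Bialgebra.mk' k A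
    (by simp [subHopf_counit])
    (by intro x y; simp [subHopf_counit])
    (incl2_injective A (by rw [incl2_comul]; simp))
    (by intro x y; exact incl2_injective A (by rw [incl2_comul, map_mul, incl2_comul, incl2_comul]; simp))

noncomputable instance : HopfAlgebra k A where
  antipode := (antipode k ∘ₗ A.val.toLinearMap).codRestrict (Subalgebra.toSubmodule A)
      fun x => IsSubHopf.antipode_mem x.1 x.2
  mul_antipode_rTensor_comul := by
    ext x
    have h1 : ∀ z : A ⊗[k] A, (LinearMap.mul' k A
        (((antipode k ∘ₗ A.val.toLinearMap).codRestrict (Subalgebra.toSubmodule A)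
      fun x => IsSubHopf.antipode_mem x.1 x.2).rTensor _ z) : F) =
        LinearMap.mul' k F ((antipode k).rTensor _ (incl2 A z)) := by
      intro z
      induction z with
      | zero => simp
      | add u v hu hv => simp only [map_add, hu, hv, Subalgebra.coe_add]
      | tmul u v => rfl
    simp only [LinearMap.comp_apply]
    rw [h1, incl2_comul, mul_antipode_rTensor_comul_apply]
    rfl
  mul_antipode_lTensor_comul := by
    ext x
    have h1 : ∀ z : A ⊗[k] A, (LinearMap.mul' k A
        (((antipode k ∘ₗ A.val.toLinearMap).codRestrict (Subalgebra.toSubmodule A)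
      fun x => IsSubHopf.antipode_mem x.1 x.2).lTensor _ z) : F) =
        LinearMap.mul' k F ((antipode k).lTensor _ (incl2 A z)) := by
      intro z
      induction z with
      | zero => simp
      | add u v hu hv => simp only [map_add, hu, hv, Subalgebra.coe_add]
      | tmul u v => rfl
    simp only [LinearMap.comp_apply]
    rw [h1, incl2_comul, mul_antipode_lTensor_comul_apply]
    rfl

theorem subHopf_antipode (x : A) : (antipode k x : A) = antipode k (x : F) := rfl

variable (A) in
/-- The inclusion of a Hopf subalgebra. -/
noncomputable def subIncl : A →ₐc[k] F :=
  BialgHom.ofAlgHom A.val rfl (by ext x; exact incl2_comul x)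

theorem subIncl_apply (x : A) : subIncl A x = (x : F) := rfl

theorem subHopf_finrank_dvd [FiniteDimensional k F] [Nontrivial F] :
    Module.finrank k A ∣ Module.finrank k F :=
  finrank_dvd (subIncl A) Subtype.val_injective

theorem isSubHopf_adjoin {s : Set F}
    (h1 : ∀ x ∈ s, comul (R := k) x ∈ (incl2 (Algebra.adjoin k s)).range)
    (h2 : ∀ x ∈ s, antipode k x ∈ Algebra.adjoin k s) : IsSubHopf (Algebra.adjoin k s) where
  comul_mem := by
    have : Algebra.adjoin k s ≤
        (incl2 (Algebra.adjoin k s)).range.comap (Bialgebra.comulAlgHom k F) :=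
      Algebra.adjoin_le h1
    exact this
  antipode_mem := by
    intro x hx
    induction hx using Algebra.adjoin_induction with
    | mem x hx => exact h2 x hx
    | algebraMap r =>
      rw [Algebra.algebraMap_eq_smul_one, map_smul, antipode_one]
      exact Subalgebra.smul_mem _ (one_mem _) r
    | add x y _ _ hx hy => rw [map_add]; exact add_mem hx hy
    | mul x y _ _ hx hy => rw [antipode_mul_antidistrib]; exact mul_mem hy hx

theorem tmul_mem_range_incl2 {A : Subalgebra k F} {x y : F} (hx : x ∈ A) (hy : y ∈ A) :
    x ⊗ₜ[k] y ∈ (incl2 A).range := ⟨(⟨x, hx⟩ : A) ⊗ₜ (⟨y, hy⟩ : A), rfl⟩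

end SubHopf

section Maschke

variable {k H : Type} [Field k] [Ring H] [HopfAlgebra k H]

theorem isSemisimpleRing_of_separable (e : H ⊗[k] H)
    (h1 : ∀ h : H, (h ⊗ₜ 1) * e = e * (1 ⊗ₜ h)) (h2 : LinearMap.mul' k H e = 1) :
    IsSemisimpleRing H := by
  refine (isSemisimpleModule_iff H H).2 ⟨fun N => ?_⟩
  obtain ⟨π, hπ⟩ := (N.restrictScalars k).subtype.exists_leftInverse_of_injective
    (LinearMap.ker_eq_bot.mpr (N.restrictScalars k).injective_subtype)
  let av : H →ₗ[k] H ⊗[k] H →ₗ[k] H := LinearMap.flip (TensorProduct.lift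
    (LinearMap.mk₂ k (fun a b : H => (LinearMap.mulLeft k a) ∘ₗ (N.restrictScalars k).subtype ∘ₗ π ∘ₗ
      LinearMap.mulLeft k b) (by intros; ext; simp [add_mul]) (by intros; ext; simp)
      (by intros; ext; simp [add_mul, mul_add]) (by intros; ext; simp)))
  have av_tmul : ∀ x a b, av x (a ⊗ₜ b) = a * (π (b * x) : H) := fun x a b => rfl
  have av1 : ∀ h x z, h * av x z = av x ((h ⊗ₜ 1) * z) := by
    intro h x z
    induction z with
    | zero => simp
    | add u v hu hv => simp only [map_add, mul_add, hu, hv]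
    | tmul a b => simp [av_tmul, mul_assoc]
  have av2 : ∀ h x z, av (h * x) z = av x (z * (1 ⊗ₜ h)) := by
    intro h x z
    induction z with
    | zero => simp
    | add u v hu hv => simp only [map_add, add_mul, hu, hv]
    | tmul a b => simp [av_tmul, mul_assoc]
  have av3 : ∀ x z, av x z ∈ N := by
    intro x z
    induction z with
    | zero => simp
    | add u v hu hv => rw [map_add]; exact add_mem hu hv
    | tmul a b => exact N.smul_mem a (π (b * x)).2
  have av4 : ∀ x ∈ N, ∀ z, av x z = LinearMap.mul' k H z * x := by
    intro x hx z
    induction z with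
    | zero => simp
    | add u v hu hv => simp only [map_add, add_mul, hu, hv]
    | tmul a b =>
      have := LinearMap.congr_fun hπ ⟨b * x, N.smul_mem b hx⟩
      simp only [LinearMap.comp_apply, LinearMap.id_apply, Submodule.subtype_apply] at this
      rw [av_tmul, this]
      simp [mul_assoc]
  let P : H →ₗ[H] N :=
    { toFun := fun x => ⟨av x e, av3 x e⟩
      map_add' := fun x y => Subtype.ext (by simp)
      map_smul' := fun h x => Subtype.ext (by simp [av1, av2, h1]) }
  exact ⟨LinearMap.ker P, (LinearMap.isCompl_of_proj fun x => Subtype.ext (by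
    change av x e = x
    rw [av4 x x.2, h2, one_mul]))⟩

/-- The map `a ⊗ b ↦ a ⊗ S b` applied to `Δ Λ` for a left integral `Λ` is a Casimir element. -/
theorem casimir_of_leftInt {Λ : H} (hΛ : Λ ∈ leftInt k H) (h : H) :
    (h ⊗ₜ[k] (1 : H)) * (antipode k).lTensor H (comul Λ) =
      (antipode k).lTensor H (comul Λ) * (1 ⊗ₜ h) := by
  let Ψ : H ⊗[k] H →ₗ[k] H ⊗[k] H := TensorProduct.lift
    (LinearMap.mk₂ k (fun x t : H => (x ⊗ₜ[k] (1 : H)) * (antipode k).lTensor H (comul Λ) * (1 ⊗ₜ t))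
      (by intros; simp [TensorProduct.add_tmul, add_mul])
      (by intros; simp only [← TensorProduct.smul_tmul', smul_mul_assoc])
      (by intros; simp [TensorProduct.tmul_add, mul_add]) (by intros; simp))
  have hΨ : ∀ x t, Ψ (x ⊗ₜ t) =
      (x ⊗ₜ[k] (1 : H)) * (antipode k).lTensor H (comul Λ) * (1 ⊗ₜ t) := fun _ _ => rfl
  have e1 : ∀ (u : H ⊗[k] H) (v : H),
      (antipode k).lTensor H (u * comul Λ) * (1 ⊗ₜ[k] v) =
        Ψ ((LinearMap.mul' k H ∘ₗ (antipode k).rTensor H).lTensor H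
          (TensorProduct.assoc k H H H (u ⊗ₜ v))) := by
    intro u v
    induction u with
    | zero => simp
    | add a b ha hb => simp only [add_mul, TensorProduct.add_tmul, map_add, ha, hb]
    | tmul a b =>
      rw [TensorProduct.assoc_tmul, LinearMap.lTensor_tmul, hΨ]
      induction comul (R := k) Λ with
      | zero => simp
      | add a b ha hb => simp only [mul_add, add_mul, map_add, ha, hb]
      | tmul c d => simp [antipode_mul_antidistrib, mul_assoc]
  have e2 : ∀ z : H ⊗[k] H, Ψ ((LinearMap.mul' k H ∘ₗ (antipode k).rTensor H).lTensor H
        (TensorProduct.assoc k H H H (comul.rTensor H z))) =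
      (antipode k).lTensor H (comul Λ) * (1 ⊗ₜ TensorProduct.lid k H (counit.rTensor H z)) := by
    intro z
    induction z with
    | zero => simp
    | add a b ha hb => simp only [map_add, ha, hb, TensorProduct.tmul_add, mul_add]
    | tmul a b =>
      rw [LinearMap.rTensor_tmul, ← e1, ← Bialgebra.comul_mul, (mem_leftInt Λ).1 hΛ a]
      simp
  have e3 := e2 (comul h)
  rw [coassoc_apply, ← LinearMap.lTensor_comp_apply, LinearMap.comp_assoc,
    mul_antipode_rTensor_comul, rTensor_counit_comul, LinearMap.lTensor_comp_apply,
    lTensor_counit_comul] at e3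
  simpa [hΨ, ← Algebra.TensorProduct.one_def] using e3

theorem isSemisimpleRing_of_leftInt {Λ : H} (hΛ : Λ ∈ leftInt k H)
    (h1 : counit (R := k) Λ = 1) : IsSemisimpleRing H :=
  isSemisimpleRing_of_separable _ (casimir_of_leftInt hΛ) (by
    rw [mul_antipode_lTensor_comul_apply, h1, map_one])

end Maschke

section Involutory

variable {k H : Type} [Field k] [Ring H] [HopfAlgebra k H]

theorem mul_antipode_swap (hS : ∀ x : H, antipode k (antipode k x) = x) (z : H) :
    LinearMap.mul' k H ((antipode k).rTensor H (TensorProduct.comm k H H (comul z))) =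
      counit (R := k) z • 1 := by
  have h1 : ∀ w : H ⊗[k] H, antipode k (LinearMap.mul' k H ((antipode k).rTensor H
      (TensorProduct.comm k H H w))) = LinearMap.mul' k H ((antipode k).rTensor H w) := by
    intro w
    induction w with
    | zero => simp
    | add a b ha hb => simp only [map_add, ha, hb]
    | tmul a b => simp [antipode_mul_antidistrib, hS]
  have h2 := h1 (comul z)
  rw [mul_antipode_rTensor_comul_apply] at h2
  rw [← hS (LinearMap.mul' k H _), h2, Algebra.algebraMap_eq_smul_one, map_smul, antipode_one]

/-- The operator `x ↦ f(x₁) x₂`. -/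
noncomputable def hitL : Module.Dual k H →ₗ[k] Module.End k H where
  toFun f := (TensorProduct.lid k H).toLinearMap ∘ₗ f.rTensor H ∘ₗ comul
  map_add' f g := by ext x; simp [LinearMap.rTensor_add]
  map_smul' c f := by ext x; simp [LinearMap.rTensor_smul]

theorem hitL_apply (f : Module.Dual k H) (x : H) :
    hitL f x = TensorProduct.lid k H (f.rTensor H (comul x)) := rfl

/-- The operator `x ↦ S(b) f(a x₁) x₂`, linearly in `a ⊗ b`. -/
noncomputable def sandwich (T : Module.End k H) : H ⊗[k] H →ₗ[k] Module.End k H :=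
  TensorProduct.lift (LinearMap.mk₂ k
    (fun a b => LinearMap.mulLeft k (antipode k b) ∘ₗ T ∘ₗ LinearMap.mulLeft k a)
    (by intros; ext; simp [add_mul, mul_add]) (by intros; ext; simp)
    (by intros; ext; simp [add_mul]) (by intros; ext; simp))

theorem sandwich_tmul (T : Module.End k H) (a b : H) : sandwich T (a ⊗ₜ b) =
    LinearMap.mulLeft k (antipode k b) ∘ₗ T ∘ₗ LinearMap.mulLeft k a := rfl

theorem hitL_comp_mulLeft (hS : ∀ x : H, antipode k (antipode k x) = x)
    (f : Module.Dual k H) (h : H) :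
    hitL (f ∘ₗ LinearMap.mulLeft k h) = sandwich (hitL f) (comul h) := by
  ext x
  let W : H ⊗[k] H → H ⊗[k] (H ⊗[k] H) →ₗ[k] H := fun w =>
    TensorProduct.lift (LinearMap.mk₂ k (fun p (y : H ⊗[k] H) =>
      LinearMap.mul' k H ((antipode k).rTensor H (TensorProduct.comm k H H y)) *
        TensorProduct.lid k H ((f ∘ₗ LinearMap.mulLeft k p).rTensor H w))
      (by
        intro a b y; rw [← mul_add]; congr 1
        induction w with
        | zero => simp
        | add u v hu hv => simp only [map_add, hu, hv]; abel
        | tmul u v => simp [add_mul, add_smul])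
      (by
        intro c a y; rw [← mul_smul_comm]; congr 1
        induction w with
        | zero => simp
        | add u v hu hv => simp only [map_add, hu, hv, smul_add]
        | tmul u v => simp [mul_smul])
      (by intros; simp [add_mul]) (by intros; simp))
  have hW : ∀ w p y, W w (p ⊗ₜ y) =
      LinearMap.mul' k H ((antipode k).rTensor H (TensorProduct.comm k H H y)) *
        TensorProduct.lid k H ((f ∘ₗ LinearMap.mulLeft k p).rTensor H w) := fun _ _ _ => rfl
  have e1 : ∀ (u : H ⊗[k] H) (b : H) (w : H ⊗[k] H),
      antipode k b * TensorProduct.lid k H (f.rTensor H (u * w)) =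
        W w (TensorProduct.assoc k H H H (u ⊗ₜ b)) := by
    intro u b w
    induction u with
    | zero => simp
    | add p q hp hq => simp only [add_mul, map_add, mul_add, TensorProduct.add_tmul, hp, hq]
    | tmul p q =>
      rw [TensorProduct.assoc_tmul, hW]
      induction w with
      | zero => simp
      | add u v hu hv => simp only [map_add, mul_add, hu, hv]
      | tmul u v => simp [mul_assoc]
  have e2 : ∀ z : H ⊗[k] H, sandwich (hitL f) z x =
      W (comul x) (TensorProduct.assoc k H H H (comul.rTensor H z)) := by
    intro z
    induction z with
    | zero => simp
    | add u v hu hv => simp only [map_add, LinearMap.add_apply, hu, hv]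
    | tmul u v =>
      rw [sandwich_tmul, LinearMap.rTensor_tmul, ← e1, ← Bialgebra.comul_mul]
      rfl
  have e3 : ∀ z : H ⊗[k] H, W (comul x) (comul.lTensor H z) =
      W (comul x) ((TensorProduct.rid k H (counit.lTensor H z)) ⊗ₜ
        ((1 : H) ⊗ₜ (1 : H))) := by
    intro z
    induction z with
    | zero => simp
    | add u v hu hv => simp only [map_add, TensorProduct.add_tmul, hu, hv]
    | tmul u v =>
      rw [LinearMap.lTensor_tmul, hW, mul_antipode_swap hS, LinearMap.lTensor_tmul,
        TensorProduct.rid_tmul, ← TensorProduct.smul_tmul', map_smul, hW]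
      simp
  rw [e2, coassoc_apply, e3, lTensor_counit_comul, hW, hitL_apply]
  simp

theorem trace_sandwich (T : Module.End k H) (h : H) :
    LinearMap.trace k H (sandwich T (comul h)) = counit (R := k) h • LinearMap.trace k H T := by
  have h1 : ∀ z : H ⊗[k] H, LinearMap.trace k H (sandwich T z) =
      LinearMap.trace k H (T ∘ₗ LinearMap.mulLeft k
        (LinearMap.mul' k H ((antipode k).lTensor H z))) := by
    intro z
    induction z with
    | zero => simp
    | add u v hu hv =>
      simp only [map_add, hu, hv]
      rw [← map_add, ← LinearMap.comp_add]
      congr 2; ext; simp [add_mul]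
    | tmul a b =>
      rw [sandwich_tmul, ← Module.End.mul_eq_comp, LinearMap.trace_mul_comm]
      congr 1
      ext; simp
  rw [h1, mul_antipode_lTensor_comul_apply]
  rw [← map_smul]
  congr 1
  ext; simp [Algebra.algebraMap_eq_smul_one]

theorem exists_normalized_leftInt [CharZero k] [FiniteDimensional k H] [Nontrivial H] (hS : ∀ x : H, antipode k (antipode k x) = x) :
    ∃ Λ ∈ leftInt k H, counit (R := k) Λ = 1 := by
  obtain ⟨Λ, hΛ⟩ := (Module.evalEquiv k H).surjective (LinearMap.trace k H ∘ₗ hitL)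
  have hf : ∀ f : Module.Dual k H, f Λ = LinearMap.trace k H (hitL f) := fun f => by
    change Module.evalEquiv k H Λ f = _
    rw [hΛ]; rfl
  have hc : counit (R := k) Λ = (Module.finrank k H : k) := by
    rw [hf counit, ← LinearMap.trace_one]
    congr 1
    ext x; simp [hitL_apply]
  have hne : (Module.finrank k H : k) ≠ 0 := by
    exact_mod_cast Module.finrank_pos.ne'
  refine ⟨(Module.finrank k H : k)⁻¹ • Λ, Submodule.smul_mem _ _ ?_, by simp [hc, hne]⟩
  intro h
  apply (Module.evalEquiv k H).injective
  ext f
  change f (h * Λ) = f (counit (R := k) h • Λ)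
  have := hf (f ∘ₗ LinearMap.mulLeft k h)
  rw [hitL_comp_mulLeft hS, trace_sandwich, ← hf] at this
  simpa using this

end Involutory

theorem tmul_ne_zero {k U W : Type} [Field k] [AddCommGroup U] [AddCommGroup W] [Module k U]
    [Module k W] {u : U} {w : W} (hu : u ≠ 0) (hw : w ≠ 0) : u ⊗ₜ[k] w ≠ 0 := by
  intro h
  obtain ⟨f, hf⟩ := not_forall.1 (mt (Module.forall_dual_apply_eq_zero_iff k u).1 hu)
  obtain ⟨g, hg⟩ := not_forall.1 (mt (Module.forall_dual_apply_eq_zero_iff k w).1 hw)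
  have := congrArg (LinearMap.mul' k k ∘ TensorProduct.map f g) h
  simp [hf, hg] at this

section Fitting

variable {k A : Type} [Field k] [Ring A] [Algebra k A]

variable (k) in
/-- Fitting decomposition for an element of a finite-dimensional algebra. -/
theorem exists_fitting [FiniteDimensional k A] (b : A) : ∃ (N : ℕ) (y : A), 2 ≤ N ∧ Commute b y ∧
    b ^ N * (b ^ N * y) = b ^ N := by
  have hm : minpoly k b ≠ 0 := minpoly.ne_zero (Algebra.IsIntegral.isIntegral b)
  obtain ⟨u, hu, hu'⟩ := Polynomial.exists_eq_pow_rootMultiplicity_mul_and_not_dvd _ hm 0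
  rw [Polynomial.C_0, sub_zero] at hu hu'
  set N := Polynomial.rootMultiplicity 0 (minpoly k b)
  have hco : IsCoprime (Polynomial.X ^ (N + 2) : Polynomial k) u :=
    ((Polynomial.irreducible_X.coprime_iff_not_dvd).2 hu').pow_left
  obtain ⟨r, s, hrs⟩ := hco
  have h0 : b ^ N * Polynomial.aeval b u = 0 := by
    have := minpoly.aeval k b
    rw [hu] at this
    simpa using this
  have h1 := congrArg (Polynomial.aeval b) hrs
  simp only [map_add, map_mul, map_pow, Polynomial.aeval_X, map_one] at h1
  have hc : ∀ P : Polynomial k, Commute b (Polynomial.aeval b P) := fun P =>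
    by simpa using ((Commute.all Polynomial.X P).map (Polynomial.aeval b))
  refine ⟨N + 2, Polynomial.aeval b r, by omega, hc r, ?_⟩
  have h2 : b ^ (N + 2) * (Polynomial.aeval b s * Polynomial.aeval b u) = 0 := by
    rw [← mul_assoc, ((hc s).pow_left (N + 2)).eq, mul_assoc, pow_add, ((Commute.refl b).pow_pow N 2).eq,
      mul_assoc, h0, mul_zero, mul_zero]
  rw [((hc r).pow_left (N + 2)).eq]
  calc _ = b ^ (N + 2) * (Polynomial.aeval b r * b ^ (N + 2)) +
        b ^ (N + 2) * (Polynomial.aeval b s * Polynomial.aeval b u) := by rw [h2, add_zero]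
    _ = _ := by rw [← mul_add, h1, mul_one]

variable (k A) in
/-- The trace of left multiplication. -/
noncomputable def ltr : A →ₗ[k] k := LinearMap.trace k A ∘ₗ (Algebra.lmul k A).toLinearMap

theorem ltr_mul_comm (x y : A) : ltr k A (x * y) = ltr k A (y * x) := by
  simp only [ltr, LinearMap.comp_apply, AlgHom.toLinearMap_apply, map_mul]
  exact LinearMap.trace_mul_comm k _ _

theorem eq_zero_of_ltr_eq_zero [FiniteDimensional k A] [CharZero k] {e : A} (he : e * e = e) (h : ltr k A e = 0) :
    e = 0 := by
  have hid : IsIdempotentElem (Algebra.lmul k A e) := by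
    rw [IsIdempotentElem, ← map_mul, he]
  have h1 := (LinearMap.isProj_range_iff_isIdempotentElem _).2 hid |>.trace
  have h2 : (Module.finrank k (LinearMap.range (Algebra.lmul k A e)) : k) = 0 := by
    rw [← h1]; exact h
  have h3 : Module.finrank k (LinearMap.range (Algebra.lmul k A e)) = 0 := by exact_mod_cast h2
  have h4 := Submodule.finrank_eq_zero.1 h3
  have h5 : e * 1 ∈ LinearMap.range (Algebra.lmul k A e) := ⟨1, rfl⟩
  rw [h4, Submodule.mem_bot, mul_one] at h5
  exact h5

variable (k) in
theorem isNilpotent_of_commutator_eq_sq [FiniteDimensional k A] [CharZero k] {a c : A} (h : c * a - a * c = c ^ 2) :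
    IsNilpotent c := by
  obtain ⟨N, y, hN, hy, he⟩ := exists_fitting k c
  refine ⟨N, ?_⟩
  have hyN := hy.pow_left N
  have hid : (c ^ N * y) * (c ^ N * y) = c ^ N * y := by
    rw [hyN.eq, mul_assoc, ← hyN.eq, he, ← hyN.eq]
  have h0 : ltr k A (c ^ N * y) = 0 := by
    obtain ⟨M, rfl⟩ := Nat.exists_eq_add_of_le' hN
    have : c ^ (M + 2) * y = (y * c ^ M) * (c * a) - (y * c ^ M) * (a * c) := by
      rw [← mul_sub, h, hyN.eq, pow_add, mul_assoc]
    have h2 : c * (y * c ^ M * a) = y * c ^ M * (c * a) := by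
      rw [← mul_assoc, ← mul_assoc, hy.eq, mul_assoc y c, ← pow_succ', pow_succ]
      simp only [mul_assoc]
    rw [this, map_sub, ← mul_assoc _ a c, ltr_mul_comm _ c, h2, sub_self]
  rw [← he, eq_zero_of_ltr_eq_zero hid h0, mul_zero]

end Fitting

section Comatrix

variable {k F : Type} [Field k] [Ring F] [HopfAlgebra k F]

/-- A `2 × 2` multiplicative matrix. -/
structure IsComatrix (a b c d : F) : Prop where
  comul_a : comul (R := k) a = a ⊗ₜ a + b ⊗ₜ c
  comul_b : comul (R := k) b = a ⊗ₜ b + b ⊗ₜ d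
  comul_c : comul (R := k) c = c ⊗ₜ a + d ⊗ₜ c
  comul_d : comul (R := k) d = c ⊗ₜ b + d ⊗ₜ d
  counit_a : counit (R := k) a = 1
  counit_b : counit (R := k) b = 0
  counit_c : counit (R := k) c = 0
  counit_d : counit (R := k) d = 1

variable {a b c d : F}

theorem IsComatrix.rels (h : IsComatrix (k := k) a b c d) :
    (antipode k a * a + antipode k b * c = 1 ∧ antipode k a * b + antipode k b * d = 0 ∧
      antipode k c * a + antipode k d * c = 0 ∧ antipode k c * b + antipode k d * d = 1) ∧
    (a * antipode k a + b * antipode k c = 1 ∧ a * antipode k b + b * antipode k d = 0 ∧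
      c * antipode k a + d * antipode k c = 0 ∧ c * antipode k b + d * antipode k d = 1) := by
  have l := fun x : F => mul_antipode_rTensor_comul_apply (R := k) x
  have r := fun x : F => mul_antipode_lTensor_comul_apply (R := k) x
  refine ⟨⟨?_, ?_, ?_, ?_⟩, ⟨?_, ?_, ?_, ?_⟩⟩
  · simpa [h.comul_a, h.counit_a] using l a
  · simpa [h.comul_b, h.counit_b] using l b
  · simpa [h.comul_c, h.counit_c] using l c
  · simpa [h.comul_d, h.counit_d] using l d
  · simpa [h.comul_a, h.counit_a] using r a
  · simpa [h.comul_b, h.counit_b] using r b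
  · simpa [h.comul_c, h.counit_c] using r c
  · simpa [h.comul_d, h.counit_d] using r d

/-- There is no Jordanian multiplicative matrix in a finite-dimensional Hopf algebra. -/
theorem jordanian_false [FiniteDimensional k F] [CharZero k] (h : IsComatrix (k := k) a b c d)
    (hc : c ≠ 0) (Sa : antipode k a = d - c) (Sb : antipode k b = a + c - b - d)
    (Sc : antipode k c = -c) (Sd : antipode k d = a + c) : False := by
  obtain ⟨⟨l1, -, l3, l4⟩, ⟨r1, -, r3, -⟩⟩ := h.rels
  rw [Sa, Sb] at l1
  rw [Sc, Sd] at l3 l4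
  rw [Sa, Sc] at r1 r3
  have ca : c * a = a * c + c ^ 2 := by
    have : c * a = a * c + c ^ 2 + (-c * a + (a + c) * c) * (-1) := by noncomm_ring
    rw [l3] at this; simpa using this
  have cd : d * c = c * d - c ^ 2 := by
    have : d * c = c * d - c ^ 2 - (c * (d - c) + d * -c) := by noncomm_ring
    rw [r3] at this; simpa using this
  have hnil : IsNilpotent c := isNilpotent_of_commutator_eq_sq k (a := a) (by rw [ca]; abel)
  obtain ⟨m, hm⟩ : ∃ m, nilpotencyClass c = m + 2 := by
    have h1 : nilpotencyClass c ≠ 0 := fun h0 => by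
      have := pow_nilpotencyClass hnil
      rw [h0, pow_zero] at this
      exact hc (by rw [← mul_one c, this, mul_zero])
    have h2 : nilpotencyClass c ≠ 1 := fun h0 => by
      have := pow_nilpotencyClass hnil
      rw [h0, pow_one] at this
      exact hc this
    exact ⟨nilpotencyClass c - 2, by omega⟩
  have hz : c ^ (m + 2) = 0 := hm ▸ pow_nilpotencyClass hnil
  have hnz : c ^ (m + 1) ≠ 0 := fun h0 => by
    have := csInf_le (OrderBot.bddBelow _) (show (m + 1) ∈ {n | c ^ n = 0} from h0)
    rw [nilpotencyClass] at hm
    omega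
  have e1 : ∀ n, c ^ (m + 1) * d ^ n * c = 0 := by
    intro n
    induction n with
    | zero => rw [pow_zero, mul_one, ← pow_succ, hz]
    | succ n ih =>
      calc c ^ (m + 1) * d ^ (n + 1) * c = c ^ (m + 1) * d ^ n * (d * c) := by
            rw [pow_succ d]; simp only [mul_assoc]
        _ = c ^ (m + 1) * d ^ n * c * (d - c) := by rw [cd]; noncomm_ring
        _ = 0 := by rw [ih, zero_mul]
  have e2 : ∀ n, c ^ m * d ^ n * c = c ^ (m + 1) * d ^ n := by
    intro n
    induction n with
    | zero => rw [pow_zero, mul_one, ← pow_succ, mul_one]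
    | succ n ih =>
      calc c ^ m * d ^ (n + 1) * c = c ^ m * d ^ n * (d * c) := by
            rw [pow_succ d]; simp only [mul_assoc]
        _ = c ^ m * d ^ n * c * d - c ^ m * d ^ n * c * c := by rw [cd]; noncomm_ring
        _ = c ^ (m + 1) * d ^ (n + 1) := by rw [ih, e1, sub_zero, pow_succ d, mul_assoc]
  have key : ∀ n : ℕ, ∃ t : k, ((c ^ m) ⊗ₜ[k] (1 : F)) * (comul (R := k) c : F ⊗[k] F) ^ (n + 1) =
      (c ^ m * d ^ (n + 1)) ⊗ₜ (c ^ (n + 1)) +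
      (c ^ (m + 1) * d ^ n) ⊗ₜ (((n : k) + 1) • (c ^ n * a) + t • c ^ (n + 1)) := by
    intro n
    induction n with
    | zero =>
      refine ⟨0, ?_⟩
      simp [h.comul_c, mul_add, pow_succ, add_comm]
    | succ n ih =>
      obtain ⟨t, ht⟩ := ih
      refine ⟨t - ((n : k) + 1), ?_⟩
      rw [pow_succ _ (n + 1), ← mul_assoc, ht, h.comul_c]
      simp only [mul_add, add_mul, Algebra.TensorProduct.tmul_mul_tmul, e1, e2,
        TensorProduct.zero_tmul]
      have h3 : (((n : k) + 1) • (c ^ n * a) + t • c ^ (n + 1)) * c =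
          ((n : k) + 1) • (c ^ (n + 1) * a) + (t - ((n : k) + 1)) • c ^ (n + 2) := by
        rw [add_mul, smul_mul_assoc, smul_mul_assoc, mul_assoc,
          show a * c = c * a - c ^ 2 by rw [ca]; abel, mul_sub, ← mul_assoc, ← pow_succ,
          ← pow_add, ← pow_succ]
        module
      have h4 : (((n + 1 : ℕ) : k) + 1) • (c ^ (n + 1) * a) + (t - ((n : k) + 1)) • c ^ (n + 1 + 1) =
          c ^ (n + 1) * a + (((n : k) + 1) • (c ^ (n + 1) * a) + (t - ((n : k) + 1)) • c ^ (n + 2)) := by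
        push_cast; module
      rw [← add_mul, h3, h4, TensorProduct.tmul_add (_ * _) (c ^ (n + 1) * a), mul_assoc _ _ d,
        ← pow_succ, mul_assoc _ _ d, ← pow_succ, ← pow_succ]
      abel
  obtain ⟨t, ht⟩ := key (m + 1)
  have h5 : (comul (R := k) c : F ⊗[k] F) ^ (m + 1 + 1) = 0 := by
    rw [← Bialgebra.comul_pow, hz, map_zero]
  have h6 : ((m : k) + 1 + 1) ≠ 0 := by exact_mod_cast Nat.succ_ne_zero (m + 1)
  rw [h5, mul_zero, show c ^ (m + 1 + 1) = 0 from hz, TensorProduct.tmul_zero, zero_add, smul_zero,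
    add_zero] at ht
  push_cast at ht
  rw [TensorProduct.tmul_smul] at ht
  have h7 := (smul_eq_zero.1 ht.symm).resolve_left h6
  have bc : b * c = c * (b - a + c - d) := by
    have : b * c = c * (b - a + c - d) - (a * (d - c) + b * -c) + (-c * b + (a + c) * d) +
      (c * a - (a * c + c ^ 2)) := by noncomm_ring
    rw [r1, l4, ca] at this; simpa using this
  have da : d * a = 1 + c * (b - a + c - d) + c * (d - c) := by
    have : d * a = ((d - c) * a + (a + c - b - d) * c) + b * c + d * c +
      (c * a - (a * c + c ^ 2)) := by noncomm_ring
    rw [l1, ca, bc, cd] at this; rw [this]; noncomm_ring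
  have d1 : ∀ n, c ^ (m + 1) * d ^ n * a ^ n = c ^ (m + 1) := by
    intro n
    induction n with
    | zero => simp
    | succ n ih =>
      calc c ^ (m + 1) * d ^ (n + 1) * a ^ (n + 1) = c ^ (m + 1) * d ^ n * (d * a) * a ^ n := by
            rw [pow_succ d, pow_succ' a]; simp only [mul_assoc]
        _ = c ^ (m + 1) * d ^ n * a ^ n +
          (c ^ (m + 1) * d ^ n * c) * (b - a + c - d + (d - c)) * a ^ n := by
            rw [da]; simp only [mul_add, add_mul, mul_assoc, mul_one]; abel
        _ = _ := by rw [ih, e1]; simp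
  have d2 : c ^ (m + 1) * a * d = c ^ (m + 1) := by
    calc c ^ (m + 1) * a * d = c ^ (m + 1) * (a * (d - c) + b * -c) +
          c ^ (m + 1) * (a * c + b * c) := by noncomm_ring
      _ = c ^ (m + 1) + c ^ (m + 2) * (a - c + (b - a + c - d)) := by
          rw [r1, bc, show a * c = c * (a - c) by rw [mul_sub, ca]; noncomm_ring, ← mul_add,
            ← mul_add c, mul_add (c ^ (m + 1)), mul_one, ← mul_assoc, ← pow_succ]
      _ = _ := by rw [hz]; simp
  exact tmul_ne_zero (fun h8 => hnz (by rw [← d1 (m + 1), h8, zero_mul]))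
    (fun h8 => hnz (by rw [← d2, h8, zero_mul])) h7

end Comatrix

section Burnside

variable {k H V : Type} [Field k] [IsAlgClosed k] [Ring H] [Algebra k H] [AddCommGroup V]
  [Module k V] [Module H V] [IsScalarTower k H V] [FiniteDimensional k V] [IsSimpleModule H V]

theorem exists_scalar_of_simple (φ : V →ₗ[H] V) : ∃ μ : k, ∀ v, φ v = μ • v := by
  have := IsSimpleModule.nontrivial H V
  obtain ⟨μ, hμ⟩ := Module.End.exists_eigenvalue (K := k) (φ.restrictScalars k : Module.End k V)
  obtain ⟨v, hv⟩ := hμ.exists_hasEigenvector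
  refine ⟨μ, ?_⟩
  let ψ : V →ₗ[H] V :=
    { toFun := fun x => φ x - μ • x
      map_add' := fun x y => by rw [map_add, smul_add]; abel
      map_smul' := fun h x => by
        rw [map_smul, RingHom.id_apply, smul_sub, ← algebraMap_smul H μ x,
          ← algebraMap_smul H μ (h • x), smul_smul, smul_smul, Algebra.commutes] }
  rcases LinearMap.injective_or_eq_zero ψ with h | h
  · refine absurd (h (a₁ := v) (a₂ := 0) ?_) hv.2
    rw [map_zero]
    exact sub_eq_zero.2 hv.apply_eq_smul
  · exact fun x => sub_eq_zero.1 (LinearMap.congr_fun h x)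

/-- Burnside's theorem. -/
theorem exists_smul_eq (T : V →ₗ[k] V) : ∃ h : H, ∀ v, h • v = T v := by
  let f : Module.End (Module.End H V) V :=
    { toFun := T
      map_add' := map_add T
      map_smul' := fun φ v => by
        obtain ⟨μ, hμ⟩ := exists_scalar_of_simple (k := k) φ
        change T (φ v) = φ (T v)
        rw [hμ, hμ, map_smul] }
  obtain ⟨s, hs⟩ := Module.Finite.fg_top (R := k) (M := V)
  obtain ⟨h, hh⟩ := jacobson_density f s
  refine ⟨h, fun v => ?_⟩
  have : (Algebra.lsmul k k V h) = T := by
    apply LinearMap.ext_on hs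
    intro m hm
    exact (hh m hm).symm
  exact LinearMap.congr_fun this v

end Burnside

section Form

variable {k V : Type} [Field k] [IsAlgClosed k] [AddCommGroup V] [Module k V]

/-- Normal form of a nondegenerate bilinear form in dimension two. -/
theorem exists_normal_form (hV : Module.finrank k V = 2) (B : V →ₗ[k] V →ₗ[k] k)
    (h1 : ∀ v, (∀ w, B v w = 0) → v = 0) (h2 : ∀ w, (∀ v, B v w = 0) → w = 0) :
    ∃ e : Module.Basis (Fin 2) k V, B (e 0) (e 0) = 0 ∧ B (e 0) (e 1) = 1 ∧
      ((B (e 1) (e 0) ≠ 0 ∧ B (e 1) (e 1) = 0) ∨ (B (e 1) (e 0) = -1 ∧ B (e 1) (e 1) = 1)) := by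
  have : FiniteDimensional k V := Module.finite_of_finrank_pos (by omega)
  let b := Module.finBasisOfFinrankEq k V hV
  obtain ⟨v, hv, hvv⟩ : ∃ v, v ≠ 0 ∧ B v v = 0 := by
    by_cases h0 : B (b 0) (b 0) = 0
    · exact ⟨b 0, b.ne_zero 0, h0⟩
    let P : Polynomial k := Polynomial.C (B (b 0) (b 0)) * Polynomial.X ^ 2 +
      Polynomial.C (B (b 0) (b 1) + B (b 1) (b 0)) * Polynomial.X + Polynomial.C (B (b 1) (b 1))
    have hd : P.degree = 2 := Polynomial.degree_quadratic h0
    obtain ⟨t, ht⟩ := IsAlgClosed.exists_root P (by rw [hd]; decide)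
    refine ⟨b 1 + t • b 0, fun h => ?_, ?_⟩
    · have := congrArg (fun x => b.repr x 1) h
      simp at this
    · simp only [P, Polynomial.IsRoot, Polynomial.eval_add, Polynomial.eval_mul, Polynomial.eval_C,
        Polynomial.eval_pow, Polynomial.eval_X] at ht
      simp only [map_add, map_smul, LinearMap.add_apply, LinearMap.smul_apply, smul_eq_mul]
      linear_combination ht
  obtain ⟨w, hw⟩ : ∃ w, B v w = 1 := by
    obtain ⟨w, hw⟩ := not_forall.1 (mt (h1 v) hv)
    exact ⟨(B v w)⁻¹ • w, by rw [map_smul, smul_eq_mul, inv_mul_cancel₀ hw]⟩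
  have key : ∀ v w : V, B v v = 0 → B v w = 1 → ∃ e : Module.Basis (Fin 2) k V, e 0 = v ∧ e 1 = w := by
    intro v w hvv hvw
    have hli : LinearIndependent k ![v, w] := by
      rw [LinearIndependent.pair_iff]
      intro s t hst
      have ht : t = 0 := by
        have := congrArg (B v) hst
        simpa [hvv, hvw] using this
      subst ht
      have := congrArg (fun x => B x w) hst
      exact ⟨by simpa [hvw] using this, rfl⟩
    refine ⟨basisOfLinearIndependentOfCardEqFinrank hli (by simp [hV]), ?_, ?_⟩ <;> simp
  have hr : B w v ≠ 0 := by
    intro h0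
    obtain ⟨e, rfl, rfl⟩ := key v w hvv hw
    refine hv (h2 _ fun x => ?_)
    have hx := e.sum_repr x
    rw [Fin.sum_univ_two] at hx
    rw [← hx, map_add, map_smul, map_smul, LinearMap.add_apply, LinearMap.smul_apply,
      LinearMap.smul_apply, hvv, h0]
    simp
  by_cases hr1 : B w v = -1
  · by_cases hs : B w w = 0
    · obtain ⟨e, rfl, rfl⟩ := key v w hvv hw
      exact ⟨e, hvv, hw, Or.inl ⟨hr, hs⟩⟩
    · obtain ⟨t, ht⟩ := IsAlgClosed.exists_pow_nat_eq (B w w) (n := 2) (by norm_num)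
      have ht0 : t ≠ 0 := by rintro rfl; exact hs (by rw [← ht]; simp)
      obtain ⟨e, he0, he1⟩ := key (t • v) (t⁻¹ • w) (by simp [hvv]) (by simp [hw, ht0])
      refine ⟨e, by simp [he0, hvv], by simp [he0, he1, hw, ht0], Or.inr ⟨?_, ?_⟩⟩
      · simp [he0, he1, hr1, ht0]
      · simp only [he1, map_smul, LinearMap.smul_apply, smul_eq_mul, ← ht]
        field_simp
  · have hr2 : 1 + B w v ≠ 0 := fun h => hr1 (by linear_combination h)
    obtain ⟨e, he0, he1⟩ := key v (w + (-(B w w) / (1 + B w v)) • v) hvv (by simp [hvv, hw])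
    refine ⟨e, by rw [he0, hvv], by simp [he0, he1, hvv, hw], Or.inl ⟨by simp [he0, he1, hvv, hr], ?_⟩⟩
    simp only [he1, map_add, map_smul, LinearMap.add_apply, LinearMap.smul_apply, smul_eq_mul, hvv, hw]
    field_simp
    ring

end Form

section Coefficients

variable {k H V : Type} [Field k] [Ring H] [HopfAlgebra k H] [FiniteDimensional k H]
  [AddCommGroup V] [Module k V] [Module H V] [IsScalarTower k H V]

/-- Matrix coefficients of a module. -/
noncomputable def coef (e : Module.Basis (Fin 2) k V) (i j : Fin 2) : DualH k H :=
  toDual.symm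
    { toFun := fun h => e.repr (h • e j) i
      map_add' := fun x y => by simp [add_smul]
      map_smul' := fun x y => by simp [smul_assoc] }

omit [FiniteDimensional k H] in
theorem coef_apply (e : Module.Basis (Fin 2) k V) (i j : Fin 2) (h : H) :
    toDual (coef e i j) h = e.repr (h • e j) i := by
  rw [coef, LinearEquiv.apply_symm_apply]; rfl

theorem smul_basis (e : Module.Basis (Fin 2) k V) (j : Fin 2) (h : H) :
    h • e j = toDual (coef e 0 j) h • e 0 + toDual (coef e 1 j) h • e 1 := by
  have := e.sum_repr (h • e j)
  rw [Fin.sum_univ_two] at this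
  rw [coef_apply, coef_apply, this]

theorem comul_coef (e : Module.Basis (Fin 2) k V) (i j : Fin 2) :
    comul (R := k) (coef (H := H) e i j) =
      coef e i 0 ⊗ₜ coef e 0 j + coef e i 1 ⊗ₜ coef e 1 j := by
  apply ev2_ext
  intro x y
  rw [ev2_comul, map_add, LinearMap.add_apply, ev2_tmul, ev2_tmul, coef_apply, mul_smul,
    smul_basis e j y, smul_add, ← algebraMap_smul H (toDual (coef e 0 j) y), smul_smul,
    ← Algebra.commutes, mul_smul, algebraMap_smul,
    ← algebraMap_smul H (toDual (coef e 1 j) y), smul_smul,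
    ← Algebra.commutes, mul_smul, algebraMap_smul]
  simp only [coef_apply, map_add, map_smul, Finsupp.add_apply, Finsupp.smul_apply, smul_eq_mul]
  ring

theorem counit_coef (e : Module.Basis (Fin 2) k V) (i j : Fin 2) :
    counit (R := k) (coef (H := H) e i j) = if j = i then 1 else 0 := by
  rw [dualH_counit, coef_apply, one_smul, e.repr_self, Finsupp.single_apply]

theorem isComatrix_coef (e : Module.Basis (Fin 2) k V) :
    IsComatrix (k := k) (coef (H := H) e 0 0) (coef e 0 1) (coef e 1 0) (coef e 1 1) :=
  ⟨comul_coef e 0 0, comul_coef e 0 1, comul_coef e 1 0, comul_coef e 1 1,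
    by simp [counit_coef], by simp [counit_coef], by simp [counit_coef], by simp [counit_coef]⟩

theorem linearIndependent_coef [IsAlgClosed k] [IsSimpleModule H V] (e : Module.Basis (Fin 2) k V) :
    LinearIndependent k ![coef (H := H) e 0 0, coef e 0 1, coef e 1 0, coef e 1 1] := by
  have : FiniteDimensional k V := Module.Finite.of_basis e
  rw [Fintype.linearIndependent_iff]
  intro g hg
  have hg' : ∀ h : H, g 0 * e.repr (h • e 0) 0 + g 1 * e.repr (h • e 1) 0 +
      g 2 * e.repr (h • e 0) 1 + g 3 * e.repr (h • e 1) 1 = 0 := by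
    intro h
    have := congrArg (fun f => toDual f h) hg
    simpa [Fin.sum_univ_four, coef_apply] using this
  have key : ∀ i j, ∃ h : H, ∀ i' j', e.repr (h • e j') i' = if i = i' ∧ j = j' then 1 else 0 := by
    intro i j
    obtain ⟨h, hh⟩ := exists_smul_eq (H := H) (e.constr k fun j' => if j = j' then e i else 0)
    refine ⟨h, fun i' j' => ?_⟩
    rw [hh, e.constr_basis]
    by_cases hj : j = j'
    · simp [hj, Finsupp.single_apply]
    · simp [hj]
  intro i
  fin_cases i
  · obtain ⟨h, hh⟩ := key 0 0
    simpa [hh] using hg' h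
  · obtain ⟨h, hh⟩ := key 0 1
    simpa [hh] using hg' h
  · obtain ⟨h, hh⟩ := key 1 0
    simpa [hh] using hg' h
  · obtain ⟨h, hh⟩ := key 1 1
    simpa [hh] using hg' h

theorem antipode_coef (e : Module.Basis (Fin 2) k V) (B : V →ₗ[k] V →ₗ[k] k)
    (hB : ∀ (h : H) (v w : V), B (h • v) w = B v (antipode k h • w)) (i j : Fin 2) :
    B (e 0) (e j) • coef (H := H) e 0 i + B (e 1) (e j) • coef e 1 i =
    B (e i) (e 0) • antipode k (coef (H := H) e 0 j) + B (e i) (e 1) • antipode k (coef e 1 j) := by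
  apply dualH_ext
  intro h
  have := hB h (e i) (e j)
  rw [smul_basis e i h, smul_basis e j (antipode k h)] at this
  simp only [map_add, map_smul, LinearMap.add_apply, LinearMap.smul_apply, smul_eq_mul,
    dualH_antipode] at this ⊢
  linear_combination this

/-- The dual Hopf algebra of a Hopf algebra with a self-dual two-dimensional simple module. -/
theorem exists_comatrix [IsAlgClosed k] [CharZero k] [IsSimpleModule H V]
    (hV : Module.finrank k V = 2) (B : V →ₗ[k] V →ₗ[k] k)
    (h1 : ∀ v, (∀ w, B v w = 0) → v = 0) (h2 : ∀ w, (∀ v, B v w = 0) → w = 0)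
    (hB : ∀ (h : H) (v w : V), B (h • v) w = B v (antipode k h • w)) :
    ∃ (a b c d : DualH k H) (q : k), q ≠ 0 ∧ LinearIndependent k ![a, b, c, d] ∧
      IsComatrix (k := k) a b c d ∧ antipode k a = d ∧ antipode k b = -q⁻¹ • b ∧
      antipode k c = -q • c ∧ antipode k d = a := by
  obtain ⟨e, e00, e01, he⟩ := exists_normal_form hV B h1 h2
  have h00 := antipode_coef e B hB 0 0
  have h01 := antipode_coef e B hB 0 1
  have h10 := antipode_coef e B hB 1 0
  have h11 := antipode_coef e B hB 1 1
  have hli := linearIndependent_coef (H := H) e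
  rcases he with ⟨hr, e11⟩ | ⟨e10, e11⟩
  · refine ⟨_, _, _, _, -B (e 1) (e 0), neg_ne_zero.2 hr, hli, isComatrix_coef e, ?_, ?_, ?_, ?_⟩
    · simpa [e00, e01, e11, hr] using h10.symm
    · simp only [e01, e11, zero_smul, one_smul, add_zero] at h11
      conv_rhs => rw [h11, smul_smul]
      simp [hr]
    · simpa [e00, e01, e11] using h00.symm
    · simpa [e00, e01, e11] using h01.symm
  · exfalso
    simp only [e00, e01, e10, e11, zero_smul, one_smul, neg_smul, zero_add] at h00 h01 h10 h11
    refine jordanian_false (isComatrix_coef e) (hli.ne_zero 2) ?_ ?_ h00.symm h01.symm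
    · rw [← h00] at h10
      have := congrArg Neg.neg h10
      simp only [neg_neg, neg_add] at this
      rw [this]; abel
    · rw [← h01] at h11
      have : antipode k (coef (H := H) e 0 1) = coef e 0 0 + coef e 1 0 -
        (-antipode k (coef (H := H) e 0 1) + (coef e 0 0 + coef e 1 0)) := by abel
      rw [this, ← h11]; abel

end Coefficients

section QMat

variable {k F : Type} [Field k] [Ring F] [HopfAlgebra k F]

/-- A `2 × 2` multiplicative matrix with the antipode of the coordinate algebra of quantum
`SL(2)`. -/
structure QMat (q : k) (a b c d : F) : Prop extends IsComatrix (k := k) a b c d where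
  q_ne : q ≠ 0
  antipode_a : antipode k a = d
  antipode_b : antipode k b = -q⁻¹ • b
  antipode_c : antipode k c = -q • c
  antipode_d : antipode k d = a

variable {q : k} {a b c d : F}

theorem QMat.swap (h : QMat q a b c d) : QMat q⁻¹ d c b a where
  comul_a := by rw [h.comul_d, add_comm]
  comul_b := by rw [h.comul_c, add_comm]
  comul_c := by rw [h.comul_b, add_comm]
  comul_d := by rw [h.comul_a, add_comm]
  counit_a := h.counit_d
  counit_b := h.counit_c
  counit_c := h.counit_b
  counit_d := h.counit_a
  q_ne := inv_ne_zero h.q_ne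
  antipode_a := h.antipode_d
  antipode_b := by rw [inv_inv, h.antipode_c]
  antipode_c := h.antipode_b
  antipode_d := h.antipode_a

theorem QMat.ab (h : QMat q a b c d) : a * b = q • (b * a) := by
  obtain ⟨-, ⟨-, r, -, -⟩⟩ := h.toIsComatrix.rels
  rw [h.antipode_b, h.antipode_d, mul_smul_comm, neg_smul, neg_add_eq_zero] at r
  rw [← r, smul_smul, mul_inv_cancel₀ h.q_ne, one_smul]

theorem QMat.bd (h : QMat q a b c d) : b * d = q • (d * b) := by
  obtain ⟨⟨-, l, -, -⟩, -⟩ := h.toIsComatrix.rels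
  rw [h.antipode_a, h.antipode_b, smul_mul_assoc, neg_smul, add_neg_eq_zero] at l
  rw [l, smul_smul, mul_inv_cancel₀ h.q_ne, one_smul]

theorem QMat.ac (h : QMat q a b c d) : a * c = q • (c * a) := by
  obtain ⟨⟨-, -, l, -⟩, -⟩ := h.toIsComatrix.rels
  rw [h.antipode_d, h.antipode_c, smul_mul_assoc, neg_smul, neg_add_eq_zero] at l
  exact l.symm

theorem QMat.cd (h : QMat q a b c d) : c * d = q • (d * c) := by
  obtain ⟨-, ⟨-, -, r, -⟩⟩ := h.toIsComatrix.rels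
  rw [h.antipode_a, h.antipode_c, mul_smul_comm, neg_smul, add_neg_eq_zero] at r
  exact r

theorem QMat.bc (h : QMat q a b c d) : b * c = c * b := by
  obtain ⟨⟨l, -, -, -⟩, ⟨-, -, -, r⟩⟩ := h.toIsComatrix.rels
  rw [h.antipode_a, h.antipode_b, smul_mul_assoc] at l
  rw [h.antipode_b, h.antipode_d, mul_smul_comm, add_comm, ← l, add_right_inj] at r
  have := smul_right_injective F (neg_ne_zero.2 (inv_ne_zero h.q_ne)) r
  exact this.symm

theorem QMat.da (h : QMat q a b c d) : d * a = 1 + q⁻¹ • (b * c) := by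
  obtain ⟨⟨l, -, -, -⟩, -⟩ := h.toIsComatrix.rels
  rw [h.antipode_a, h.antipode_b, smul_mul_assoc, neg_smul, ← sub_eq_add_neg, sub_eq_iff_eq_add] at l
  exact l

theorem QMat.ad (h : QMat q a b c d) : a * d = 1 + q • (b * c) := by
  obtain ⟨-, ⟨r, -, -, -⟩⟩ := h.toIsComatrix.rels
  rw [h.antipode_a, h.antipode_c, mul_smul_comm, neg_smul, ← sub_eq_add_neg, sub_eq_iff_eq_add] at r
  exact r

theorem gen_induction (hg : Algebra.adjoin k {a, b, c, d} = ⊤) {P : F → Prop} (ha : P a) (hb : P b)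
    (hc : P c) (hd : P d) (h1 : ∀ r : k, P (algebraMap k F r)) (hadd : ∀ x y, P x → P y → P (x + y))
    (hmul : ∀ x y, P x → P y → P (x * y)) (x : F) : P x := by
  have hx : x ∈ Algebra.adjoin k {a, b, c, d} := by rw [hg]; trivial
  induction hx using Algebra.adjoin_induction with
  | mem x hx => rcases hx with rfl | rfl | rfl | rfl <;> assumption
  | algebraMap r => exact h1 r
  | add x y _ _ hx hy => exact hadd _ _ hx hy
  | mul x y _ _ hx hy => exact hmul _ _ hx hy

/-- The Hopf subalgebra generated by a quantum matrix. -/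
theorem QMat.exists_subHopf (h : QMat q a b c d) :
    ∃ (A : Subalgebra k F) (_ : IsSubHopf A) (a' b' c' d' : A), QMat q a' b' c' d' ∧
      (a' : F) = a ∧ (b' : F) = b ∧ (c' : F) = c ∧ (d' : F) = d ∧
      Algebra.adjoin k {a', b', c', d'} = ⊤ := by
  let A := Algebra.adjoin k {a, b, c, d}
  have ha : a ∈ A := Algebra.subset_adjoin (by simp)
  have hb : b ∈ A := Algebra.subset_adjoin (by simp)
  have hc : c ∈ A := Algebra.subset_adjoin (by simp)
  have hd : d ∈ A := Algebra.subset_adjoin (by simp)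
  have hA : IsSubHopf A := by
    apply isSubHopf_adjoin
    · rintro x (rfl | rfl | rfl | rfl)
      · rw [h.comul_a]
        exact add_mem (tmul_mem_range_incl2 ha ha) (tmul_mem_range_incl2 hb hc)
      · rw [h.comul_b]
        exact add_mem (tmul_mem_range_incl2 ha hb) (tmul_mem_range_incl2 hb hd)
      · rw [h.comul_c]
        exact add_mem (tmul_mem_range_incl2 hc ha) (tmul_mem_range_incl2 hd hc)
      · rw [h.comul_d]
        exact add_mem (tmul_mem_range_incl2 hc hb) (tmul_mem_range_incl2 hd hd)
    · rintro x (rfl | rfl | rfl | rfl)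
      · rw [h.antipode_a]; exact hd
      · rw [h.antipode_b]; exact A.smul_mem hb _
      · rw [h.antipode_c]; exact A.smul_mem hc _
      · rw [h.antipode_d]; exact ha
  refine ⟨A, hA, ⟨a, ha⟩, ⟨b, hb⟩, ⟨c, hc⟩, ⟨d, hd⟩, ?_, rfl, rfl, rfl, rfl, ?_⟩
  · exact
      { comul_a := subHopf_comul_eq h.comul_a.symm
        comul_b := subHopf_comul_eq h.comul_b.symm
        comul_c := subHopf_comul_eq h.comul_c.symm
        comul_d := subHopf_comul_eq h.comul_d.symm
        counit_a := h.counit_a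
        counit_b := h.counit_b
        counit_c := h.counit_c
        counit_d := h.counit_d
        q_ne := h.q_ne
        antipode_a := Subtype.ext h.antipode_a
        antipode_b := Subtype.ext h.antipode_b
        antipode_c := Subtype.ext h.antipode_c
        antipode_d := Subtype.ext h.antipode_d }
  · rw [eq_top_iff]
    rintro ⟨x, hx⟩ -
    induction hx using Algebra.adjoin_induction with
    | mem x hx =>
      apply Algebra.subset_adjoin
      rcases hx with rfl | rfl | rfl | rfl <;> simp
    | algebraMap r => exact Subalgebra.algebraMap_mem _ r
    | add x y hx hy ihx ihy => exact add_mem ihx ihy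
    | mul x y hx hy ihx ihy => exact mul_mem ihx ihy

end QMat

section GroupLike

variable {k A : Type} [Field k] [Ring A] [HopfAlgebra k A]

theorem eq_zero_of_sum_tmul {U W ι : Type} [AddCommGroup U] [AddCommGroup W] [Module k U]
    [Module k W] [Fintype ι] {v : ι → U} (hv : LinearIndependent k v) {w : ι → W}
    (h : ∑ i, v i ⊗ₜ[k] w i = 0) (i : ι) : w i = 0 := by
  refine (Module.forall_dual_apply_eq_zero_iff k _).1 fun f => ?_
  have := congrArg (TensorProduct.rid k U ∘ f.lTensor U) h
  simp only [Function.comp_apply, map_sum, LinearMap.lTensor_tmul, TensorProduct.rid_tmul,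
    map_zero] at this
  exact Fintype.linearIndependent_iff.1 hv _ this i

/-- An element which is grouplike modulo the annihilator of `f` has two equal powers there. -/
theorem exists_pow_mul_eq_pow_mul [FiniteDimensional k A] {x f : A} (hx : counit (R := k) x = 1)
    (h : ∀ i : ℕ, comul (R := k) (x ^ i) * (1 ⊗ₜ f) = (x ^ i) ⊗ₜ (x ^ i * f)) :
    ∃ i m, i < m ∧ x ^ i * f = x ^ m * f := by
  have hInt : IsIntegral k x := Algebra.IsIntegral.isIntegral x
  set P := minpoly k x with hP
  have hli := linearIndependent_pow (K := k) x
  have hsum : ∑ i : Fin P.natDegree, P.coeff i • x ^ (i : ℕ) = - x ^ P.natDegree := by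
    have h1 := minpoly.aeval k x
    rw [← hP, Polynomial.aeval_eq_sum_range, Finset.sum_range_succ, (minpoly.monic hInt).coeff_natDegree,
      one_smul, Finset.sum_range] at h1
    exact eq_neg_of_add_eq_zero_left h1
  have h2 : ∑ i : Fin P.natDegree, (x ^ (i : ℕ)) ⊗ₜ[k] (P.coeff i • (x ^ (i : ℕ) * f - x ^ P.natDegree * f)) = 0 := by
    simp only [smul_sub, TensorProduct.tmul_sub, Finset.sum_sub_distrib, TensorProduct.tmul_smul]
    simp only [← h, TensorProduct.smul_tmul', ← smul_mul_assoc, ← map_smul]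
    rw [← Finset.sum_mul, ← map_sum, hsum, ← TensorProduct.sum_tmul, hsum, map_neg, neg_mul, h,
      TensorProduct.neg_tmul, sub_neg_eq_add, neg_add_cancel]
  have h3 := eq_zero_of_sum_tmul hli h2
  by_contra hcon
  push Not at hcon
  have h4 : ∀ i : Fin P.natDegree, P.coeff i = 0 := fun i =>
    (smul_eq_zero.1 (h3 i)).resolve_right (sub_ne_zero.2 (hcon i _ i.2))
  have h5 := congrArg (counit (R := k)) hsum
  simp [h4, hx] at h5

end GroupLike

section Normal

variable {k A : Type} [Field k] [Ring A] [Algebra k A]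

/-- An element `u` with `uA = Au`. -/
structure IsNormalElem (u : A) : Prop where
  left : ∀ x, ∃ y, u * x = y * u
  right : ∀ x, ∃ y, x * u = u * y

theorem IsNormalElem.pow {u : A} (h : IsNormalElem u) (n : ℕ) : IsNormalElem (u ^ n) := by
  induction n with
  | zero => exact ⟨fun x => ⟨x, by simp⟩, fun x => ⟨x, by simp⟩⟩
  | succ n ih =>
    refine ⟨fun x => ?_, fun x => ?_⟩
    · obtain ⟨y, hy⟩ := h.left x
      obtain ⟨z, hz⟩ := ih.left y
      exact ⟨z, by rw [pow_succ, mul_assoc, hy, ← mul_assoc, hz, mul_assoc]⟩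
    · obtain ⟨y, hy⟩ := ih.right x
      obtain ⟨z, hz⟩ := h.right y
      exact ⟨z, by rw [pow_succ, ← mul_assoc, hy, mul_assoc, hz, mul_assoc]⟩

theorem IsNormalElem.fitting_central {u y : A} {N : ℕ} (h : IsNormalElem u) (hy : Commute u y)
    (he : u ^ N * (u ^ N * y) = u ^ N) (x : A) : u ^ N * y * x = x * (u ^ N * y) := by
  have hyN := hy.pow_left N
  have he' : u ^ N * y * u ^ N = u ^ N := by
    rw [mul_assoc, ← hyN.eq, he]
  have h1 : u ^ N * y * x = u ^ N * y * x * (u ^ N * y) := by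
    obtain ⟨z, hz⟩ := (h.pow N).left x
    calc u ^ N * y * x = y * (u ^ N * x) := by rw [hyN.eq, mul_assoc]
      _ = y * (z * (u ^ N * (u ^ N * y))) := by rw [hz, he]
      _ = y * (u ^ N * x) * (u ^ N * y) := by rw [hz]; simp only [mul_assoc]
      _ = _ := by rw [hyN.eq]; simp only [mul_assoc]
  have h2 : x * (u ^ N * y) = u ^ N * y * x * (u ^ N * y) := by
    obtain ⟨z, hz⟩ := (h.pow N).right x
    calc x * (u ^ N * y) = u ^ N * z * y := by rw [← mul_assoc, hz]
      _ = u ^ N * y * (u ^ N * z) * y := by rw [← mul_assoc (u ^ N * y), he']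
      _ = _ := by rw [← hz]; simp only [mul_assoc]
  rw [h1, ← h2]

end Normal

section Trace

variable {k A : Type} [Field k] [Ring A] [HopfAlgebra k A]

theorem comul_mul_of_rightInt {f : A} (hf : ∀ x, f * x = counit (R := k) x • f) (h : A) :
    comul (R := k) f * (h ⊗ₜ 1) = comul f * (1 ⊗ₜ antipode k h) := by
  let W : A ⊗[k] A →ₗ[k] A ⊗[k] A := (LinearMap.mul' k A ∘ₗ (antipode k).lTensor A).lTensor A ∘ₗ
    (TensorProduct.assoc k A A A).toLinearMap ∘ₗ comul.rTensor A
  have e1 : ∀ (u : A ⊗[k] A) (v : A), (LinearMap.mul' k A ∘ₗ (antipode k).lTensor A).lTensor A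
      (TensorProduct.assoc k A A A (u ⊗ₜ v)) = u * (1 ⊗ₜ antipode k v) := by
    intro u v
    induction u with
    | zero => simp
    | add a b ha hb => simp only [add_mul, TensorProduct.add_tmul, map_add, ha, hb]
    | tmul a b => simp
  have e2 : ∀ z : A ⊗[k] A, comul (R := k) f * W z =
      comul f * (1 ⊗ₜ antipode k (TensorProduct.lid k A (counit.rTensor A z))) := by
    intro z
    induction z with
    | zero => simp
    | add a b ha hb => simp only [map_add, ha, hb, TensorProduct.tmul_add, mul_add]
    | tmul a b =>
      change _ * (LinearMap.mul' k A ∘ₗ (antipode k).lTensor A).lTensor A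
        (TensorProduct.assoc k A A A (comul a ⊗ₜ b)) = _
      rw [e1, ← mul_assoc, ← Bialgebra.comul_mul, hf a]
      simp
  have e3 := e2 (comul h)
  have e4 : W (comul h) = h ⊗ₜ 1 := by
    change (LinearMap.mul' k A ∘ₗ (antipode k).lTensor A).lTensor A
        (TensorProduct.assoc k A A A (comul.rTensor A (comul h))) = _
    rw [coassoc_apply, ← LinearMap.lTensor_comp_apply, LinearMap.comp_assoc,
      mul_antipode_lTensor_comul, LinearMap.lTensor_comp_apply, lTensor_counit_comul]
    simp
  rw [e4, rTensor_counit_comul] at e3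
  simpa using e3

/-- The linear map `x ⊗ y ↦ S(y)x`. -/
noncomputable def mulSwap : A ⊗[k] A →ₗ[k] A :=
  LinearMap.mul' k A ∘ₗ (TensorProduct.comm k A A).toLinearMap ∘ₗ (antipode k).lTensor A

theorem mulSwap_tmul (x y : A) : mulSwap (x ⊗ₜ[k] y) = antipode k y * x := rfl

theorem mulSwap_mul_left (z : A ⊗[k] A) (h : A) : mulSwap (z * (h ⊗ₜ 1)) = mulSwap z * h := by
  induction z with
  | zero => simp
  | add u v hu hv => simp only [add_mul, map_add, hu, hv]
  | tmul u v => simp [mulSwap_tmul, mul_assoc]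

theorem mulSwap_mul_right (z : A ⊗[k] A) (h : A) :
    mulSwap (z * (1 ⊗ₜ h)) = antipode k h * mulSwap z := by
  induction z with
  | zero => simp
  | add u v hu hv => simp only [add_mul, mul_add, map_add, hu, hv]
  | tmul u v => simp [mulSwap_tmul, mul_assoc, antipode_mul_antidistrib]

theorem ltr_mul_mulSwap {e : A} (he : ∀ x, e * x = x * e) (z : A ⊗[k] A) :
    ltr k A (e * mulSwap z) = ltr k A (e * LinearMap.mul' k A ((antipode k).lTensor A z)) := by
  induction z with
  | zero => simp
  | add u v hu hv => simp only [mul_add, map_add, hu, hv]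
  | tmul u v =>
    rw [mulSwap_tmul, ← mul_assoc, ltr_mul_comm, ← mul_assoc, ← he, mul_assoc]
    rfl

/-- In a finite-dimensional Hopf algebra with a nonzero right integral outside the kernel of the
counit, the Fitting idempotent of a normal eigenvector of `S²` vanishes. -/
theorem fitting_eq_zero [FiniteDimensional k A] [CharZero k] {f : A}
    (hf : ∀ x, f * x = counit (R := k) x • f) (hf1 : counit (R := k) f = 1) {u y : A} {N : ℕ}
    (hN : 2 ≤ N) (h : IsNormalElem u) (hy : Commute u y) (he : u ^ N * (u ^ N * y) = u ^ N) {ω : k}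
    (hω : ω ≠ 1) (hu : antipode k (antipode k u) = ω • u) : u ^ N * y = 0 := by
  have hc := h.fitting_central hy he
  have hyN := hy.pow_left N
  have hid : (u ^ N * y) * (u ^ N * y) = u ^ N * y := by
    calc (u ^ N * y) * (u ^ N * y) = y * (u ^ N * (u ^ N * y)) := by
          conv_lhs => rw [hyN.eq]
          rw [mul_assoc, hyN.eq]
      _ = _ := by rw [he, hyN.eq]
  have hw : mulSwap (comul (R := k) f) * u = ω • (u * mulSwap (comul (R := k) f)) := by
    rw [← mulSwap_mul_left, comul_mul_of_rightInt hf, mulSwap_mul_right, hu, smul_mul_assoc]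
  have ht : ∀ w : A, w * u = ω • (u * w) → ltr k A (u ^ N * y * w) = 0 := by
    intro w hw
    obtain ⟨M, rfl⟩ := Nat.exists_eq_add_of_le' hN
    have h1 : ltr k A (u ^ (M + 2) * y * w) = ω * ltr k A (u ^ (M + 2) * y * w) := by
      calc ltr k A (u ^ (M + 2) * y * w) = ltr k A (u * (y * u ^ (M + 1) * w)) := by
            rw [hyN.eq, ← mul_assoc, ← mul_assoc, hy.eq, mul_assoc y u, ← pow_succ']
        _ = ltr k A (y * u ^ (M + 1) * (w * u)) := by rw [ltr_mul_comm, mul_assoc]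
        _ = _ := by
            rw [hw, mul_smul_comm, map_smul, smul_eq_mul, hyN.eq, ← mul_assoc, mul_assoc y, ← pow_succ]
    have h2 : (1 - ω) * ltr k A (u ^ (M + 2) * y * w) = 0 := by linear_combination h1
    exact (mul_eq_zero.1 h2).resolve_left (sub_ne_zero.2 hω.symm)
  have h3 := ht _ hw
  rw [ltr_mul_mulSwap hc, mul_antipode_lTensor_comul_apply, hf1, map_one, mul_one] at h3
  exact eq_zero_of_ltr_eq_zero hid h3

end Trace

section NotSquare

variable {k A : Type} [Field k] [Ring A] [HopfAlgebra k A] {q : k} {a b c d : A}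

theorem QMat.normal_b (h : QMat q a b c d) (hg : Algebra.adjoin k {a, b, c, d} = ⊤) :
    IsNormalElem b := by
  have hq := h.q_ne
  refine ⟨fun x => ?_, fun x => ?_⟩
  · refine gen_induction hg (P := fun x => ∃ y, b * x = y * b) ⟨q⁻¹ • a, ?_⟩ ⟨b, rfl⟩ ⟨c, h.bc⟩
      ⟨q • d, ?_⟩ (fun r => ⟨algebraMap k A r, (Algebra.commutes r b).symm⟩) ?_ ?_ x
    · rw [smul_mul_assoc, h.ab, smul_smul, inv_mul_cancel₀ hq, one_smul]
    · rw [smul_mul_assoc, h.bd]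
    · rintro x y ⟨x', hx⟩ ⟨y', hy⟩
      exact ⟨x' + y', by rw [mul_add, add_mul, hx, hy]⟩
    · rintro x y ⟨x', hx⟩ ⟨y', hy⟩
      exact ⟨x' * y', by rw [← mul_assoc, hx, mul_assoc, hy, mul_assoc]⟩
  · refine gen_induction hg (P := fun x => ∃ y, x * b = b * y) ⟨q • a, ?_⟩ ⟨b, rfl⟩ ⟨c, h.bc.symm⟩
      ⟨q⁻¹ • d, ?_⟩ (fun r => ⟨algebraMap k A r, Algebra.commutes r b⟩) ?_ ?_ x
    · rw [mul_smul_comm, h.ab]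
    · rw [mul_smul_comm, h.bd, smul_smul, inv_mul_cancel₀ hq, one_smul]
    · rintro x y ⟨x', hx⟩ ⟨y', hy⟩
      exact ⟨x' + y', by rw [mul_add, add_mul, hx, hy]⟩
    · rintro x y ⟨x', hx⟩ ⟨y', hy⟩
      exact ⟨x' * y', by rw [mul_assoc, hy, ← mul_assoc, hx, mul_assoc]⟩

theorem gen_swap (hg : Algebra.adjoin k {a, b, c, d} = ⊤) :
    Algebra.adjoin k {d, c, b, a} = ⊤ := by
  rw [← hg]
  congr 1
  ext x
  simp only [Set.mem_insert_iff, Set.mem_singleton_iff]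
  tauto

theorem QMat.normal_c (h : QMat q a b c d) (hg : Algebra.adjoin k {a, b, c, d} = ⊤) :
    IsNormalElem c := h.swap.normal_b (gen_swap hg)

/-- If `b` and `c` die in the block of an idempotent, then there is a normalized right integral. -/
theorem QMat.exists_rightInt [FiniteDimensional k A] [CharZero k] (h : QMat q a b c d)
    (hg : Algebra.adjoin k {a, b, c, d} = ⊤) {f : A} (hfc : ∀ x, f * x = x * f)
    (hf1 : counit (R := k) f = 1) (hb : b * f = 0) (hc : c * f = 0) :
    ∃ f0 : A, (∀ x, f0 * x = counit (R := k) x • f0) ∧ counit (R := k) f0 = 1 := by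
  have hΔ : ∀ i : ℕ, comul (R := k) (a ^ i) * (1 ⊗ₜ f) = (a ^ i) ⊗ₜ (a ^ i * f) := by
    intro i
    induction i with
    | zero => simp
    | succ i ih =>
      have : comul (R := k) a * (1 ⊗ₜ f) = (1 ⊗ₜ f) * (a ⊗ₜ a) := by
        rw [h.comul_a]; simp [add_mul, hc, hfc]
      rw [pow_succ, Bialgebra.comul_mul, mul_assoc, this, ← mul_assoc, ih]
      simp [mul_assoc, hfc]
  obtain ⟨i, m, him, hpow⟩ := exists_pow_mul_eq_pow_mul h.counit_a hΔ
  obtain ⟨n, rfl⟩ := Nat.exists_eq_add_of_lt him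
  have hdaf : ∀ i : ℕ, ∀ x, d ^ i * (a ^ i * x * f) = x * f := by
    intro i
    induction i with
    | zero => simp
    | succ i ih =>
      intro x
      calc d ^ (i + 1) * (a ^ (i + 1) * x * f) = d ^ i * ((d * a) * (a ^ i * x * f)) := by
            rw [pow_succ, pow_succ']; simp only [mul_assoc]
        _ = d ^ i * (a ^ i * x * f) := by
            have h0 : b * c * (a ^ i * x * f) = 0 := by
              rw [← hfc (a ^ i * x), mul_assoc b c, ← mul_assoc c f, hc, zero_mul, mul_zero]
            rw [h.da, add_mul, one_mul, smul_mul_assoc, h0, smul_zero, add_zero]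
        _ = _ := ih x
  have hn : a ^ (n + 1) * f = f := by
    have h1 := hdaf i 1
    have h2 := hdaf i (a ^ (n + 1))
    rw [mul_one, hpow, show i + n + 1 = i + (n + 1) by omega, pow_add, h2] at h1
    simpa using h1
  let s : A := ∑ j ∈ Finset.range (n + 1), a ^ j * f
  have hsa : s * a = s := by
    simp only [s, Finset.sum_mul]
    have : ∀ j ∈ Finset.range (n + 1), a ^ j * f * a = a ^ (j + 1) * f := fun j _ => by
      rw [mul_assoc, hfc, ← mul_assoc, pow_succ]
    rw [Finset.sum_congr rfl this]
    have h1 := Finset.sum_range_succ (fun j => a ^ j * f) (n + 1)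
    rw [Finset.sum_range_succ', hn, pow_zero, one_mul, add_left_inj] at h1
    exact h1
  have hsb : s * b = 0 := by
    simp only [s, Finset.sum_mul]
    exact Finset.sum_eq_zero fun j _ => by rw [mul_assoc, hfc, hb, mul_zero]
  have hsc : s * c = 0 := by
    simp only [s, Finset.sum_mul]
    exact Finset.sum_eq_zero fun j _ => by rw [mul_assoc, hfc, hc, mul_zero]
  have hsd : s * d = s := by
    conv_lhs => rw [← hsa]
    rw [mul_assoc, h.ad, mul_add, mul_smul_comm, ← mul_assoc, hsb, zero_mul, smul_zero, mul_one,
      add_zero]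
  have hsε : counit (R := k) s = n + 1 := by
    simp [s, h.counit_a, hf1]
  have hn0 : (n + 1 : k) ≠ 0 := by exact_mod_cast Nat.succ_ne_zero n
  refine ⟨(n + 1 : k)⁻¹ • s, fun x => ?_, by rw [map_smul, hsε, smul_eq_mul, inv_mul_cancel₀ hn0]⟩
  have : s * x = counit (R := k) x • s := by
    refine gen_induction hg (P := fun x => s * x = counit (R := k) x • s) ?_ ?_ ?_ ?_ ?_ ?_ ?_ x
    · rw [h.counit_a, hsa, one_smul]
    · rw [h.counit_b, hsb, zero_smul]
    · rw [h.counit_c, hsc, zero_smul]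
    · rw [h.counit_d, hsd, one_smul]
    · intro r
      rw [Bialgebra.counit_algebraMap, ← Algebra.commutes, Algebra.smul_def]
    · intro x y hx hy
      rw [mul_add, hx, hy, map_add, add_smul]
    · intro x y hx hy
      rw [← mul_assoc, hx, smul_mul_assoc, hy, smul_smul, Bialgebra.counit_mul]
  rw [smul_mul_assoc, this, smul_comm]

theorem pow_span_pair_le (hbc : b * c = c * b) (n : ℕ) : Submodule.span k {b, c} ^ n ≤
    Submodule.span k {x | ∃ i j, i + j = n ∧ x = b ^ i * c ^ j} := by
  induction n with
  | zero =>
    rw [pow_zero, Submodule.one_le]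
    exact Submodule.subset_span ⟨0, 0, rfl, by simp⟩
  | succ n ih =>
    rw [pow_succ]
    refine (mul_le_mul' ih le_rfl).trans ?_
    rw [Submodule.span_mul_span, Submodule.span_le]
    rintro x ⟨_, ⟨i, j, hij, rfl⟩, u, hu, rfl⟩
    apply Submodule.subset_span
    rcases hu with rfl | rfl
    · refine ⟨i + 1, j, by omega, ?_⟩
      have : Commute (c ^ j) u := (show Commute u c from hbc).symm.pow_left j
      change u ^ i * c ^ j * u = _
      rw [mul_assoc, this.eq, ← mul_assoc, pow_succ]
    · exact ⟨i, j + 1, by omega, by change b ^ i * u ^ j * u = _; rw [mul_assoc, pow_succ]⟩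

/-- The ideal generated by `b` and `c` is not idempotent. -/
theorem QMat.not_idempotent [FiniteDimensional k A] [CharZero k] (h : QMat q a b c d)
    (hg : Algebra.adjoin k {a, b, c, d} = ⊤) (hq : q ^ 2 ≠ 1) (hb0 : b ≠ 0)
    (hb : b ∈ Submodule.span k {b, c} ^ 2 * (⊤ : Submodule k A))
    (hc : c ∈ Submodule.span k {b, c} ^ 2 * (⊤ : Submodule k A)) : False := by
  obtain ⟨N, y, hN, hy, hby⟩ := exists_fitting k b
  obtain ⟨M, z, hM, hz, hcz⟩ := exists_fitting k c
  have nb := h.normal_b hg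
  have nc := h.normal_c hg
  have cb := nb.fitting_central hy hby
  have cc := nc.fitting_central hz hcz
  let f := (1 - b ^ N * y) * (1 - c ^ M * z)
  have hfc : ∀ x, f * x = x * f := fun x => by
    simp only [f, mul_assoc, sub_mul _ _ x, one_mul]
    rw [← mul_assoc (c ^ M), cc, ← mul_one_sub x, ← mul_assoc, sub_mul, one_mul, cb, ← mul_one_sub x,
      mul_assoc, mul_sub (1 - b ^ N * y), mul_one, mul_sub x]
  have hbf : b ^ N * f = 0 := by
    simp only [f]
    have h0 : b ^ N * (1 - b ^ N * y) = 0 := by rw [mul_sub, hby, mul_one, sub_self]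
    rw [← mul_assoc, h0, zero_mul]
  have hcf : c ^ M * f = 0 := by
    rw [← hfc]
    simp only [f]
    have h0 : (1 - c ^ M * z) * c ^ M = 0 := by rw [sub_mul, cc, hcz, one_mul, sub_self]
    rw [mul_assoc, h0, mul_zero]
  have hf1 : counit (R := k) f = 1 := by
    simp only [f, Bialgebra.counit_mul, map_sub, Bialgebra.counit_one, Bialgebra.counit_pow,
      h.counit_b, h.counit_c]
    rw [zero_pow (by omega), zero_pow (by omega)]
    simp
  set P := Submodule.span k {b, c} with hP
  have hP2 : P ≤ P ^ 2 * ⊤ := Submodule.span_le.2 (by rintro x (rfl | rfl) <;> assumption)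
  have htop : (⊤ : Submodule k A) * ⊤ ≤ ⊤ := le_top
  have hPn : ∀ n : ℕ, P ≤ P ^ n * (P * ⊤) := by
    intro n
    induction n with
    | zero =>
      rw [pow_zero, one_mul]
      exact fun x hx => by simpa using Submodule.mul_mem_mul hx (Submodule.mem_top (x := (1 : A)))
    | succ n ih =>
      calc P ≤ P ^ n * (P * ⊤) := ih
        _ ≤ P ^ n * ((P ^ 2 * ⊤) * ⊤) := by gcongr
        _ = P ^ (n + 1) * (P * (⊤ * ⊤)) := by rw [pow_succ P n, pow_two]; simp only [mul_assoc]
        _ ≤ _ := by gcongr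
  have hkill : ∀ x ∈ P, x * f = 0 := by
    intro x hx
    have hx' := hPn (N + M) hx
    clear hx
    induction hx' using Submodule.mul_induction_on' with
    | mem_mul_mem m hm t ht =>
      rw [mul_assoc, ← hfc, ← mul_assoc]
      have : m * f = 0 := by
        have hm' := pow_span_pair_le h.bc (N + M) hm
        clear hm
        induction hm' using Submodule.span_induction with
        | mem w hw =>
          obtain ⟨i, j, hij, rfl⟩ := hw
          rcases (by omega : N ≤ i ∨ M ≤ j) with h1 | h1
          · obtain ⟨r, rfl⟩ := Nat.exists_eq_add_of_le h1
            rw [← hfc, pow_add, ← mul_assoc, ← mul_assoc, hfc, hbf]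
            simp
          · obtain ⟨r, rfl⟩ := Nat.exists_eq_add_of_le' h1
            rw [pow_add, mul_assoc, mul_assoc, hcf]
            simp
        | zero => simp
        | add u v _ _ hu hv => rw [add_mul, hu, hv, add_zero]
        | smul r u _ hu => rw [smul_mul_assoc, hu, smul_zero]
      rw [this, zero_mul]
    | add u _ v _ hu hv => rw [add_mul, hu, hv, add_zero]
  have hb' : b * f = 0 := hkill b (Submodule.subset_span (by simp))
  have hc' : c * f = 0 := hkill c (Submodule.subset_span (by simp))
  obtain ⟨f0, hf0, hf01⟩ := h.exists_rightInt hg hfc hf1 hb' hc'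
  have hSb : antipode k (antipode k b) = (q ^ 2)⁻¹ • b := by
    rw [h.antipode_b, map_smul, h.antipode_b, smul_smul]
    congr 1
    field_simp
  have hSc : antipode k (antipode k c) = q ^ 2 • c := by
    rw [h.antipode_c, map_smul, h.antipode_c, smul_smul]
    congr 1
    ring
  have eb := fitting_eq_zero hf0 hf01 hN nb hy hby (fun h1 => hq (inv_eq_one.1 h1)) hSb
  have ec := fitting_eq_zero hf0 hf01 hM nc hz hcz hq hSc
  simp only [f, eb, ec, sub_zero, mul_one] at hb'
  exact hb0 hb'

end NotSquare

section Eigen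

theorem exists_eigen_mod {k E : Type} [Field k] [IsAlgClosed k] [AddCommGroup E] [Module k E]
    [FiniteDimensional k E] (T : E →ₗ[k] E) {U N : Submodule k E} (hU : ∀ u ∈ U, T u ∈ U)
    (hN : ∀ u ∈ N, T u ∈ N) (h : ¬ U ≤ N) : ∃ u ∈ U, u ∉ N ∧ ∃ s : k, T u - s • u ∈ N := by
  let T' : (E ⧸ N) →ₗ[k] (E ⧸ N) := N.mapQ N T hN
  have hT' : ∀ x ∈ U.map N.mkQ, T' x ∈ U.map N.mkQ := by
    rintro _ ⟨u, hu, rfl⟩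
    exact ⟨T u, hU u hu, rfl⟩
  have : Nontrivial (U.map N.mkQ) := by
    rw [Submodule.nontrivial_iff_ne_bot]
    intro h0
    exact h fun u hu => by
      have : N.mkQ u ∈ U.map N.mkQ := ⟨u, hu, rfl⟩
      rw [h0, Submodule.mem_bot] at this
      simpa using this
  obtain ⟨s, hs⟩ := Module.End.exists_eigenvalue (T'.restrict hT')
  obtain ⟨⟨v, u, hu, huv⟩, hv⟩ := hs.exists_hasEigenvector
  have h1 : T' v = s • v := congrArg Subtype.val hv.apply_eq_smul
  have h2 : v ≠ 0 := fun h0 => hv.2 (Subtype.ext h0)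
  subst huv
  refine ⟨u, hu, fun hn => h2 (by simpa using hn), s, ?_⟩
  have h3 : N.mkQ (T u - s • u) = 0 := by
    rw [map_sub, map_smul, ← h1]
    exact sub_self _
  exact (Submodule.Quotient.mk_eq_zero N).1 h3

theorem exists_algHom {k A X : Type} [Field k] [Ring A] [Algebra k A] [AddCommGroup X] [Module k X]
    (F : A →ₗ[k] X →ₗ[k] k) {S : Set X} (hne : ∃ w ∈ S, F 1 w ≠ 0)
    (ht : ∀ y, ∃ t, ∀ w ∈ S, F y w = t * F 1 w)
    (hmul : ∀ x y s t, (∀ w ∈ S, F x w = s * F 1 w) → (∀ w ∈ S, F y w = t * F 1 w) →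
      ∀ w ∈ S, F (x * y) w = s * t * F 1 w) :
    ∃ η : A →ₐ[k] k, ∀ y, ∀ w ∈ S, F y w = η y * F 1 w := by
  choose t ht using ht
  obtain ⟨w, hw, hw0⟩ := hne
  have uniq : ∀ y s, F y w = s * F 1 w → t y = s := fun y s h => by
    rw [ht y w hw] at h
    exact mul_right_cancel₀ hw0 h
  let η : A →ₗ[k] k :=
    { toFun := t
      map_add' := fun x y => uniq _ _ (by
        rw [map_add, LinearMap.add_apply, ht x w hw, ht y w hw, add_mul])
      map_smul' := fun r y => uniq _ _ (by
        rw [map_smul, LinearMap.smul_apply, ht y w hw, smul_eq_mul, RingHom.id_apply, smul_eq_mul,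
          mul_assoc]) }
  exact ⟨AlgHom.ofLinearMap η (uniq _ _ (one_mul _).symm)
    fun x y => uniq _ _ (hmul x y _ _ (ht x) (ht y) w hw), fun y w hw => ht y w hw⟩

variable {k A : Type} [Field k] [Ring A] [HopfAlgebra k A]

/-- The right translation `x ↦ x₁ g(x₂)`. -/
noncomputable def rtrans (g : A →ₐ[k] k) : A →ₐ[k] A :=
  (Algebra.TensorProduct.rid k k A).toAlgHom.comp
    ((Algebra.TensorProduct.map (AlgHom.id k A) g).comp (Bialgebra.comulAlgHom k A))

theorem rtrans_apply (g : A →ₐ[k] k) (x : A) :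
    rtrans g x = TensorProduct.rid k A (g.toLinearMap.lTensor A (comul x)) := rfl

/-- The convolution inverse of a character. -/
noncomputable def charInv (g : A →ₐ[k] k) : A →ₐ[k] k :=
  AlgHom.ofLinearMap (g.toLinearMap ∘ₗ antipode k) (by simp)
    (fun x y => by simp [antipode_mul_antidistrib, mul_comm])

theorem charInv_apply (g : A →ₐ[k] k) (x : A) : charInv g x = g (antipode k x) := rfl

end Eigen

section Generators

variable {k A : Type} [Field k] [Ring A] [Algebra k A] {a b c d : A}

theorem algHom_ext_gen {B : Type} [Ring B] [Algebra k B]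
    (hg : Algebra.adjoin k {a, b, c, d} = ⊤) {f g : A →ₐ[k] B} (ha : f a = g a) (hb : f b = g b)
    (hc : f c = g c) (hd : f d = g d) : f = g :=
  AlgHom.ext_of_adjoin_eq_top hg (by rintro x (rfl | rfl | rfl | rfl) <;> assumption)

end Generators

section SkewDerivation

variable {k A : Type} [Field k] [Ring A] [HopfAlgebra k A] {q : k} {a b c d : A}

theorem QMat.rtrans_char (h : QMat q a b c d) {g : A →ₐ[k] k} (hb : g b = 0) (hc : g c = 0) :
    rtrans g a = g a • a ∧ rtrans g b = g d • b ∧ rtrans g c = g a • c ∧ rtrans g d = g d • d := by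
  simp [rtrans_apply, h.comul_a, h.comul_b, h.comul_c, h.comul_d, hb, hc]

/-- A functional supported on the cotangent space of the trivial character. -/
theorem QMat.exists_cotangent [IsAlgClosed k] [FiniteDimensional k A] [CharZero k]
    (h : QMat q a b c d) (hg : Algebra.adjoin k {a, b, c, d} = ⊤) (hq : q ^ 2 ≠ 1) (hb0 : b ≠ 0) :
    ∃ ψ : A →ₗ[k] k, (∀ x, ψ (b * x) = ψ b * counit (R := k) x) ∧
      (∀ x, ψ (c * x) = ψ c * counit (R := k) x) ∧ (ψ b ≠ 0 ∨ ψ c ≠ 0) := by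
  have nb := h.normal_b hg
  have nc := h.normal_c hg
  set P := Submodule.span k {b, c} with hP
  have hbP : b ∈ P := Submodule.subset_span (by simp)
  have hcP : c ∈ P := Submodule.subset_span (by simp)
  set J := P ^ 2 * (⊤ : Submodule k A) with hJ
  have hJmul : ∀ x ∈ J, ∀ y, x * y ∈ J := by
    intro x hx y
    induction hx using Submodule.mul_induction_on' with
    | mem_mul_mem m hm t ht =>
      rw [mul_assoc]; exact Submodule.mul_mem_mul hm trivial
    | add u _ v _ hu hv => rw [add_mul]; exact J.add_mem hu hv
  have hJuv : ∀ u ∈ P, ∀ v ∈ P, ∀ y, u * v * y ∈ J := fun u hu v hv y => by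
    rw [hJ, pow_two]; exact Submodule.mul_mem_mul (Submodule.mul_mem_mul hu hv) trivial
  let U : Submodule k (A →ₗ[k] k) := J.dualAnnihilator
  have hUmem : ∀ ψ, ψ ∈ U ↔ ∀ x ∈ J, ψ x = 0 := fun ψ => Submodule.mem_dualAnnihilator ψ
  let 𝔟 : Set A := {w | ∃ y, w = b * y ∨ w = c * y}
  let N : Submodule k (A →ₗ[k] k) :=
    { carrier := {ψ | ∀ w ∈ 𝔟, ψ w = 0}
      add_mem' := fun hu hv w hw => by rw [LinearMap.add_apply, hu w hw, hv w hw, add_zero]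
      zero_mem' := fun w _ => rfl
      smul_mem' := fun r u hu w hw => by rw [LinearMap.smul_apply, hu w hw, smul_zero] }
  have h𝔟 : ∀ w ∈ 𝔟, ∀ y, w * y ∈ 𝔟 := by
    rintro _ ⟨x, rfl | rfl⟩ y
    · exact ⟨x * y, Or.inl (mul_assoc _ _ _)⟩
    · exact ⟨x * y, Or.inr (mul_assoc _ _ _)⟩
  have h𝔟J : ∀ w ∈ 𝔟, ∀ u, u = b ∨ u = c → w * u ∈ J := by
    rintro w hw u hu
    have huP : u ∈ P := by rcases hu with rfl | rfl <;> assumption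
    have hnu : IsNormalElem u := by rcases hu with rfl | rfl <;> assumption
    obtain ⟨x, hx⟩ := hw
    obtain ⟨y, hy⟩ := hnu.right x
    rcases hx with rfl | rfl <;> rw [mul_assoc, hy, ← mul_assoc]
    · exact hJuv _ hbP _ huP _
    · exact hJuv _ hcP _ huP _
  have hUN : ¬ U ≤ N := by
    intro hle
    have key : ∀ x, (x = b ∨ x = c) → x ∈ J := by
      intro x hx
      by_contra hxJ
      obtain ⟨ψ, hψ, hψJ⟩ := Submodule.exists_le_ker_of_notMem hxJ
      refine hψ (hle ((hUmem ψ).2 fun y hy => hψJ hy) x ⟨1, ?_⟩)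
      simpa using hx
    exact h.not_idempotent hg hq hb0 (key b (Or.inl rfl)) (key c (Or.inr rfl))
  obtain ⟨ψ, hψU, hψN, s, hs⟩ := exists_eigen_mod
    ((LinearMap.mulRight k a).dualMap : (A →ₗ[k] k) →ₗ[k] (A →ₗ[k] k))
    (U := U) (N := N) (fun u hu => (hUmem _).2 fun x hx => (hUmem u).1 hu _ (hJmul x hx a))
    (fun u hu w hw => hu _ (h𝔟 w hw a)) hUN
  have hψa : ∀ w ∈ 𝔟, ψ (w * a) = s * ψ w := fun w hw => by
    simpa [sub_eq_zero] using hs w hw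
  have hψu : ∀ w ∈ 𝔟, ∀ u, u = b ∨ u = c → ψ (w * u) = 0 := fun w hw u hu =>
    (hUmem ψ).1 hψU _ (h𝔟J w hw u hu)
  obtain ⟨w0, hw0, hwψ⟩ : ∃ w ∈ 𝔟, ψ w ≠ 0 := by
    by_contra! hcon
    exact hψN hcon
  have hψda : ∀ w ∈ 𝔟, s * ψ (w * d) = ψ w := fun w hw => by
    rw [← hψa _ (h𝔟 w hw d), mul_assoc, h.da, mul_add, mul_one, mul_smul_comm, map_add, map_smul,
      ← mul_assoc, hψu _ (h𝔟 w hw b) c (Or.inr rfl), smul_zero, add_zero]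
  have hs0 : s ≠ 0 := by
    rintro rfl
    exact hwψ (by rw [← hψda w0 hw0, zero_mul])
  have hs1 : ∀ w ∈ 𝔟, ψ (w * d) = s⁻¹ * ψ w := fun w hw => by
    rw [← hψda w hw, ← mul_assoc, inv_mul_cancel₀ hs0, one_mul]
  obtain ⟨η, hη⟩ := exists_algHom ((LinearMap.mul k A).flip.compr₂ ψ) (S := 𝔟)
    ⟨w0, hw0, by simpa using hwψ⟩ (fun y => by
      simp only [LinearMap.compr₂_apply, LinearMap.flip_apply, LinearMap.mul_apply', mul_one]
      refine gen_induction hg (P := fun y => ∃ t, ∀ w ∈ 𝔟, ψ (w * y) = t * ψ w) ⟨s, hψa⟩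
        ⟨0, fun w hw => by rw [zero_mul, hψu w hw b (Or.inl rfl)]⟩
        ⟨0, fun w hw => by rw [zero_mul, hψu w hw c (Or.inr rfl)]⟩ ⟨s⁻¹, hs1⟩
        (fun r => ⟨r, fun w hw => ?_⟩) ?_ ?_ y
      · rw [← Algebra.commutes, ← Algebra.smul_def, map_smul, smul_eq_mul]
      · rintro x y ⟨t, ht⟩ ⟨t', ht'⟩
        exact ⟨t + t', fun w hw => by rw [mul_add, map_add, ht w hw, ht' w hw, add_mul]⟩
      · rintro x y ⟨t, ht⟩ ⟨t', ht'⟩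
        exact ⟨t' * t, fun w hw => by
          rw [← mul_assoc, ht' _ (h𝔟 w hw x), ht w hw, mul_assoc]⟩) (by
    simp only [LinearMap.compr₂_apply, LinearMap.flip_apply, LinearMap.mul_apply', mul_one]
    intro x y t t' ht ht' w hw
    rw [← mul_assoc, ht' _ (h𝔟 w hw x), ht w hw]
    ring)
  simp only [LinearMap.compr₂_apply, LinearMap.flip_apply, LinearMap.mul_apply', mul_one] at hη
  have cancel : ∀ {x y : k}, x * ψ w0 = y * ψ w0 → x = y := fun h => mul_right_cancel₀ hwψ h
  have ηa : η a = s := cancel (by rw [← hη a w0 hw0, hψa w0 hw0])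
  have ηd : η d = s⁻¹ := cancel (by rw [← hη d w0 hw0, hs1 w0 hw0])
  have ηb : η b = 0 := cancel (by rw [← hη b w0 hw0, hψu w0 hw0 b (Or.inl rfl), zero_mul])
  have ηc : η c = 0 := cancel (by rw [← hη c w0 hw0, hψu w0 hw0 c (Or.inr rfl), zero_mul])
  have ib : charInv η b = 0 := by rw [charInv_apply, h.antipode_b, map_smul, ηb, smul_zero]
  have ic : charInv η c = 0 := by rw [charInv_apply, h.antipode_c, map_smul, ηc, smul_zero]
  have ia : charInv η a = s⁻¹ := by rw [charInv_apply, h.antipode_a, ηd]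
  have id' : charInv η d = s := by rw [charInv_apply, h.antipode_d, ηa]
  obtain ⟨ta, tb, tc, td⟩ := h.rtrans_char ib ic
  have hηθ : η.comp (rtrans (charInv η)) = Bialgebra.counitAlgHom k A := by
    apply algHom_ext_gen hg
    · simp [ta, ia, ηa, hs0, h.counit_a]
    · simp [tb, ηb, h.counit_b]
    · simp [tc, ηc, h.counit_c]
    · simp [td, id', ηd, hs0, h.counit_d]
  have hηθ' : ∀ x, η (rtrans (charInv η) x) = counit (R := k) x := fun x =>
    DFunLike.congr_fun hηθ x
  have hb𝔟 : b ∈ 𝔟 := ⟨1, by simp⟩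
  have hc𝔟 : c ∈ 𝔟 := ⟨1, by simp⟩
  refine ⟨ψ ∘ₗ (rtrans (charInv η)).toLinearMap, fun x => ?_, fun x => ?_, ?_⟩
  · simp only [LinearMap.comp_apply, AlgHom.toLinearMap_apply, map_mul, tb, id', smul_mul_assoc,
      map_smul, smul_eq_mul, hη _ b hb𝔟, hηθ']
    ring
  · simp only [LinearMap.comp_apply, AlgHom.toLinearMap_apply, map_mul, tc, ia, smul_mul_assoc,
      map_smul, smul_eq_mul, hη _ c hc𝔟, hηθ']
    ring
  · simp only [LinearMap.comp_apply, AlgHom.toLinearMap_apply, tb, tc, ia, id', map_smul,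
      smul_eq_mul, mul_ne_zero_iff, ne_eq, hs0, inv_eq_zero, not_false_eq_true, true_and]
    by_contra! hcon
    obtain ⟨x, hx⟩ := hw0
    rcases hx with rfl | rfl
    · rw [hη x b hb𝔟, hcon.1, mul_zero] at hwψ
      exact hwψ rfl
    · rw [hη x c hc𝔟, hcon.2, mul_zero] at hwψ
      exact hwψ rfl

/-- A nonzero skew derivation. -/
theorem QMat.exists_skew [IsAlgClosed k] [FiniteDimensional k A] [CharZero k]
    (h : QMat q a b c d) (hg : Algebra.adjoin k {a, b, c, d} = ⊤) (hq : q ^ 2 ≠ 1) (hb0 : b ≠ 0) :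
    ∃ (g : A →ₐ[k] k) (E : A →ₗ[k] k), g a = q ∧ g b = 0 ∧ g c = 0 ∧ g d = q⁻¹ ∧
      (∀ x y, E (x * y) = g x * E y + E x * counit (R := k) y) ∧ E a = 0 ∧ E d = 0 ∧
      (E b ≠ 0 ∨ E c ≠ 0) := by
  obtain ⟨ψ, hψb, hψc, hne⟩ := h.exists_cotangent hg hq hb0
  have nb := h.normal_b hg
  have nc := h.normal_c hg
  have hq0 := h.q_ne
  let S : Set A := {w | ∃ y, w = b * y ∨ w = c * y}
  have hSψ : ∀ w ∈ S, ∀ y, ψ (w * y) = ψ w * counit (R := k) y := by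
    rintro _ ⟨x, rfl | rfl⟩ y
    · rw [mul_assoc, hψb, hψb, Bialgebra.counit_mul, mul_assoc]
    · rw [mul_assoc, hψc, hψc, Bialgebra.counit_mul, mul_assoc]
  have hSr : ∀ w ∈ S, ∀ y, w * y ∈ S := by
    rintro _ ⟨x, rfl | rfl⟩ y
    · exact ⟨x * y, Or.inl (mul_assoc _ _ _)⟩
    · exact ⟨x * y, Or.inr (mul_assoc _ _ _)⟩
  have hSl : ∀ w ∈ S, ∀ y, y * w ∈ S := by
    rintro _ ⟨x, rfl | rfl⟩ y
    · obtain ⟨z, hz⟩ := nb.right y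
      exact ⟨z * x, Or.inl (by rw [← mul_assoc, hz, mul_assoc])⟩
    · obtain ⟨z, hz⟩ := nc.right y
      exact ⟨z * x, Or.inr (by rw [← mul_assoc, hz, mul_assoc])⟩
  have hbS : b ∈ S := ⟨1, by simp⟩
  have hcS : c ∈ S := ⟨1, by simp⟩
  have hb0S : ∀ w ∈ S, ψ (b * w) = 0 := by
    rintro _ ⟨x, rfl | rfl⟩ <;> simp [hψb, h.counit_b, h.counit_c]
  have hc0S : ∀ w ∈ S, ψ (c * w) = 0 := by
    rintro _ ⟨x, rfl | rfl⟩ <;> simp [hψc, h.counit_b, h.counit_c]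
  have hSa : ∀ w ∈ S, ψ (a * w) = q * ψ w := by
    rintro _ ⟨x, rfl | rfl⟩
    · rw [← mul_assoc, h.ab, smul_mul_assoc, mul_assoc, map_smul, hψb, hψb, Bialgebra.counit_mul,
        h.counit_a, one_mul, smul_eq_mul]
    · rw [← mul_assoc, h.ac, smul_mul_assoc, mul_assoc, map_smul, hψc, hψc, Bialgebra.counit_mul,
        h.counit_a, one_mul, smul_eq_mul]
  have hSd : ∀ w ∈ S, ψ (d * w) = q⁻¹ * ψ w := by
    rintro _ ⟨x, rfl | rfl⟩
    · have : d * b = q⁻¹ • (b * d) := by rw [h.bd, smul_smul, inv_mul_cancel₀ hq0, one_smul]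
      rw [← mul_assoc, this, smul_mul_assoc, mul_assoc, map_smul, hψb, hψb, Bialgebra.counit_mul,
        h.counit_d, one_mul, smul_eq_mul]
    · have : d * c = q⁻¹ • (c * d) := by rw [h.cd, smul_smul, inv_mul_cancel₀ hq0, one_smul]
      rw [← mul_assoc, this, smul_mul_assoc, mul_assoc, map_smul, hψc, hψc, Bialgebra.counit_mul,
        h.counit_d, one_mul, smul_eq_mul]
  obtain ⟨w0, hw0, hwψ⟩ : ∃ w ∈ S, ψ w ≠ 0 := by
    rcases hne with hne | hne
    exacts [⟨b, hbS, hne⟩, ⟨c, hcS, hne⟩]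
  obtain ⟨g, hgS⟩ := exists_algHom ((LinearMap.mul k A).compr₂ ψ) (S := S)
    ⟨w0, hw0, by simpa using hwψ⟩ (fun y => by
      simp only [LinearMap.compr₂_apply, LinearMap.mul_apply', one_mul]
      refine gen_induction hg (P := fun y => ∃ t, ∀ w ∈ S, ψ (y * w) = t * ψ w) ⟨q, hSa⟩
        ⟨0, fun w hw => by rw [zero_mul, hb0S w hw]⟩
        ⟨0, fun w hw => by rw [zero_mul, hc0S w hw]⟩ ⟨q⁻¹, hSd⟩
        (fun r => ⟨r, fun w hw => ?_⟩) ?_ ?_ y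
      · rw [← Algebra.smul_def, map_smul, smul_eq_mul]
      · rintro x y ⟨t, ht⟩ ⟨t', ht'⟩
        exact ⟨t + t', fun w hw => by rw [add_mul, map_add, ht w hw, ht' w hw, add_mul]⟩
      · rintro x y ⟨t, ht⟩ ⟨t', ht'⟩
        exact ⟨t * t', fun w hw => by
          rw [mul_assoc, ht _ (hSl w hw y), ht' w hw, mul_assoc]⟩) (by
    simp only [LinearMap.compr₂_apply, LinearMap.mul_apply', one_mul]
    intro x y t t' ht ht' w hw
    rw [mul_assoc, ht _ (hSl w hw y), ht' w hw, mul_assoc])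
  simp only [LinearMap.compr₂_apply, LinearMap.mul_apply', one_mul] at hgS
  have cancel : ∀ {x y : k}, x * ψ w0 = y * ψ w0 → x = y := fun h => mul_right_cancel₀ hwψ h
  have ga : g a = q := cancel (by rw [← hgS a w0 hw0, hSa w0 hw0])
  have gd : g d = q⁻¹ := cancel (by rw [← hgS d w0 hw0, hSd w0 hw0])
  have gb : g b = 0 := cancel (by rw [← hgS b w0 hw0, hb0S w0 hw0, zero_mul])
  have gc : g c = 0 := cancel (by rw [← hgS c w0 hw0, hc0S w0 hw0, zero_mul])
  have hspanl : ∀ w ∈ Submodule.span k S, ∀ x, ψ (x * w) = g x * ψ w := by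
    intro w hw x
    induction hw using Submodule.span_induction with
    | mem w hw => exact hgS x w hw
    | zero => simp
    | add u v _ _ hu hv => rw [mul_add, map_add, map_add, hu, hv, mul_add]
    | smul r u _ hu => rw [mul_smul_comm, map_smul, map_smul, hu, smul_eq_mul, smul_eq_mul]; ring
  have hspanr : ∀ w ∈ Submodule.span k S, ∀ x, ψ (w * x) = ψ w * counit (R := k) x := by
    intro w hw x
    induction hw using Submodule.span_induction with
    | mem w hw => exact hSψ w hw x
    | zero => simp
    | add u v _ _ hu hv => rw [add_mul, map_add, map_add, hu, hv, add_mul]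
    | smul r u _ hu => rw [smul_mul_assoc, map_smul, map_smul, hu, smul_eq_mul, smul_eq_mul]; ring
  have hideal : ∀ w ∈ Submodule.span k S, ∀ x,
      x * w ∈ Submodule.span k S ∧ w * x ∈ Submodule.span k S := by
    intro w hw x
    induction hw using Submodule.span_induction with
    | mem w hw => exact ⟨Submodule.subset_span (hSl w hw x), Submodule.subset_span (hSr w hw x)⟩
    | zero => simp
    | add u v _ _ hu hv =>
      rw [mul_add, add_mul]; exact ⟨add_mem hu.1 hv.1, add_mem hu.2 hv.2⟩
    | smul r u _ hu =>
      rw [mul_smul_comm, smul_mul_assoc]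
      exact ⟨Submodule.smul_mem _ _ hu.1, Submodule.smul_mem _ _ hu.2⟩
  have hbs := Submodule.subset_span (R := k) hbS
  have hcs := Submodule.subset_span (R := k) hcS
  have hcomm : ∀ x, x * a - a * x ∈ Submodule.span k S := by
    intro x
    refine gen_induction hg (P := fun x => x * a - a * x ∈ Submodule.span k S) ?_ ?_ ?_ ?_ ?_ ?_ ?_ x
    · simp
    · exact sub_mem (hideal b hbs a).2 (hideal b hbs a).1
    · exact sub_mem (hideal c hcs a).2 (hideal c hcs a).1
    · rw [h.da, h.ad, add_sub_add_left_eq_sub, ← sub_smul]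
      exact Submodule.smul_mem _ _ (hideal b hbs c).2
    · intro r
      rw [Algebra.commutes, sub_self]
      exact zero_mem _
    · intro x y hx hy
      convert add_mem hx hy using 1
      noncomm_ring
    · intro x y hx hy
      convert add_mem (hideal _ hy x).1 (hideal _ hx y).2 using 1
      noncomm_ring
  refine ⟨g, ψ ∘ₗ (LinearMap.mulRight k a - LinearMap.mulLeft k a), ga, gb, gc, gd, ?_, ?_, ?_, ?_⟩
  · intro x y
    simp only [LinearMap.comp_apply, LinearMap.sub_apply, LinearMap.mulRight_apply,
      LinearMap.mulLeft_apply]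
    rw [← hspanl _ (hcomm y), ← hspanr _ (hcomm x), ← map_add]
    congr 1
    noncomm_ring
  · simp
  · simp only [LinearMap.comp_apply, LinearMap.sub_apply, LinearMap.mulRight_apply,
      LinearMap.mulLeft_apply]
    rw [h.da, h.ad, add_sub_add_left_eq_sub, ← sub_smul, map_smul, hψb, h.counit_c, mul_zero,
      smul_zero]
  · simp only [LinearMap.comp_apply, LinearMap.sub_apply, LinearMap.mulRight_apply,
      LinearMap.mulLeft_apply]
    have hq1 : (1 - q) ≠ 0 := fun h1 => hq (by rw [← sub_eq_zero.1 h1, one_pow])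
    have e1 : ψ (b * a - a * b) = (1 - q) * ψ b := by
      rw [h.ab, map_sub, map_smul, hψb, h.counit_a, smul_eq_mul]; ring
    have e2 : ψ (c * a - a * c) = (1 - q) * ψ c := by
      rw [h.ac, map_sub, map_smul, hψc, h.counit_a, smul_eq_mul]; ring
    rw [e1, e2]
    exact hne.imp (mul_ne_zero hq1) (mul_ne_zero hq1)

end SkewDerivation

section Act

variable {k A : Type} [Field k] [Ring A] [HopfAlgebra k A]

/-- The operator `x ↦ x₁ f(x₂)`. -/
noncomputable def rhit (f : A →ₗ[k] k) : A →ₗ[k] A :=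
  (TensorProduct.rid k A).toLinearMap ∘ₗ f.lTensor A ∘ₗ comul

theorem rhit_apply (f : A →ₗ[k] k) (x : A) :
    rhit f x = TensorProduct.rid k A (f.lTensor A (comul x)) := rfl

theorem counit_rhit (f : A →ₗ[k] k) (x : A) : counit (R := k) (rhit f x) = f x := by
  have key : ∀ z : A ⊗[k] A, counit (R := k) (TensorProduct.rid k A (f.lTensor A z)) =
      f (TensorProduct.lid k A (counit.rTensor A z)) := by
    intro z
    induction z with
    | zero => simp
    | add u v hu hv => simp only [map_add, hu, hv]
    | tmul u v => simp [mul_comm]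
  rw [rhit_apply, key, rTensor_counit_comul]
  simp

theorem rhit_mul_skew {g : A →ₐ[k] k} {E : A →ₗ[k] k}
    (hE : ∀ x y, E (x * y) = g x * E y + E x * counit (R := k) y) (x y : A) :
    rhit E (x * y) = rtrans g x * rhit E y + rhit E x * y := by
  have key : ∀ z w : A ⊗[k] A, TensorProduct.rid k A (E.lTensor A (z * w)) =
      TensorProduct.rid k A (g.toLinearMap.lTensor A z) * TensorProduct.rid k A (E.lTensor A w) +
      TensorProduct.rid k A (E.lTensor A z) * TensorProduct.rid k A (counit.lTensor A w) := by
    intro z w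
    induction z with
    | zero => simp
    | add u v hu hv => simp only [map_add, add_mul, hu, hv]; abel
    | tmul u v =>
      induction w with
      | zero => simp
      | add s t hs ht => simp only [map_add, mul_add, hs, ht]; abel
      | tmul s t =>
        simp [hE, add_smul, smul_smul, mul_comm]
  rw [rhit_apply, Bialgebra.comul_mul, key, lTensor_counit_comul]
  simp [rhit_apply, rtrans_apply]

variable [FiniteDimensional k A]

/-- The right hit action of the dual. -/
noncomputable def act : DualH k A →ₐ[k] Module.End k A :=
  AlgHom.ofLinearMap
    { toFun := fun f => rhit (toDual f)
      map_add' := fun f h => by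
        ext x
        simp [rhit_apply, LinearMap.lTensor_add]
      map_smul' := fun r h => by
        ext x
        simp [rhit_apply, LinearMap.lTensor_smul] }
    (by
      ext x
      have : toDual (1 : DualH k A) = counit := LinearMap.ext dualH_one
      simp [rhit_apply, this])
    (by
      intro f h
      ext x
      have e1 : ∀ (z : A ⊗[k] A) (y : A), toDual h y • TensorProduct.rid k A ((toDual f).lTensor A z) =
          TensorProduct.rid k A ((ev2 (f ⊗ₜ h)).lTensor A (TensorProduct.assoc k A A A (z ⊗ₜ y))) := by
        intro z y
        induction z with
        | zero => simp
        | add u v hu hv => simp only [map_add, smul_add, TensorProduct.add_tmul, hu, hv]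
        | tmul u v => simp [smul_smul, ev2_tmul, mul_comm]
      have e2 : ∀ z : A ⊗[k] A, rhit (toDual f) (TensorProduct.rid k A ((toDual h).lTensor A z)) =
          TensorProduct.rid k A ((ev2 (f ⊗ₜ h)).lTensor A
            (TensorProduct.assoc k A A A (comul.rTensor A z))) := by
        intro z
        induction z with
        | zero => simp
        | add u v hu hv => simp only [map_add, hu, hv]
        | tmul u v => simp [← e1, rhit_apply]
      change rhit (toDual (f * h)) x = rhit (toDual f) (rhit (toDual h) x)
      have e3 : toDual (f * h) = ev2 (f ⊗ₜ h) ∘ₗ comul := LinearMap.ext (dualH_mul_apply f h)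
      rw [rhit_apply (toDual h) x, e2, coassoc_apply, rhit_apply, e3, LinearMap.lTensor_comp_apply])

theorem act_apply (f : DualH k A) (x : A) : act f x = rhit (toDual f) x := rfl

theorem toDual_eq_counit_act (f : DualH k A) (x : A) :
    toDual f x = counit (R := k) (act f x) := (counit_rhit _ _).symm

theorem act_injective : Function.Injective (act : DualH k A → Module.End k A) := fun f h hfh =>
  dualH_ext fun x => by rw [toDual_eq_counit_act, toDual_eq_counit_act, hfh]

end Act

section SkewData

variable {k A : Type} [Field k] [Ring A] [HopfAlgebra k A]

/-- The left translation `x ↦ g(x₁) x₂`. -/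
noncomputable def ltrans (g : A →ₐ[k] k) : A →ₐ[k] A :=
  (Algebra.TensorProduct.lid k A).toAlgHom.comp
    ((Algebra.TensorProduct.map g (AlgHom.id k A)).comp (Bialgebra.comulAlgHom k A))

theorem ltrans_apply (g : A →ₐ[k] k) (x : A) :
    ltrans g x = TensorProduct.lid k A (g.toLinearMap.rTensor A (comul x)) := rfl

/-- A skew derivation dual to the generator `b` of a quantum matrix. -/
structure SkewData (q : k) (a b c d : A) (g : A →ₐ[k] k) (E : A →ₗ[k] k) : Prop where
  g_a : g a = q
  g_b : g b = 0
  g_c : g c = 0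
  g_d : g d = q⁻¹
  leibniz : ∀ x y, E (x * y) = g x * E y + E x * counit (R := k) y
  E_a : E a = 0
  E_b : E b ≠ 0
  E_c : E c = 0 ∨ q ^ 2 = -1
  E_d : E d = 0

theorem QMat.ltrans_char {q : k} {a b c d : A} (h : QMat q a b c d) {g : A →ₐ[k] k} (hb : g b = 0)
    (hc : g c = 0) :
    ltrans g a = g a • a ∧ ltrans g b = g a • b ∧ ltrans g c = g d • c ∧ ltrans g d = g d • d := by
  simp [ltrans_apply, h.comul_a, h.comul_b, h.comul_c, h.comul_d, hb, hc]

theorem QMat.exists_skewData_of_ne {q : k} {a b c d : A} (h : QMat q a b c d)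
    (hg : Algebra.adjoin k {a, b, c, d} = ⊤) (hq : q ^ 2 ≠ 1) {g : A →ₐ[k] k} {E : A →ₗ[k] k}
    (ga : g a = q) (gb : g b = 0) (gc : g c = 0) (gd : g d = q⁻¹)
    (hE : ∀ x y, E (x * y) = g x * E y + E x * counit (R := k) y) (Ea : E a = 0) (Ed : E d = 0)
    (Eb : E b ≠ 0) : ∃ E', SkewData q a b c d g E' := by
  by_cases hq2 : q ^ 2 = -1
  · exact ⟨E, ga, gb, gc, gd, hE, Ea, Eb, Or.inr hq2, Ed⟩
  have hq0 := h.q_ne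
  have ia : charInv g a = q⁻¹ := by rw [charInv_apply, h.antipode_a, gd]
  have ib : charInv g b = 0 := by rw [charInv_apply, h.antipode_b, map_smul, gb, smul_zero]
  have ic : charInv g c = 0 := by rw [charInv_apply, h.antipode_c, map_smul, gc, smul_zero]
  have id' : charInv g d = q := by rw [charInv_apply, h.antipode_d, ga]
  obtain ⟨ra, rb, rc, rd⟩ := h.rtrans_char ib ic
  obtain ⟨la, lb, lc, ld⟩ := h.ltrans_char gb gc
  obtain ⟨Ad, Ada, Adb, Adc, Add⟩ : ∃ Ad : A →ₐ[k] A, Ad a = a ∧ Ad b = q ^ 2 • b ∧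
      Ad c = (q ^ 2)⁻¹ • c ∧ Ad d = d := by
    refine ⟨(ltrans g).comp (rtrans (charInv g)), ?_, ?_, ?_, ?_⟩
    · rw [AlgHom.comp_apply, ra, map_smul, la, ia, ga, smul_smul, inv_mul_cancel₀ hq0, one_smul]
    · rw [AlgHom.comp_apply, rb, map_smul, lb, id', ga, smul_smul, pow_two]
    · rw [AlgHom.comp_apply, rc, map_smul, lc, ia, gd, smul_smul, pow_two, mul_inv]
    · rw [AlgHom.comp_apply, rd, map_smul, ld, id', gd, smul_smul, mul_inv_cancel₀ hq0, one_smul]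
  have hgAd : ∀ x, g (Ad x) = g x := fun x =>
    DFunLike.congr_fun (algHom_ext_gen hg (f := g.comp Ad) (g := g) (by simp [Ada]) (by simp [Adb, gb])
      (by simp [Adc, gc]) (by simp [Add])) x
  have hεAd : ∀ x, counit (R := k) (Ad x) = counit (R := k) x := fun x =>
    DFunLike.congr_fun (algHom_ext_gen hg (f := (Bialgebra.counitAlgHom k A).comp Ad)
      (g := Bialgebra.counitAlgHom k A) (by simp [Ada]) (by simp [Adb, h.counit_b])
      (by simp [Adc, h.counit_c]) (by simp [Add])) x
  refine ⟨E ∘ₗ Ad.toLinearMap - (q ^ 2)⁻¹ • E, ga, gb, gc, gd, ?_, ?_, ?_, Or.inl ?_, ?_⟩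
  · intro x y
    simp only [LinearMap.sub_apply, LinearMap.comp_apply, LinearMap.smul_apply,
      AlgHom.toLinearMap_apply, map_mul, hE, hgAd, hεAd, smul_eq_mul]
    ring
  · simp [Ada, Ea]
  · simp only [LinearMap.sub_apply, LinearMap.comp_apply, LinearMap.smul_apply,
      AlgHom.toLinearMap_apply, Adb, map_smul, smul_eq_mul, ← sub_mul]
    refine mul_ne_zero (fun h0 => ?_) Eb
    have h1 : (q ^ 2 - 1) * (q ^ 2 + 1) = 0 := by
      field_simp at h0
      linear_combination h0
    rcases mul_eq_zero.1 h1 with h2 | h2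
    · exact hq (sub_eq_zero.1 h2)
    · exact hq2 (eq_neg_of_add_eq_zero_left h2)
  · simp [Adc]
  · simp [Add, Ed]

/-- A skew derivation exists for `(a, b, c, d)` or for `(d, c, b, a)`. -/
theorem QMat.exists_skewData [IsAlgClosed k] [FiniteDimensional k A] [CharZero k] {q : k}
    {a b c d : A} (h : QMat q a b c d)
    (hg : Algebra.adjoin k {a, b, c, d} = ⊤) (hq : q ^ 2 ≠ 1) (hb0 : b ≠ 0) :
    ∃ (q : k) (a b c d : A) (g : A →ₐ[k] k) (E : A →ₗ[k] k), q ^ 2 ≠ 1 ∧ QMat q a b c d ∧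
      Algebra.adjoin k {a, b, c, d} = ⊤ ∧ SkewData q a b c d g E := by
  obtain ⟨g, E, ga, gb, gc, gd, hE, Ea, Ed, hbc⟩ := h.exists_skew hg hq hb0
  by_cases Eb : E b = 0
  · have Ec := hbc.resolve_left (not_not.2 Eb)
    have hq' : q⁻¹ ^ 2 ≠ 1 := by rwa [inv_pow, ne_eq, inv_eq_one]
    obtain ⟨E', hE'⟩ := h.swap.exists_skewData_of_ne (gen_swap hg) hq' gd gc gb
      (by rw [ga, inv_inv]) hE Ed Ea Ec
    exact ⟨q⁻¹, d, c, b, a, g, E', hq', h.swap, gen_swap hg, hE'⟩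
  · obtain ⟨E', hE'⟩ := h.exists_skewData_of_ne hg hq ga gb gc gd hE Ea Ed Eb
    exact ⟨q, a, b, c, d, g, E', hq, h, hg, hE'⟩

end SkewData

section DualSubalgebra

variable {k A : Type} [Field k] [Ring A] [HopfAlgebra k A] {q : k} {a b c d : A}
  {g : A →ₐ[k] k} {E : A →ₗ[k] k}

theorem skew_eq_zero (hg : Algebra.adjoin k {a, b, c, d} = ⊤) (α β : A →ₐ[k] A) {F : A →ₗ[k] A}
    (hF : ∀ x y, F (x * y) = α x * F y + F x * β y) (ha : F a = 0) (hb : F b = 0) (hc : F c = 0)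
    (hd : F d = 0) (x : A) : F x = 0 := by
  have h1 : F 1 = 0 := by simpa using hF 1 1
  refine gen_induction hg (P := fun x => F x = 0) ha hb hc hd (fun r => ?_) (fun x y hx hy => ?_)
    (fun x y hx hy => ?_) x
  · rw [Algebra.algebraMap_eq_smul_one, map_smul, h1, smul_zero]
  · rw [map_add, hx, hy, add_zero]
  · rw [hF, hx, hy, mul_zero, zero_mul, add_zero]

theorem SkewData.rtrans_gen (s : SkewData q a b c d g E) (h : QMat q a b c d) :
    rtrans g a = q • a ∧ rtrans g b = q⁻¹ • b ∧ rtrans g c = q • c ∧ rtrans g d = q⁻¹ • d := by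
  have := h.rtrans_char s.g_b s.g_c
  rwa [s.g_a, s.g_d] at this

theorem SkewData.rhit_gen (s : SkewData q a b c d g E) (h : QMat q a b c d) :
    rhit E a = E c • b ∧ rhit E b = E b • a ∧ rhit E c = E c • d ∧ rhit E d = E b • c := by
  simp [rhit_apply, h.comul_a, h.comul_b, h.comul_c, h.comul_d, s.E_a, s.E_d]

theorem SkewData.E_c_mul (s : SkewData q a b c d g E) : E c * (q ^ 4 - 1) = 0 := by
  rcases s.E_c with h | h
  · rw [h, zero_mul]
  · rw [show q ^ 4 - 1 = (q ^ 2 - 1) * (q ^ 2 + 1) by ring, h]; ring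

theorem SkewData.rtrans_rhit (s : SkewData q a b c d g E) (h : QMat q a b c d)
    (hg : Algebra.adjoin k {a, b, c, d} = ⊤) (x : A) :
    rtrans g (rhit E x) = q ^ 2 • rhit E (rtrans g x) := by
  obtain ⟨ra, rb, rc, rd⟩ := s.rtrans_gen h
  obtain ⟨ea, eb, ec, ed⟩ := s.rhit_gen h
  have hq := h.q_ne
  have hE := rhit_mul_skew s.leibniz
  have hc := s.E_c_mul
  have key := skew_eq_zero hg ((rtrans g).comp (rtrans g)) (rtrans g)
    (F := (rtrans g).toLinearMap ∘ₗ rhit E - q ^ 2 • (rhit E ∘ₗ (rtrans g).toLinearMap)) (by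
      intro x y
      simp only [LinearMap.sub_apply, LinearMap.smul_apply, LinearMap.comp_apply,
        AlgHom.toLinearMap_apply, AlgHom.comp_apply, hE, map_mul, map_add, smul_add, mul_sub, sub_mul,
        mul_smul_comm, smul_mul_assoc]
      abel)
    (by
      simp only [LinearMap.sub_apply, LinearMap.smul_apply, LinearMap.comp_apply,
        AlgHom.toLinearMap_apply, ra, ea, map_smul, rb, smul_smul, ← sub_smul]
      rw [show E c * q⁻¹ - q ^ 2 * (q * E c) = - (q⁻¹ * (E c * (q ^ 4 - 1))) by field_simp; ring, hc]
      simp)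
    (by
      simp only [LinearMap.sub_apply, LinearMap.smul_apply, LinearMap.comp_apply,
        AlgHom.toLinearMap_apply, ra, eb, map_smul, rb, smul_smul, ← sub_smul]
      rw [show E b * q - q ^ 2 * (q⁻¹ * E b) = 0 by field_simp; ring]
      simp)
    (by
      simp only [LinearMap.sub_apply, LinearMap.smul_apply, LinearMap.comp_apply,
        AlgHom.toLinearMap_apply, rc, ec, map_smul, rd, smul_smul, ← sub_smul]
      rw [show E c * q⁻¹ - q ^ 2 * (q * E c) = - (q⁻¹ * (E c * (q ^ 4 - 1))) by field_simp; ring, hc]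
      simp)
    (by
      simp only [LinearMap.sub_apply, LinearMap.smul_apply, LinearMap.comp_apply,
        AlgHom.toLinearMap_apply, rc, ed, map_smul, rd, smul_smul, ← sub_smul]
      rw [show E b * q - q ^ 2 * (q⁻¹ * E b) = 0 by field_simp; ring]
      simp)
    x
  simpa [sub_eq_zero] using key

variable [FiniteDimensional k A]

theorem act_symm (f : A →ₗ[k] k) (x : A) : act (toDual.symm f) x = rhit f x := by
  rw [act_apply, LinearEquiv.apply_symm_apply]

theorem act_symm_char (g : A →ₐ[k] k) (x : A) : act (toDual.symm g.toLinearMap) x = rtrans g x :=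
  act_symm _ _

theorem SkewData.G_mul_E (s : SkewData q a b c d g E) (h : QMat q a b c d)
    (hg : Algebra.adjoin k {a, b, c, d} = ⊤) :
    toDual.symm g.toLinearMap * toDual.symm E =
      q ^ 2 • (toDual.symm E * toDual.symm g.toLinearMap : DualH k A) := by
  apply act_injective
  ext x
  rw [map_mul, map_smul, map_mul, Module.End.mul_apply, LinearMap.smul_apply, Module.End.mul_apply,
    act_symm_char, act_symm_char, act_symm, act_symm, s.rtrans_rhit h hg]

theorem comul_char (g : A →ₐ[k] k) : comul (R := k) (toDual.symm g.toLinearMap : DualH k A) =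
    toDual.symm g.toLinearMap ⊗ₜ toDual.symm g.toLinearMap := by
  apply ev2_ext
  intro x y
  rw [ev2_comul, ev2_tmul]
  simp

theorem SkewData.comul_E (s : SkewData q a b c d g E) :
    comul (R := k) (toDual.symm E : DualH k A) =
    toDual.symm g.toLinearMap ⊗ₜ toDual.symm E + toDual.symm E ⊗ₜ 1 := by
  apply ev2_ext
  intro x y
  rw [ev2_comul, map_add, LinearMap.add_apply, ev2_tmul, ev2_tmul]
  simp [s.leibniz, dualH_one]

theorem antipode_char_mul (g : A →ₐ[k] k) :
    antipode k (toDual.symm g.toLinearMap : DualH k A) * toDual.symm g.toLinearMap = 1 := by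
  have := mul_antipode_rTensor_comul_apply (R := k) (toDual.symm g.toLinearMap : DualH k A)
  rw [comul_char, dualH_counit] at this
  simpa using this

theorem SkewData.antipode_E (s : SkewData q a b c d g E) :
    antipode k (toDual.symm E : DualH k A) =
      -(antipode k (toDual.symm g.toLinearMap : DualH k A) * toDual.symm E) := by
  have := mul_antipode_rTensor_comul_apply (R := k) (toDual.symm E : DualH k A)
  have h1 : E 1 = 0 := by simpa using s.leibniz 1 1
  rw [s.comul_E, dualH_counit] at this
  simp only [map_add, LinearMap.rTensor_tmul, LinearMap.mul'_apply, mul_one,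
    LinearEquiv.apply_symm_apply, h1, map_zero] at this
  exact (neg_eq_of_add_eq_zero_right this).symm

theorem act_char_pow (g : A →ₐ[k] k) (n : ℕ) (x : A) :
    act (toDual.symm g.toLinearMap ^ n) x = ((rtrans g) ^ n) x := by
  induction n generalizing x with
  | zero => simp
  | succ n ih => rw [pow_succ, pow_succ, map_mul, Module.End.mul_apply, ih, act_symm_char]; rfl

omit [FiniteDimensional k A] in
theorem SkewData.rtrans_pow_gen (s : SkewData q a b c d g E) (h : QMat q a b c d) (n : ℕ) :
    (rtrans g ^ n) a = q ^ n • a ∧ (rtrans g ^ n) b = q⁻¹ ^ n • b ∧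
    (rtrans g ^ n) c = q ^ n • c ∧ (rtrans g ^ n) d = q⁻¹ ^ n • d := by
  obtain ⟨ra, rb, rc, rd⟩ := s.rtrans_gen h
  induction n with
  | zero => simp
  | succ n ih =>
    obtain ⟨ia, ib, ic, id'⟩ := ih
    simp only [pow_succ, AlgHom.mul_apply, ra, rb, rc, rd, map_smul, ia, ib, ic, id', smul_smul]
    simp only [mul_comm q, mul_comm q⁻¹, and_self]

theorem SkewData.G_pow_eq_one (s : SkewData q a b c d g E) (h : QMat q a b c d)
    (hg : Algebra.adjoin k {a, b, c, d} = ⊤) {n : ℕ} (hn : q ^ n = 1) :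
    (toDual.symm g.toLinearMap : DualH k A) ^ n = 1 := by
  apply act_injective
  obtain ⟨ra, rb, rc, rd⟩ := s.rtrans_pow_gen h n
  have : rtrans g ^ n = 1 := by
    apply algHom_ext_gen hg <;> simp [ra, rb, rc, rd, hn]
  ext x
  rw [act_char_pow, this, map_one]
  rfl

theorem SkewData.orderOf_pos (s : SkewData q a b c d g E) (h : QMat q a b c d) :
    0 < orderOf q := by
  have hG : ∀ i : ℕ, comul (R := k) ((toDual.symm g.toLinearMap : DualH k A) ^ i) * (1 ⊗ₜ 1) =
      (toDual.symm g.toLinearMap ^ i) ⊗ₜ (toDual.symm g.toLinearMap ^ i * 1) := by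
    intro i
    rw [Bialgebra.comul_pow, comul_char, Algebra.TensorProduct.tmul_pow, mul_one,
      ← Algebra.TensorProduct.one_def, mul_one]
  obtain ⟨i, m, him, hpow⟩ := exists_pow_mul_eq_pow_mul (by rw [dualH_counit]; simp) hG
  have key : ∀ j : ℕ, toDual ((toDual.symm g.toLinearMap : DualH k A) ^ j * 1) a = q ^ j := by
    intro j
    rw [mul_one, toDual_eq_counit_act, act_char_pow, (s.rtrans_pow_gen h j).1]
    simp [h.counit_a]
  have h1 := key i
  rw [hpow, key] at h1
  rw [orderOf_pos_iff, isOfFinOrder_iff_pow_eq_one]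
  refine ⟨m - i, by omega, ?_⟩
  have h2 : q ^ i * q ^ (m - i) = q ^ i * 1 := by
    rw [← pow_add, Nat.add_sub_cancel' him.le, mul_one, h1]
  exact mul_left_cancel₀ (pow_ne_zero _ h.q_ne) h2

theorem SkewData.isSubHopf_G (s : SkewData q a b c d g E) (h : QMat q a b c d)
    (hg : Algebra.adjoin k {a, b, c, d} = ⊤) :
    IsSubHopf (Algebra.adjoin k {(toDual.symm g.toLinearMap : DualH k A)}) := by
  have hG := Algebra.self_mem_adjoin_singleton k (toDual.symm g.toLinearMap : DualH k A)
  refine isSubHopf_adjoin ?_ ?_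
  · rintro _ rfl
    rw [comul_char]
    exact tmul_mem_range_incl2 hG hG
  · rintro _ rfl
    have h1 := s.G_pow_eq_one h hg (pow_orderOf_eq_one q)
    have h2 : antipode k (toDual.symm g.toLinearMap : DualH k A) =
        toDual.symm g.toLinearMap ^ (orderOf q - 1) := by
      obtain ⟨m, hm⟩ := Nat.exists_eq_succ_of_ne_zero (s.orderOf_pos h).ne'
      rw [hm, pow_succ'] at h1
      rw [hm, Nat.succ_sub_one]
      exact left_inv_eq_right_inv (antipode_char_mul g) h1
    rw [h2]
    exact pow_mem hG _

theorem SkewData.isSubHopf_GE (s : SkewData q a b c d g E) (h : QMat q a b c d)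
    (hg : Algebra.adjoin k {a, b, c, d} = ⊤) :
    IsSubHopf (Algebra.adjoin k {(toDual.symm g.toLinearMap : DualH k A), toDual.symm E}) := by
  have hG : (toDual.symm g.toLinearMap : DualH k A) ∈
      Algebra.adjoin k {(toDual.symm g.toLinearMap : DualH k A), toDual.symm E} :=
    Algebra.subset_adjoin (by simp)
  have hE : (toDual.symm E : DualH k A) ∈
      Algebra.adjoin k {(toDual.symm g.toLinearMap : DualH k A), toDual.symm E} :=
    Algebra.subset_adjoin (by simp)
  have hSG : antipode k (toDual.symm g.toLinearMap : DualH k A) ∈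
      Algebra.adjoin k {(toDual.symm g.toLinearMap : DualH k A), toDual.symm E} := by
    have h1 := s.G_pow_eq_one h hg (pow_orderOf_eq_one q)
    obtain ⟨m, hm⟩ := Nat.exists_eq_succ_of_ne_zero (s.orderOf_pos h).ne'
    rw [hm, pow_succ'] at h1
    rw [left_inv_eq_right_inv (antipode_char_mul g) h1]
    exact pow_mem hG _
  refine isSubHopf_adjoin ?_ ?_
  · rintro _ (rfl | rfl)
    · rw [comul_char]
      exact tmul_mem_range_incl2 hG hG
    · rw [s.comul_E]
      exact add_mem (tmul_mem_range_incl2 hG hE) (tmul_mem_range_incl2 hE (one_mem _))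
  · rintro _ (rfl | rfl)
    · exact hSG
    · rw [s.antipode_E]
      exact neg_mem (mul_mem hSG hE)

end DualSubalgebra

section SkewPair

variable {k D : Type} [Field k] [Ring D] [Algebra k D]

theorem finrank_adjoin_skew_le {G E : D} {t κ : k} {n l : ℕ} (hn : 0 < n) (hl : 0 < l)
    (hGn : G ^ n = 1) (hGE : G * E = t • (E * G)) (hE : E ^ l = κ • (G ^ 2 - 1))
    [FiniteDimensional k D] :
    Module.finrank k (Algebra.adjoin k {G, E}) ≤ l * n := by
  set M := Submodule.span k (Set.range fun x : Fin l × Fin n => E ^ (x.1 : ℕ) * G ^ (x.2 : ℕ))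
  have hmem : ∀ j < l, ∀ i : ℕ, E ^ j * G ^ i ∈ M := by
    intro j hj i
    rw [pow_eq_pow_mod i hGn]
    exact Submodule.subset_span ⟨(⟨j, hj⟩, ⟨i % n, Nat.mod_lt _ hn⟩), rfl⟩
  have hmem' : ∀ i : ℕ, E ^ l * G ^ i ∈ M := by
    intro i
    have h0 := fun i => hmem 0 hl i
    simp only [pow_zero, one_mul] at h0
    rw [hE, smul_mul_assoc, sub_mul, ← pow_add, one_mul]
    exact M.smul_mem _ (M.sub_mem (h0 _) (h0 _))
  have hEM : ∀ x ∈ M, E * x ∈ M := by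
    intro x hx
    induction hx using Submodule.span_induction with
    | mem x hx =>
      obtain ⟨⟨j, i⟩, rfl⟩ := hx
      simp only
      rw [← mul_assoc, ← pow_succ']
      rcases Nat.lt_or_ge (j + 1) l with h | h
      · exact hmem _ h _
      · rw [show (j : ℕ) + 1 = l by omega]
        exact hmem' _
    | zero => simp
    | add x y _ _ hx hy => rw [mul_add]; exact M.add_mem hx hy
    | smul r x _ hx => rw [mul_smul_comm]; exact M.smul_mem _ hx
  have hcomm : ∀ j : ℕ, G * E ^ j = t ^ j • (E ^ j * G) := by
    intro j
    induction j with
    | zero => simp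
    | succ j ih =>
      rw [pow_succ, ← mul_assoc, ih, smul_mul_assoc, mul_assoc, hGE, mul_smul_comm, smul_smul,
        mul_assoc, pow_succ]
  have hGM : ∀ x ∈ M, G * x ∈ M := by
    intro x hx
    induction hx using Submodule.span_induction with
    | mem x hx =>
      obtain ⟨⟨j, i⟩, rfl⟩ := hx
      simp only
      rw [← mul_assoc, hcomm, smul_mul_assoc, mul_assoc, ← pow_succ']
      exact M.smul_mem _ (hmem _ j.2 _)
    | zero => simp
    | add x y _ _ hx hy => rw [mul_add]; exact M.add_mem hx hy
    | smul r x _ hx => rw [mul_smul_comm]; exact M.smul_mem _ hx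
  have hT : ∀ y ∈ Algebra.adjoin k {G, E}, ∀ x ∈ M, y * x ∈ M := by
    intro y hy
    induction hy using Algebra.adjoin_induction with
    | mem y hy =>
      rcases hy with rfl | rfl
      · exact hGM
      · exact hEM
    | algebraMap r =>
      intro x hx
      rw [← Algebra.smul_def]
      exact M.smul_mem _ hx
    | add y z _ _ hy hz => intro x hx; rw [add_mul]; exact M.add_mem (hy x hx) (hz x hx)
    | mul y z _ _ hy hz => intro x hx; rw [mul_assoc]; exact hy _ (hz x hx)
  have h1 : (1 : D) ∈ M := by simpa using hmem 0 hl 0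
  have hle : Subalgebra.toSubmodule (Algebra.adjoin k {G, E}) ≤ M := fun y hy => by
    simpa using hT y hy 1 h1
  calc Module.finrank k (Algebra.adjoin k {G, E})
      ≤ Module.finrank k M := Submodule.finrank_mono hle
    _ ≤ Fintype.card (Fin l × Fin n) := finrank_range_le_card _
    _ = l * n := by simp

theorem finrank_adjoin_cyclic_le {G : D} {n : ℕ} (hn : 0 < n) (hGn : G ^ n = 1)
    [FiniteDimensional k D] : Module.finrank k (Algebra.adjoin k {G}) ≤ n := by
  have h := finrank_adjoin_skew_le (k := k) (G := G) (E := 0) (t := 1) (κ := 0) (l := 1) hn one_pos hGn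
    (by simp) (by simp)
  have : Algebra.adjoin k {G} ≤ Algebra.adjoin k {G, (0 : D)} := Algebra.adjoin_mono (by simp)
  have h2 := Submodule.finrank_mono (R := k) (s := Subalgebra.toSubmodule (Algebra.adjoin k {G}))
    (t := Subalgebra.toSubmodule (Algebra.adjoin k {G, (0 : D)})) this
  rw [one_mul] at h
  exact h2.trans h

end SkewPair

section Independence

variable {k A : Type} [Field k] [Ring A] [HopfAlgebra k A] {q : k} {a b c d : A}
  {g : A →ₐ[k] k} {E : A →ₗ[k] k}

theorem SkewData.E_a_pow (s : SkewData q a b c d g E) (i : ℕ) :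
    E (a ^ i) = 0 := by
  induction i with
  | zero => simpa using s.leibniz 1 1
  | succ i ih => rw [pow_succ, s.leibniz, ih, s.E_a]; simp

theorem SkewData.rhit_b_pow (s : SkewData q a b c d g E) (h : QMat q a b c d)
    (m : ℕ) : rhit E (b ^ (m + 1)) =
      (E b * ∑ i ∈ Finset.range (m + 1), (q⁻¹ ^ 2) ^ i) • (a * b ^ m) := by
  obtain ⟨ra, rb, rc, rd⟩ := s.rtrans_gen h
  obtain ⟨ea, eb, ec, ed⟩ := s.rhit_gen h
  have hq := h.q_ne
  have hba : b * a = q⁻¹ • (a * b) := by rw [h.ab, smul_smul, inv_mul_cancel₀ hq, one_smul]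
  induction m with
  | zero => simp [eb]
  | succ m ih =>
    rw [pow_succ' b (m + 1), rhit_mul_skew s.leibniz, ih, rb, eb, mul_smul_comm, smul_mul_assoc,
      ← mul_assoc, hba, smul_mul_assoc, mul_assoc, ← pow_succ', smul_smul, smul_smul,
      smul_mul_assoc, ← add_smul]
    congr 1
    rw [Finset.sum_range_succ' _ (m + 1)]
    simp only [pow_succ _ (_ : ℕ), pow_zero, ← Finset.sum_mul]
    ring

theorem SkewData.rhit_a_pow (s : SkewData q a b c d g E) (h : QMat q a b c d) (hc : E c = 0)
    (i : ℕ) : rhit E (a ^ i) = 0 := by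
  obtain ⟨ea, eb, ec, ed⟩ := s.rhit_gen h
  induction i with
  | zero => simpa using rhit_mul_skew s.leibniz 1 1
  | succ i ih => rw [pow_succ, rhit_mul_skew s.leibniz, ih, ea, hc]; simp

theorem SkewData.rhit_monomial (s : SkewData q a b c d g E) (h : QMat q a b c d) (hc : E c = 0)
    (i m : ℕ) : rhit E (a ^ i * b ^ (m + 1)) =
      (q ^ i * (E b * ∑ i ∈ Finset.range (m + 1), (q⁻¹ ^ 2) ^ i)) • (a ^ (i + 1) * b ^ m) := by
  obtain ⟨ra, rb, rc, rd⟩ := s.rtrans_gen h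
  rw [rhit_mul_skew s.leibniz, s.rhit_a_pow h hc, zero_mul, add_zero, map_pow, ra, smul_pow,
    s.rhit_b_pow h, smul_mul_assoc, mul_smul_comm, smul_smul, pow_succ a, mul_assoc (a ^ i)]

variable [FiniteDimensional k A]

theorem SkewData.pairing (s : SkewData q a b c d g E) (h : QMat q a b c d) (hq2 : q ^ 2 ≠ 1)
    (i j m : ℕ) (hj : j < orderOf (q ^ 2)) (hm : m < orderOf (q ^ 2)) :
    (j ≠ m → toDual (toDual.symm E ^ j : DualH k A) (a ^ i * b ^ m) = 0) ∧
    (j = m → toDual (toDual.symm E ^ j : DualH k A) (a ^ i * b ^ m) ≠ 0) := by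
  have hq := h.q_ne
  have h0 : ∀ i m, toDual (toDual.symm E ^ 0 : DualH k A) (a ^ i * b ^ m) = 0 ^ m := by
    intro i m
    rw [pow_zero, dualH_one]
    simp [h.counit_a, h.counit_b]
  have hbase : ∀ m i, (0 ≠ m → toDual (toDual.symm E ^ 0 : DualH k A) (a ^ i * b ^ m) = 0) ∧
    (0 = m → toDual (toDual.symm E ^ 0 : DualH k A) (a ^ i * b ^ m) ≠ 0) := by
    intro m i
    rw [h0]
    exact ⟨fun h => zero_pow h.symm, fun h => by rw [← h, pow_zero]; exact one_ne_zero⟩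
  rcases s.E_c with hc | hq'
  · induction j generalizing i m with
    | zero => exact hbase m i
    | succ j ih =>
      have hstep : ∀ x, toDual (toDual.symm E ^ (j + 1) : DualH k A) x =
          toDual (toDual.symm E ^ j : DualH k A) (rhit E x) := by
        intro x
        rw [toDual_eq_counit_act, pow_succ, _root_.map_mul, Module.End.mul_apply, act_symm,
          ← toDual_eq_counit_act]
      rw [hstep]
      cases m with
      | zero => rw [pow_zero, mul_one, s.rhit_a_pow h hc]; simp
      | succ m =>
        rw [s.rhit_monomial h hc, map_smul]
        obtain ⟨i1, i2⟩ := ih (i + 1) m (by omega) (by omega)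
        refine ⟨fun hjm => by rw [i1 (by omega), smul_zero], fun hjm => smul_ne_zero ?_ (i2 (by omega))⟩
        refine mul_ne_zero (pow_ne_zero _ hq) (mul_ne_zero s.E_b fun hz => ?_)
        have hgeom := geom_sum_mul (q⁻¹ ^ 2) (m + 1)
        rw [hz, zero_mul] at hgeom
        have hone : (q ^ 2) ^ (m + 1) = 1 := by
          have := (sub_eq_zero.1 hgeom.symm)
          rwa [inv_pow, inv_pow, inv_eq_one] at this
        exact absurd (orderOf_le_of_pow_eq_one (Nat.succ_pos m) hone) (by omega)
  · have h2 : orderOf (q ^ 2) = 2 := by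
      rw [orderOf_eq_prime_iff]
      exact ⟨by rw [hq']; ring, hq2⟩
    rw [h2] at hj hm
    interval_cases j
    · exact hbase m i
    · interval_cases m
      · simp [s.E_a_pow]
      · simp [s.leibniz, h.counit_b, s.g_a, s.E_b, hq]

theorem SkewData.linearIndependent (s : SkewData q a b c d g E) (h : QMat q a b c d)
    (hq2 : q ^ 2 ≠ 1) : LinearIndependent k
      (fun x : Fin (orderOf (q ^ 2)) × Fin (orderOf q) =>
        (toDual.symm E ^ (x.1 : ℕ) * toDual.symm g.toLinearMap ^ (x.2 : ℕ) : DualH k A)) := by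
  have hq := h.q_ne
  have hval : ∀ (j i u m : ℕ), toDual (toDual.symm E ^ j * toDual.symm g.toLinearMap ^ i : DualH k A)
      (a ^ u * b ^ m) = (q ^ u * q⁻¹ ^ m) ^ i *
        toDual (toDual.symm E ^ j : DualH k A) (a ^ u * b ^ m) := by
    intro j i u m
    obtain ⟨ra, rb, rc, rd⟩ := s.rtrans_pow_gen h i
    rw [toDual_eq_counit_act, _root_.map_mul act, Module.End.mul_apply, act_char_pow, _root_.map_mul,
      map_pow (rtrans g ^ i), map_pow (rtrans g ^ i), ra, rb, smul_pow, smul_pow, smul_mul_smul_comm, map_smul, map_smul,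
      ← toDual_eq_counit_act, smul_eq_mul]
    congr 1
    rw [mul_pow]
    simp only [← pow_mul, mul_comm]
  rw [Fintype.linearIndependent_iff]
  rintro C hC ⟨m, i⟩
  have hrow : ∀ u : Fin (orderOf q),
      ∑ i, C (m, i) * (q ^ (u : ℕ) * q⁻¹ ^ (m : ℕ)) ^ (i : ℕ) = 0 := by
    intro u
    have h1 := congrArg (fun f => toDual f (a ^ (u : ℕ) * b ^ (m : ℕ))) hC
    simp only [map_sum, map_smul, map_zero, LinearMap.sum_apply, LinearMap.smul_apply,
      LinearMap.zero_apply, hval, Fintype.sum_prod_type] at h1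
    rw [Finset.sum_eq_single m] at h1
    · have hne := (s.pairing h hq2 u m m m.2 m.2).2 rfl
      simp only [smul_eq_mul, ← mul_assoc, ← Finset.sum_mul] at h1
      exact (mul_eq_zero.1 h1).resolve_right hne
    · intro j _ hjm
      refine Finset.sum_eq_zero fun i _ => ?_
      rw [(s.pairing h hq2 u j m j.2 m.2).1 (fun hh => hjm (Fin.ext hh)), mul_zero, smul_zero]
    · simp
  have hinj : Function.Injective (fun u : Fin (orderOf q) => q ^ (u : ℕ) * q⁻¹ ^ (m : ℕ)) := by
    intro u v huv
    have := mul_right_cancel₀ (pow_ne_zero _ (inv_ne_zero hq)) huv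
    exact Fin.ext (pow_injOn_Iio_orderOf u.2 v.2 this)
  exact congrFun (Matrix.eq_zero_of_forall_index_sum_mul_pow_eq_zero hinj hrow) i

end Independence

section Quantum

variable {k A : Type} [Field k] [Ring A] [HopfAlgebra k A] {q : k} {a b c d : A}
  {g : A →ₐ[k] k} {E : A →ₗ[k] k}

theorem SkewData.rhit_sq (s : SkewData q a b c d g E) (h : QMat q a b c d)
    (hg : Algebra.adjoin k {a, b, c, d} = ⊤) (x y : A) :
    rhit E (rhit E (x * y)) = rtrans g (rtrans g x) * rhit E (rhit E y) +
      (1 + q ^ 2) • (rhit E (rtrans g x) * rhit E y) + rhit E (rhit E x) * y := by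
  simp only [rhit_mul_skew s.leibniz, map_add, s.rtrans_rhit h hg, smul_mul_assoc, add_smul,
    one_smul]
  abel

theorem SkewData.rhit_sq_of_sq_eq_neg_one [CharZero k] (s : SkewData q a b c d g E)
    (h : QMat q a b c d) (hg : Algebra.adjoin k {a, b, c, d} = ⊤) (hq : q ^ 2 = -1) (x : A) :
    rhit E (rhit E x) = (-(E b * E c) / 2) • (rtrans g (rtrans g x) - x) := by
  obtain ⟨ra, rb, rc, rd⟩ := s.rtrans_gen h
  obtain ⟨ea, eb, ec, ed⟩ := s.rhit_gen h
  have hqi : q⁻¹ * q⁻¹ = -1 := by rw [← mul_inv, ← pow_two, hq]; norm_num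
  have hq' : q * q = -1 := by rw [← pow_two, hq]
  have hk : ∀ z : A, (E b * E c) • z = (-(E b * E c) / 2) • (-z - z) := by
    intro z
    rw [show -z - z = (-2 : k) • z by rw [neg_smul, two_smul]; abel, smul_smul]
    congr 1
    ring
  have key := skew_eq_zero hg ((rtrans g).comp (rtrans g)) (AlgHom.id k A)
    (F := rhit E ∘ₗ rhit E - (-(E b * E c) / 2) •
      ((rtrans g).toLinearMap ∘ₗ (rtrans g).toLinearMap - LinearMap.id)) (by
      intro x y
      simp only [LinearMap.sub_apply, LinearMap.smul_apply, LinearMap.comp_apply,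
        AlgHom.toLinearMap_apply, AlgHom.comp_apply, AlgHom.id_apply, LinearMap.id_apply,
        s.rhit_sq h hg, hq, _root_.map_mul, smul_sub, mul_sub, sub_mul, mul_smul_comm,
        smul_mul_assoc, add_neg_cancel, zero_smul]
      abel)
    (by simp [ea, eb, ra, smul_smul, hq', ← hk, mul_comm (E c)])
    (by simp [ea, eb, rb, smul_smul, hqi, ← hk])
    (by simp [ec, ed, rc, smul_smul, hq', ← hk, mul_comm (E c)])
    (by simp [ec, ed, rd, smul_smul, hqi, ← hk])
    x
  simpa [sub_eq_zero] using key

theorem SkewData.rhit_cube (s : SkewData q a b c d g E)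
    (h : QMat q a b c d) (hg : Algebra.adjoin k {a, b, c, d} = ⊤) (hc : E c = 0)
    (hq : 1 + q ^ 2 + q ^ 4 = 0) (x : A) : rhit E (rhit E (rhit E x)) = 0 := by
  obtain ⟨ra, rb, rc, rd⟩ := s.rtrans_gen h
  obtain ⟨ea, eb, ec, ed⟩ := s.rhit_gen h
  have key := skew_eq_zero hg ((rtrans g).comp ((rtrans g).comp (rtrans g))) (AlgHom.id k A)
    (F := rhit E ∘ₗ rhit E ∘ₗ rhit E) (by
      intro x y
      simp only [LinearMap.comp_apply, AlgHom.comp_apply, AlgHom.id_apply,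
        rhit_mul_skew s.leibniz, map_add, map_smul, s.rtrans_rhit h hg, smul_add,
        smul_mul_assoc, smul_smul]
      have e1 : ∀ u : A, u + q ^ 2 • u + (q ^ 2 * q ^ 2) • u = 0 := fun u => by
        nth_rewrite 1 [← one_smul k u]
        rw [← add_smul, ← add_smul, show 1 + q ^ 2 + q ^ 2 * q ^ 2 = 0 by linear_combination hq,
          zero_smul]
      have h1 := e1 (rhit E (rtrans g (rtrans g x)) * rhit E (rhit E y))
      have h2 := e1 (rhit E (rhit E (rtrans g x)) * rhit E y)
      rw [← sub_eq_zero]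
      rw [← add_zero (0 : A)]
      nth_rewrite 1 [← h1]
      rw [← h2]
      abel)
    (by simp [ea, hc])
    (by simp [ea, eb, hc])
    (by simp [ec, hc])
    (by simp [ec, ed, hc])
    x
  exact key

variable [FiniteDimensional k A]

theorem toDual_symm_pow_eq (E : A →ₗ[k] k) (n : ℕ) (x : A) :
    act (toDual.symm E ^ n : DualH k A) x = (rhit E ^ n) x := by
  rw [map_pow]
  rfl

theorem SkewData.E_sq [CharZero k] (s : SkewData q a b c d g E)
    (h : QMat q a b c d) (hg : Algebra.adjoin k {a, b, c, d} = ⊤) (hq : q ^ 2 = -1) :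
    (toDual.symm E : DualH k A) ^ 2 =
      (-(E b * E c) / 2) • ((toDual.symm g.toLinearMap : DualH k A) ^ 2 - 1) := by
  apply act_injective
  ext x
  rw [toDual_symm_pow_eq, pow_two, Module.End.mul_apply, s.rhit_sq_of_sq_eq_neg_one h hg hq,
    map_smul, map_sub, map_one, LinearMap.smul_apply, LinearMap.sub_apply, act_char_pow]
  rfl

theorem SkewData.E_cube (s : SkewData q a b c d g E)
    (h : QMat q a b c d) (hg : Algebra.adjoin k {a, b, c, d} = ⊤) (hc : E c = 0)
    (hq : 1 + q ^ 2 + q ^ 4 = 0) : (toDual.symm E : DualH k A) ^ 3 = 0 := by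
  apply act_injective
  ext x
  rw [toDual_symm_pow_eq, map_zero]
  exact s.rhit_cube h hg hc hq x

theorem SkewData.le_finrank_adjoin (s : SkewData q a b c d g E) (h : QMat q a b c d)
    (hq2 : q ^ 2 ≠ 1) : orderOf (q ^ 2) * orderOf q ≤ Module.finrank k
      (Algebra.adjoin k {(toDual.symm E : DualH k A), toDual.symm g.toLinearMap}) := by
  set T := Algebra.adjoin k {(toDual.symm E : DualH k A), toDual.symm g.toLinearMap}
  have hE : (toDual.symm E : DualH k A) ∈ T := Algebra.subset_adjoin (by simp)
  have hG : (toDual.symm g.toLinearMap : DualH k A) ∈ T := Algebra.subset_adjoin (by simp)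
  have hli : LinearIndependent k (fun x : Fin (orderOf (q ^ 2)) × Fin (orderOf q) =>
      (⟨toDual.symm E, hE⟩ ^ (x.1 : ℕ) * ⟨toDual.symm g.toLinearMap, hG⟩ ^ (x.2 : ℕ) : T)) :=
    LinearIndependent.of_comp T.val.toLinearMap (s.linearIndependent h hq2)
  simpa using hli.fintype_card_le_finrank

theorem SkewData.orderOf_sq_pos (s : SkewData q a b c d g E) (h : QMat q a b c d) :
    0 < orderOf (q ^ 2) :=
  orderOf_pos_iff.2 ((orderOf_pos_iff.1 (s.orderOf_pos h)).pow)

theorem SkewData.finrank_adjoin_G (s : SkewData q a b c d g E) (h : QMat q a b c d)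
    (hg : Algebra.adjoin k {a, b, c, d} = ⊤) (hq2 : q ^ 2 ≠ 1) :
    Module.finrank k (Algebra.adjoin k {(toDual.symm g.toLinearMap : DualH k A)}) =
      orderOf q := by
  refine le_antisymm (finrank_adjoin_cyclic_le (s.orderOf_pos h)
    (s.G_pow_eq_one h hg (pow_orderOf_eq_one q))) ?_
  set T := Algebra.adjoin k {(toDual.symm g.toLinearMap : DualH k A)}
  have hG : (toDual.symm g.toLinearMap : DualH k A) ∈ T := Algebra.subset_adjoin (by simp)
  have hinj : Function.Injective (fun i : Fin (orderOf q) =>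
      ((⟨0, s.orderOf_sq_pos h⟩, i) : Fin (orderOf (q ^ 2)) × Fin (orderOf q))) :=
    fun i j hij => (Prod.ext_iff.1 hij).2
  have hli : LinearIndependent k (fun x : Fin (orderOf q) =>
      (⟨toDual.symm g.toLinearMap, hG⟩ ^ (x : ℕ) : T)) := by
    refine LinearIndependent.of_comp T.val.toLinearMap ?_
    convert (s.linearIndependent h hq2).comp _ hinj using 1
    ext i : 1
    simp
  simpa using hli.fintype_card_le_finrank

/-- The quantum parameter of a generating quantum matrix in dimension dividing `4p`. -/
theorem QMat.sq_eq_one [IsAlgClosed k] [CharZero k] {p : ℕ} (hp : p.Prime) (hodd : Odd p)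
    (hdim : Module.finrank k A ∣ 4 * p) (h : QMat q a b c d)
    (hg : Algebra.adjoin k {a, b, c, d} = ⊤) (hb0 : b ≠ 0) : q ^ 2 = 1 := by
  by_contra hq
  obtain ⟨q, a, b, c, d, g, E, hq, h, hg, s⟩ := h.exists_skewData hg hq hb0
  have hn := s.orderOf_pos h
  have hl := s.orderOf_sq_pos h
  have hGn := s.G_pow_eq_one h hg (pow_orderOf_eq_one q)
  have hGE := s.G_mul_E h hg
  have hp3 : 3 ≤ p := by
    have := hp.two_le
    obtain ⟨m, rfl⟩ := hodd
    omega
  have hKdvd : orderOf q ∣ 4 * p := by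
    have := s.isSubHopf_G h hg
    have := subHopf_finrank_dvd (A := Algebra.adjoin k {(toDual.symm g.toLinearMap : DualH k A)})
    rw [s.finrank_adjoin_G h hg hq, finrank_dualH] at this
    exact this.trans hdim
  have hTdvd : Module.finrank k (Algebra.adjoin k
      {(toDual.symm g.toLinearMap : DualH k A), toDual.symm E}) ∣ 4 * p := by
    have := s.isSubHopf_GE h hg
    have := subHopf_finrank_dvd (A := Algebra.adjoin k
      {(toDual.symm g.toLinearMap : DualH k A), toDual.symm E})
    rw [finrank_dualH] at this
    exact this.trans hdim
  have hTle := s.le_finrank_adjoin h hq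
  rw [Set.pair_comm] at hTle
  have hord : orderOf (q ^ 2) = orderOf q / (orderOf q).gcd 2 := orderOf_pow' q two_ne_zero
  by_cases hq4 : q ^ 2 = -1
  · have h2 : orderOf (q ^ 2) = 2 := by
      rw [orderOf_eq_prime_iff]
      exact ⟨by rw [hq4]; ring, hq⟩
    have h4 : orderOf q = 4 := by
      have : orderOf q = 2 ^ (1 + 1) := orderOf_eq_prime_pow (by simpa using hq)
        (by norm_num; rw [show q ^ 4 = (q ^ 2) ^ 2 by ring, hq4]; ring)
      simpa using this
    have := finrank_adjoin_skew_le (l := 2) hn two_pos hGn hGE (s.E_sq h hg hq4)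
    rw [h2, h4] at hTle
    rw [h4] at this
    rw [show Module.finrank k _ = 8 from le_antisymm this hTle] at hTdvd
    obtain ⟨m, hm⟩ := hTdvd
    obtain ⟨r, rfl⟩ := hodd
    omega
  · have hc : E c = 0 := s.E_c.resolve_right hq4
    have hn4 : ¬ orderOf q ∣ 4 := by
      intro hd
      have h4 : q ^ 4 = 1 := orderOf_dvd_iff_pow_eq_one.1 hd
      have : (q ^ 2 - 1) * (q ^ 2 + 1) = 0 := by linear_combination h4
      rcases mul_eq_zero.1 this with h0 | h0
      · exact hq (sub_eq_zero.1 h0)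
      · exact hq4 (eq_neg_of_add_eq_zero_left h0)
    have hpn : p ∣ orderOf q := by
      by_contra hpn
      exact hn4 (Nat.Coprime.dvd_of_dvd_mul_right
        ((Nat.Prime.coprime_iff_not_dvd hp).2 hpn).symm hKdvd)
    have hle := hTle.trans (Nat.le_of_dvd (by omega) hTdvd)
    obtain ⟨m, hm⟩ := hpn
    have hm4 : m ∣ 4 := by
      rw [hm, mul_comm 4 p] at hKdvd
      exact Nat.dvd_of_mul_dvd_mul_left hp.pos hKdvd
    have hmle : m ≤ 4 := Nat.le_of_dvd (by norm_num) hm4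
    have hm0 : m ≠ 0 := by rintro rfl; omega
    have hp2 : Nat.gcd p 2 = 1 := (Nat.coprime_two_right).2 hodd
    have hm3 : m ≠ 3 := by rintro rfl; omega
    have hhalf : ∀ r, orderOf q = 2 * r → orderOf (q ^ 2) = r := by
      intro r hr
      rw [hord, hr, Nat.gcd_mul_right_left]
      omega
    have hm1 : m = 1 := by
      by_contra hm1
      have : m = 2 ∨ m = 4 := by omega
      rcases this with rfl | rfl
      · rw [hhalf p (by omega), hm] at hle
        nlinarith
      · rw [hhalf (2 * p) (by omega), hm] at hle
        nlinarith
    rw [hm1, mul_one] at hm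
    rw [hm, hp2, Nat.div_one] at hord
    rw [hord, hm] at hle
    have hp3 : p = 3 := by
      have : p ≤ 4 := by nlinarith
      have : p ≠ 4 := by rintro rfl; exact absurd hp (by norm_num)
      omega
    subst hp3
    have h6 : (q ^ 2) ^ 3 = 1 := by rw [← hord]; exact pow_orderOf_eq_one _
    have h0 : 1 + q ^ 2 + q ^ 4 = 0 := by
      have : (q ^ 2 - 1) * (1 + q ^ 2 + q ^ 4) = 0 := by linear_combination h6
      exact (mul_eq_zero.1 this).resolve_left (sub_ne_zero.2 hq)
    have := finrank_adjoin_skew_le (l := 3) (κ := 0) hn (by norm_num) hGn hGE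
      (by rw [s.E_cube h hg hc h0, zero_smul])
    rw [hord, hm] at hTle
    rw [hm] at this
    rw [show Module.finrank k _ = 9 from le_antisymm this hTle] at hTdvd
    omega

end Quantum

section Characters

theorem exists_char_ne_zero {k R : Type} [Field k] [IsAlgClosed k] [CommRing R] [Algebra k R]
    [FiniteDimensional k R] [IsSemisimpleRing R] {x : R} (hx : x ≠ 0) :
    ∃ χ : R →ₐ[k] k, χ x ≠ 0 := by
  have hJ : Ring.jacobson R = ⊥ := IsSemisimpleModule.jacobson_eq_bot R R
  have hx' : x ∉ Ring.jacobson R := by rw [hJ]; simpa using hx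
  rw [Ring.jacobson_eq_sInf_isMaximal] at hx'
  simp only [Submodule.mem_sInf, Set.mem_ofPred_eq, not_forall] at hx'
  obtain ⟨I, hI, hxI⟩ := hx'
  let := Ideal.Quotient.field I
  have hbij : Function.Bijective (algebraMap k (R ⧸ I)) :=
    IsAlgClosed.algebraMap_bijective_of_isIntegral
  let e := AlgEquiv.ofBijective (Algebra.ofId k (R ⧸ I)) hbij
  refine ⟨e.symm.toAlgHom.comp (Ideal.Quotient.mkₐ k I), fun h => hxI ?_⟩
  have h1 : e.symm (Ideal.Quotient.mk I x) = 0 := h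
  rw [map_eq_zero_iff _ e.symm.injective] at h1
  exact Ideal.Quotient.eq_zero_iff_mem.1 h1

theorem exists_char_ne_zero' {k R : Type} [Field k] [IsAlgClosed k] [Ring R] [Algebra k R]
    [FiniteDimensional k R] (hss : IsSemisimpleRing R) (hcomm : ∀ x y : R, x * y = y * x)
    {x : R} (hx : x ≠ 0) : ∃ χ : R →ₐ[k] k, χ x ≠ 0 := by
  let : CommRing R := { ‹Ring R› with mul_comm := hcomm }
  exact exists_char_ne_zero hx

variable {k K : Type} [Field k] [Ring K] [HopfAlgebra k K] [FiniteDimensional k K]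

/-- The functional underlying a group-like element of the dual. -/
noncomputable def charOf (γ : GroupLike k (DualH k K)) : K →ₐ[k] k :=
  AlgHom.ofLinearMap (toDual γ.val) (by
    rw [← dualH_counit]; exact γ.2.counit_eq_one) (fun x y => by
    rw [← ev2_comul, γ.2.comul_eq_tmul_self, ev2_tmul])

theorem charOf_apply (γ : GroupLike k (DualH k K)) (x : K) : charOf γ x = toDual γ.val x := rfl

/-- The group-like element of the dual defined by a character. -/
noncomputable def ofChar (χ : K →ₐ[k] k) : GroupLike k (DualH k K) where
  val := toDual.symm χ.toLinearMap
  isGroupLikeElem_val := ⟨by rw [dualH_counit]; simp, comul_char χ⟩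

theorem charOf_ofChar (χ : K →ₐ[k] k) : charOf (ofChar χ) = χ := by
  ext x; simp [charOf_apply, ofChar]

theorem charOf_injective : Function.Injective (charOf (k := k) (K := K)) := fun γ δ h =>
  GroupLike.val_injective (dualH_ext fun x => by
    rw [← charOf_apply, h, charOf_apply])

theorem charOf_mul (γ δ : GroupLike k (DualH k K)) (x : K) :
    charOf (γ * δ) x = ev2 (γ.val ⊗ₜ δ.val) (comul x) := by
  rw [charOf_apply, GroupLike.val_mul, dualH_mul_apply]

theorem charOf_one (x : K) : charOf (1 : GroupLike k (DualH k K)) x = counit x := by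
  rw [charOf_apply, GroupLike.val_one, dualH_one]

instance : Finite (GroupLike k (DualH k K)) :=
  (linearIndep_groupLikeVal (R := k) (A := DualH k K)).finite

variable [IsAlgClosed k]

theorem eq_zero_of_charOf (hss : IsSemisimpleRing K) (hcomm : ∀ x y : K, x * y = y * x) {x : K}
    (h : ∀ γ : GroupLike k (DualH k K), charOf γ x = 0) : x = 0 := by
  by_contra hx
  obtain ⟨χ, hχ⟩ := exists_char_ne_zero' (k := k) hss hcomm hx
  exact hχ (by rw [← charOf_ofChar χ, h])

theorem charOf_bijective (hss : IsSemisimpleRing K) (hcomm : ∀ x y : K, x * y = y * x) :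
    Nat.card (GroupLike k (DualH k K)) = Module.finrank k K ∧
    Function.Bijective (LinearMap.pi (fun γ : GroupLike k (DualH k K) =>
      (charOf γ).toLinearMap)) := by
  have := Fintype.ofFinite (GroupLike k (DualH k K))
  have hinj : Function.Injective (LinearMap.pi (fun γ : GroupLike k (DualH k K) =>
      (charOf γ).toLinearMap)) := by
    rw [injective_iff_map_eq_zero]
    intro x hx
    exact eq_zero_of_charOf hss hcomm fun γ => congrFun hx γ
  have h1 := LinearMap.finrank_le_finrank_of_injective hinj
  have h2 := (linearIndep_groupLikeVal (R := k) (A := DualH k K)).fintype_card_le_finrank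
  rw [Module.finrank_pi] at h1
  rw [finrank_dualH] at h2
  have h3 := le_antisymm h1 h2
  refine ⟨by rw [Nat.card_eq_fintype_card, h3], hinj, ?_⟩
  exact (LinearMap.injective_iff_surjective_of_finrank_eq_finrank
    (by rw [Module.finrank_pi, h3])).1 hinj

open Classical in
theorem exists_idempotents (hss : IsSemisimpleRing K) (hcomm : ∀ x y : K, x * y = y * x) :
    ∃ e : GroupLike k (DualH k K) → K,
      ∀ γ δ, charOf δ (e γ) = if δ = γ then 1 else 0 := by
  choose e he using fun γ : GroupLike k (DualH k K) =>
    (charOf_bijective hss hcomm).2.2 (Pi.single γ 1)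
  refine ⟨e, fun γ δ => ?_⟩
  have := congrFun (he γ) δ
  simpa [Pi.single_apply] using this

end Characters

theorem exists_complement {k E : Type} [Field k] [AddCommGroup E] [Module k E]
    (W : Submodule k E) (φ : E →ₗ[k] k) (hW : Module.finrank k W = 2) {u : E} (hu : u ∈ W)
    (hu1 : φ u = 1) :
    ∃ x : E, x ≠ 0 ∧ x ∈ W ∧ φ x = 0 ∧ ∀ r ∈ W, ∃ μ : k, r = φ r • u + μ • x := by
  let ev : W →ₗ[k] k := φ ∘ₗ W.subtype
  have hev : ∀ r, ev r = φ r.1 := fun r => rfl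
  have hone : ev ⟨u, hu⟩ = 1 := hu1
  have : FiniteDimensional k W := FiniteDimensional.of_finrank_pos (by omega)
  have h4 : Module.finrank k (LinearMap.ker ev) = 1 := by
    have h5 := LinearMap.finrank_range_add_finrank_ker ev
    have h6 : LinearMap.range ev = ⊤ := by
      rw [LinearMap.range_eq_top]
      intro c
      exact ⟨c • _, by rw [map_smul, hone, smul_eq_mul, mul_one]⟩
    rw [h6, hW, finrank_top, Module.finrank_self] at h5
    omega
  obtain ⟨v, hv, hspan⟩ := finrank_eq_one_iff'.1 h4
  refine ⟨v.1.1, fun h => hv (Subtype.ext (Subtype.ext h)), v.1.2, v.2, fun r hr => ?_⟩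
  obtain ⟨μ, hμ⟩ := hspan ⟨⟨r, hr⟩ - φ r • ⟨u, hu⟩, by
    rw [LinearMap.mem_ker, map_sub, map_smul, hone, hev]; simp⟩
  have := congrArg (fun z => z.1.1) hμ
  simp only [Submodule.coe_smul, Submodule.coe_sub] at this
  exact ⟨μ, by rw [this]; abel⟩

section TwoSided

variable {k F : Type} [Field k] [Ring F] [HopfAlgebra k F] [FiniteDimensional k F]
variable (K : Subalgebra k F) [IsSubHopf K]

/-- `h` transforms on the left under `K` through the character `γ`. -/
def LChar (γ : GroupLike k (DualH k K)) (h : DualH k F) : Prop :=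
  ∀ (y : K) (f : F), toDual h (y * f) = charOf γ y * toDual h f

/-- `h` transforms on the right under `K` through the character `γ`. -/
def RChar (γ : GroupLike k (DualH k K)) (h : DualH k F) : Prop :=
  ∀ (y : K) (f : F), toDual h (f * y) = charOf γ y * toDual h f

variable {K} {γ δ : GroupLike k (DualH k K)} {h h' : DualH k F}

theorem toDual_mul_one (h h' : DualH k F) :
    toDual (h * h') 1 = toDual h 1 * toDual h' 1 := by
  rw [dualH_mul_apply, Bialgebra.comul_one, Algebra.TensorProduct.one_def, ev2_tmul]

theorem LChar.mul (hh : LChar K γ h) (hh' : LChar K δ h') : LChar K (γ * δ) (h * h') := by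
  intro y f
  have key : ∀ (z : K ⊗[k] K) (w : F ⊗[k] F), ev2 (h ⊗ₜ h') (incl2 K z * w) =
      ev2 (γ.val ⊗ₜ δ.val) z * ev2 (h ⊗ₜ h') w := by
    intro z w
    induction z with
    | zero => simp
    | add u v hu hv => simp only [map_add, hu, hv, add_mul]
    | tmul u v =>
      induction w with
      | zero => simp
      | add r s hr hs => simp only [map_add, hr, hs, mul_add]
      | tmul r s =>
        rw [incl2_tmul, Algebra.TensorProduct.tmul_mul_tmul, ev2_tmul, ev2_tmul, ev2_tmul, hh, hh',
          charOf_apply, charOf_apply]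
        ring
  rw [dualH_mul_apply, Bialgebra.comul_mul, ← incl2_comul, key, ← charOf_mul, ← dualH_mul_apply]

theorem RChar.mul (hh : RChar K γ h) (hh' : RChar K δ h') : RChar K (γ * δ) (h * h') := by
  intro y f
  have key : ∀ (z : K ⊗[k] K) (w : F ⊗[k] F), ev2 (h ⊗ₜ h') (w * incl2 K z) =
      ev2 (γ.val ⊗ₜ δ.val) z * ev2 (h ⊗ₜ h') w := by
    intro z w
    induction z with
    | zero => simp
    | add u v hu hv => simp only [map_add, hu, hv, mul_add, add_mul]
    | tmul u v =>
      induction w with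
      | zero => simp
      | add r s hr hs => simp only [map_add, hr, hs, mul_add, add_mul]
      | tmul r s =>
        rw [incl2_tmul, Algebra.TensorProduct.tmul_mul_tmul, ev2_tmul, ev2_tmul, ev2_tmul, hh, hh',
          charOf_apply, charOf_apply]
        ring
  rw [dualH_mul_apply, Bialgebra.comul_mul, ← incl2_comul, key, ← charOf_mul, ← dualH_mul_apply]

theorem LChar.one : LChar K 1 (1 : DualH k F) := by
  intro y f
  rw [dualH_one, Bialgebra.counit_mul, charOf_one, dualH_one, subHopf_counit]

theorem RChar.one : RChar K 1 (1 : DualH k F) := by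
  intro y f
  rw [dualH_one, Bialgebra.counit_mul, charOf_one, dualH_one, subHopf_counit, mul_comm]

theorem LChar.pow (hh : LChar K γ h) (n : ℕ) : LChar K (γ ^ n) (h ^ n) := by
  induction n with
  | zero => simpa using LChar.one
  | succ n ih => rw [pow_succ, pow_succ]; exact ih.mul hh

/-- The functional `f ↦ h (y f)`. -/
noncomputable def lshift (y : F) (h : DualH k F) : DualH k F :=
  toDual.symm (toDual h ∘ₗ LinearMap.mulLeft k y)

omit [FiniteDimensional k F] in
theorem lshift_apply (y : F) (h : DualH k F) (f : F) : toDual (lshift y h) f = toDual h (y * f) :=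
  rfl

theorem LChar.mul_lshift {r : DualH k F} (hr : LChar K γ r) (h : DualH k F) (y : K) :
    lshift (y : F) (r * h) =
      r * lshift ((TensorProduct.lid k K
        ((charOf γ).toLinearMap.rTensor K (comul (R := k) y)) : K) : F) h := by
  refine dualH_ext fun f => ?_
  have key : ∀ (z : K ⊗[k] K) (w : F ⊗[k] F), ev2 (r ⊗ₜ h) (incl2 K z * w) =
      ev2 (r ⊗ₜ lshift ((TensorProduct.lid k K
        ((charOf γ).toLinearMap.rTensor K z) : K) : F) h) w := by
    intro z w
    induction w with
    | zero => simp
    | add r s hr hs => simp only [map_add, hr, hs, mul_add]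
    | tmul s t =>
      rw [ev2_tmul, lshift_apply]
      induction z with
      | zero => simp
      | add u v hu hv => simp only [map_add, add_mul, mul_add, Subalgebra.coe_add, hu, hv]
      | tmul u v =>
        rw [incl2_tmul, Algebra.TensorProduct.tmul_mul_tmul, ev2_tmul, hr]
        simp
        ring
  rw [lshift_apply, dualH_mul_apply, Bialgebra.comul_mul, ← incl2_comul, key, ← dualH_mul_apply]

variable [IsAlgClosed k] (hss : IsSemisimpleRing K) (hcomm : ∀ x y : K, x * y = y * x)

include hss hcomm in
theorem mul_idem [DecidableEq (GroupLike k (DualH k K))] {e : GroupLike k (DualH k K) → K}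
    (he : ∀ γ δ, charOf δ (e γ) = if δ = γ then 1 else 0) (y : K) :
    y * e γ = charOf γ y • e γ := by
  rw [← sub_eq_zero]
  refine eq_zero_of_charOf (k := k) hss hcomm fun δ => ?_
  rw [map_sub, _root_.map_mul, map_smul, he]
  split_ifs with hd
  · subst hd; simp
  · simp

include hss hcomm in
theorem exists_twoSided (γ : GroupLike k (DualH k K)) :
    ∃ h : DualH k F, LChar K γ h ∧ RChar K γ h ∧ toDual h 1 = 1 := by
  classical
  obtain ⟨e, he⟩ := exists_idempotents (k := k) hss hcomm
  have h0 : (e γ : F) ≠ 0 := by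
    intro h
    have := he γ γ
    rw [Subtype.ext h (a2 := (0 : K)), map_zero] at this
    simp at this
  obtain ⟨φ, hφ⟩ := not_forall.1 (mt (Module.forall_dual_apply_eq_zero_iff k (e γ : F)).1 h0)
  have hl := mul_idem hss hcomm he (γ := γ)
  have hl' : ∀ y : K, (y : F) * e γ = charOf γ y • (e γ : F) := fun y => congrArg Subtype.val (hl y)
  have hr' : ∀ y : K, (e γ : F) * y = charOf γ y • (e γ : F) := fun y =>
    (congrArg Subtype.val (hcomm (e γ) y)).trans (hl' y)
  refine ⟨toDual.symm ((φ (e γ))⁻¹ • (φ ∘ₗ LinearMap.mulLeft k (e γ : F) ∘ₗ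
    LinearMap.mulRight k (e γ : F))), fun y f => ?_, fun y f => ?_, ?_⟩
  · simp only [LinearEquiv.apply_symm_apply, LinearMap.smul_apply, LinearMap.comp_apply,
      LinearMap.mulLeft_apply, LinearMap.mulRight_apply]
    rw [mul_assoc, ← mul_assoc, hr', smul_mul_assoc, map_smul]
    simp only [smul_eq_mul]; ring
  · simp only [LinearEquiv.apply_symm_apply, LinearMap.smul_apply, LinearMap.comp_apply,
      LinearMap.mulLeft_apply, LinearMap.mulRight_apply]
    rw [mul_assoc, hl', mul_smul_comm, mul_smul_comm, map_smul]
    simp only [smul_eq_mul]; ring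
  · simp only [LinearEquiv.apply_symm_apply, LinearMap.smul_apply, LinearMap.comp_apply,
      LinearMap.mulLeft_apply, LinearMap.mulRight_apply, one_mul]
    rw [hl', he, if_pos rfl, one_smul, smul_eq_mul, inv_mul_cancel₀ hφ]

include hss hcomm in
theorem exists_skew_functional (hdim : Module.finrank k F = 2 * Module.finrank k K) :
    ∃ x : DualH k F, x ≠ 0 ∧ LChar K 1 x ∧ toDual x 1 = 0 ∧
      ∀ r, LChar K 1 r → ∃ μ : k, r = toDual r 1 • 1 + μ • x := by
  classical
  obtain ⟨e, he⟩ := exists_idempotents (k := k) hss hcomm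
  have hl : ∀ y : K, (y : F) * e 1 = charOf (1 : GroupLike k (DualH k K)) y • (e 1 : F) :=
    fun y => congrArg Subtype.val (mul_idem hss hcomm he y)
  have hr : ∀ y : K, (e 1 : F) * y = charOf (1 : GroupLike k (DualH k K)) y • (e 1 : F) := fun y =>
    (congrArg Subtype.val (hcomm (e 1) y)).trans (hl y)
  set L : F →ₗ[k] F := LinearMap.mulLeft k (e 1 : F) with hL
  have h1 : LinearMap.range L = invts (resReg (subIncl K)) := by
    ext m
    constructor
    · rintro ⟨f, rfl⟩
      intro y
      rw [resReg_apply, subIncl_apply, hL, LinearMap.mulLeft_apply, ← mul_assoc, hl, charOf_one,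
        smul_mul_assoc]
    · intro hm
      refine ⟨m, ?_⟩
      have := hm (e 1)
      rw [resReg_apply, subIncl_apply, ← charOf_one, he, if_pos rfl, one_smul] at this
      exact this
  have : Nontrivial F := ⟨⟨1, 0, fun h => by simpa using congrArg (counit (R := k)) h⟩⟩
  let W : Submodule k (F →ₗ[k] k) := LinearMap.range L.dualMap
  have h2 : Module.finrank k W = 2 := by
    change Module.finrank k (LinearMap.range L.dualMap) = 2
    rw [LinearMap.finrank_range_dualMap_eq_finrank_range, h1]
    have h3 := finrank_invts_resReg (subIncl K) Subtype.val_injective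
    rw [hdim] at h3
    exact Nat.eq_of_mul_eq_mul_right Module.finrank_pos h3
  have hmem : ∀ r : DualH k F, LChar K 1 r ↔ toDual r ∈ W := by
    intro r
    constructor
    · intro hr'
      refine ⟨toDual r, LinearMap.ext fun f => ?_⟩
      rw [LinearMap.dualMap_apply, hL, LinearMap.mulLeft_apply, hr', he, if_pos rfl, one_mul]
    · rintro ⟨φ, hφ⟩ y f
      rw [← hφ, LinearMap.dualMap_apply, LinearMap.dualMap_apply, hL, LinearMap.mulLeft_apply,
        LinearMap.mulLeft_apply, ← mul_assoc, hr, smul_mul_assoc, map_smul, smul_eq_mul]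
  obtain ⟨x, hx0, hxW, hx1, hspan⟩ := exists_complement W (LinearMap.applyₗ (1 : F)) h2
    ((hmem 1).1 LChar.one) (by simp [dualH_one])
  refine ⟨toDual.symm x, fun h => hx0 ?_, (hmem _).2 (by simpa using hxW), by simpa using hx1,
    fun r hr' => ?_⟩
  · simpa using h
  · obtain ⟨μ, hμ⟩ := hspan _ ((hmem r).1 hr')
    refine ⟨μ, toDual.injective ?_⟩
    simpa using hμ

end TwoSided

section Index

variable {k F : Type} [Field k] [Ring F] [HopfAlgebra k F] [FiniteDimensional k F]
variable {K : Subalgebra k F} [IsSubHopf K]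
variable {γ δ : GroupLike k (DualH k K)} {x : DualH k F}

theorem exists_grading_char (hx : x ≠ 0) (hxl : LChar K 1 x) (hx1 : toDual x 1 = 0)
    (hspan : ∀ r, LChar K 1 r → ∃ μ : k, r = toDual r 1 • 1 + μ • x) :
    ∃ g : F →ₐ[k] k, ∀ f f', toDual x (f * f') = counit (R := k) f * toDual x f' +
      g f' * toDual x f := by
  have h1 : ∀ f', ∃ μ : k, ∀ f, toDual x (f * f') = counit (R := k) f * toDual x f' +
      μ * toDual x f := by
    intro f'
    obtain ⟨μ, hμ⟩ := hspan (toDual.symm (toDual x ∘ₗ LinearMap.mulRight k f')) (by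
      intro y f
      change toDual x ((y : F) * f * f') = _ * toDual x (f * f')
      rw [mul_assoc, hxl])
    refine ⟨μ, fun f => ?_⟩
    have h2 := congrArg (fun z => toDual z f) hμ
    simp only [LinearEquiv.apply_symm_apply, map_add, map_smul, LinearMap.add_apply,
      LinearMap.smul_apply, LinearMap.comp_apply, LinearMap.mulRight_apply, dualH_one,
      smul_eq_mul, one_mul] at h2
    rw [h2, mul_comm (toDual x f')]
  choose g hg using h1
  obtain ⟨f₀, hf₀⟩ : ∃ f₀, toDual x f₀ ≠ 0 := by
    by_contra! h
    exact hx (dualH_ext fun f => by rw [h f, map_zero, LinearMap.zero_apply])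
  have cancel : ∀ a b : k, a * toDual x f₀ = b * toDual x f₀ → a = b := fun a b h =>
    mul_right_cancel₀ hf₀ h
  have hadd : ∀ a b, g (a + b) = g a + g b := fun a b => cancel _ _ (by
    have := hg (a + b) f₀
    rw [mul_add, map_add, hg, hg, map_add] at this
    linear_combination -this)
  have hsmul : ∀ (c : k) a, g (c • a) = c * g a := fun c a => cancel _ _ (by
    have := hg (c • a) f₀
    rw [mul_smul_comm, map_smul, hg, map_smul, smul_eq_mul, smul_eq_mul] at this
    linear_combination -this)
  have hone : g 1 = 1 := cancel _ _ (by
    have := hg 1 f₀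
    rw [mul_one, hx1] at this
    linear_combination -this)
  have hmul : ∀ a b, g (a * b) = g a * g b := fun a b => cancel _ _ (by
    have h3 := hg (a * b) f₀
    rw [← mul_assoc, hg b (f₀ * a), hg a f₀, hg b a, Bialgebra.counit_mul] at h3
    linear_combination -h3)
  exact ⟨AlgHom.ofLinearMap { toFun := g, map_add' := hadd, map_smul' := hsmul } hone hmul,
    fun f₁ f₂ => hg f₂ f₁⟩

/-- The restriction of a character to a subalgebra. -/
noncomputable def resChar (K : Subalgebra k F) [IsSubHopf K] (g : F →ₐ[k] k) :
    GroupLike k (DualH k K) := ofChar (g.comp K.val)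

theorem charOf_resChar (g : F →ₐ[k] k) (y : K) : charOf (resChar K g) y = g y := by
  rw [resChar, charOf_ofChar]; rfl

theorem LChar.char (g : F →ₐ[k] k) : LChar K (resChar K g) (toDual.symm g.toLinearMap) := by
  intro y f
  rw [charOf_resChar]; simp

theorem rChar_of_skew {g : F →ₐ[k] k} (hxl : LChar K 1 x) (hx1 : toDual x 1 = 0)
    (hg : ∀ f f', toDual x (f * f') = counit (R := k) f * toDual x f' + g f' * toDual x f) :
    RChar K (resChar K g) x := by
  intro y f
  have h := hxl y 1
  rw [hx1, mul_one, mul_zero] at h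
  rw [hg, h, charOf_resChar, mul_zero, zero_add]

theorem comul_of_skew {g : F →ₐ[k] k}
    (hg : ∀ f f', toDual x (f * f') = counit (R := k) f * toDual x f' + g f' * toDual x f) :
    comul (R := k) x = 1 ⊗ₜ x + x ⊗ₜ toDual.symm g.toLinearMap := by
  refine ev2_ext fun a b => ?_
  rw [ev2_comul, hg, map_add, LinearMap.add_apply, ev2_tmul, ev2_tmul, dualH_one]
  simp [mul_comm]

theorem RChar.unique (hx : x ≠ 0) (h : RChar K γ x) (h' : RChar K δ x) : γ = δ := by
  obtain ⟨f₀, hf₀⟩ : ∃ f₀, toDual x f₀ ≠ 0 := by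
    by_contra! h
    exact hx (dualH_ext fun f => by rw [h f, map_zero, LinearMap.zero_apply])
  refine charOf_injective (AlgHom.ext fun y => mul_right_cancel₀ hf₀ ?_)
  rw [← h, ← h']

theorem RChar.smul (h : RChar K γ x) (c : k) : RChar K γ (c • x) := by
  intro y f
  rw [map_smul, LinearMap.smul_apply, LinearMap.smul_apply, h, smul_eq_mul, smul_eq_mul]
  ring

theorem RChar.sub {x' : DualH k F} (h : RChar K γ x) (h' : RChar K γ x') : RChar K γ (x - x') := by
  intro y f
  rw [map_sub, LinearMap.sub_apply, LinearMap.sub_apply, h, h']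
  ring

theorem eq_smul_one {g : F →ₐ[k] k} (hxr : RChar K (resChar K g) x)
    (hspan : ∀ r, LChar K 1 r → ∃ μ : k, r = toDual r 1 • 1 + μ • x) (hg1 : resChar K g ≠ 1)
    {r : DualH k F} (hl : LChar K 1 r) (hr : RChar K 1 r) : r = toDual r 1 • 1 := by
  obtain ⟨μ, hμ⟩ := hspan r hl
  have h1 : μ • x = r - toDual r 1 • 1 := by rw [eq_sub_iff_add_eq', ← hμ]
  have h2 : RChar K 1 (μ • x) := h1 ▸ hr.sub (RChar.one.smul _)
  by_contra hne
  have hμ0 : μ • x ≠ 0 := fun h => hne (by rw [h, add_zero] at hμ; exact hμ)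
  exact hg1 ((hxr.smul μ).unique hμ0 h2)

variable [CharZero k]

theorem skew_nilpotent_order {g : F →ₐ[k] k} (hx : x ≠ 0)
    (hspan : ∀ r, LChar K 1 r → ∃ μ : k, r = toDual r 1 • 1 + μ • x)
    (hg : ∀ f f', toDual x (f * f') = counit (R := k) f * toDual x f' + g f' * toDual x f)
    (hxx : x * x = 0) {j : ℕ} (hj : Odd j) : resChar K g ^ j ≠ 1 := by
  set G : DualH k F := toDual.symm g.toLinearMap with hG
  intro hgj
  have hc := comul_of_skew hg
  have h1 : x * G = -(G * x) := by
    have h2 := Bialgebra.comul_mul (R := k) x x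
    rw [hxx, map_zero, hc] at h2
    simp only [add_mul, mul_add, Algebra.TensorProduct.tmul_mul_tmul, one_mul, mul_one, hxx,
      TensorProduct.tmul_zero, TensorProduct.zero_tmul, add_zero, zero_add,
      ← TensorProduct.tmul_add] at h2
    by_contra hne
    refine tmul_ne_zero (k := k) hx (fun h => hne ?_) h2.symm
    exact eq_neg_of_add_eq_zero_right h
  have h3 : ∀ n : ℕ, x * G ^ n = (-1 : k) ^ n • (G ^ n * x) := by
    intro n
    induction n with
    | zero => simp
    | succ n ih =>
      rw [pow_succ, ← mul_assoc, ih, smul_mul_assoc, mul_assoc, h1, mul_neg, ← mul_assoc,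
        pow_succ (-1 : k)]
      simp
  obtain ⟨μ, hμ⟩ := hspan (G ^ j) (hgj ▸ (LChar.char g).pow j)
  have h4 : x * G ^ j = G ^ j * x := by
    rw [hμ]; simp [mul_add, add_mul]
  have h5 : G ^ j * x = 0 := by
    have := h3 j
    rw [h4, hj.neg_one_pow, neg_smul, one_smul] at this
    have h6 : (2 : k) • (G ^ j * x) = 0 := by rw [two_smul]; nth_rewrite 1 [this]; simp
    exact (smul_eq_zero.1 h6).resolve_left two_ne_zero
  have h6 : ∀ n : ℕ, (antipode k G) ^ n * G ^ n = 1 := by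
    intro n
    induction n with
    | zero => simp
    | succ n ih =>
      rw [pow_succ, pow_succ', mul_assoc, ← mul_assoc _ G, antipode_char_mul, one_mul, ih]
  apply hx
  rw [← one_mul x, ← h6 j, mul_assoc, h5, mul_zero]

variable [IsAlgClosed k] (hss : IsSemisimpleRing K) (hcomm : ∀ x y : K, x * y = y * x)

include hss hcomm in
theorem skew_nilpotent_central {g : F →ₐ[k] k} (hx : x ≠ 0) (hxl : LChar K 1 x)
    (hx1 : toDual x 1 = 0)
    (hspan : ∀ r, LChar K 1 r → ∃ μ : k, r = toDual r 1 • 1 + μ • x)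
    (hxr : RChar K (resChar K g) x) (hg1 : resChar K g ≠ 1) (γ : GroupLike k (DualH k K)) :
    γ * resChar K g = resChar K g * γ := by
  obtain ⟨u, hul, hur, hu1⟩ := exists_twoSided hss hcomm γ
  obtain ⟨v, hvl, hvr, hv1⟩ := exists_twoSided hss hcomm γ⁻¹
  have huv : u * v = 1 := by
    rw [eq_smul_one hxr hspan hg1 (r := u * v) (by simpa using hul.mul hvl)
      (by simpa using hur.mul hvr), toDual_mul_one, hu1, hv1, one_mul, one_smul]
  obtain ⟨μ, hμ⟩ := hspan (v * x * u) (by simpa using (hvl.mul hxl).mul hul)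
  rw [toDual_mul_one, toDual_mul_one, hx1, mul_zero, zero_mul, zero_smul, zero_add] at hμ
  have hr := (hvr.mul hxr).mul hur
  have h0 : μ • x ≠ 0 := by
    intro h
    rw [h] at hμ
    apply hx
    calc x = u * (v * x * u) * v := by
          rw [mul_assoc v, ← mul_assoc, huv, one_mul, mul_assoc, huv, mul_one]
      _ = 0 := by rw [hμ]; simp
  have := (hμ ▸ hr : RChar K _ (μ • x)).unique h0 (hxr.smul μ)
  rw [mul_assoc, inv_mul_eq_iff_eq_mul] at this
  exact this.symm

omit [CharZero k] [IsAlgClosed k] in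
theorem mul_lshift_one {r : DualH k F}
    (hr : LChar K 1 r) (h : DualH k F) (y : K) : lshift (y : F) (r * h) = r * lshift (y : F) h := by
  rw [hr.mul_lshift]
  congr 3
  have h1 : ∀ z : K ⊗[k] K, TensorProduct.lid k K ((charOf (1 : GroupLike k (DualH k K))).toLinearMap.rTensor K z) =
      TensorProduct.lid k K ((counit (R := k) (A := K)).rTensor K z) := by
    intro z
    congr 3
  rw [h1, rTensor_counit_comul]
  simp

include hss hcomm in
theorem skew_nondegenerate {β : k} (hβ : β ≠ 0) (hx : x ≠ 0) (hx1 : toDual x 1 = 0)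
    (hxl : LChar K 1 x)
    (hspan : ∀ r, LChar K 1 r → ∃ μ : k, r = toDual r 1 • 1 + μ • x) (hxx : x * x = β • x) :
    ∃ Λ ∈ leftInt k (DualH k F), counit (R := k) Λ ≠ 0 := by
  classical
  obtain ⟨e, he⟩ := exists_idempotents (k := k) hss hcomm
  have : Nontrivial F := ⟨⟨1, 0, fun h => by simpa using congrArg (counit (R := k)) h⟩⟩
  have := Fintype.ofFinite (GroupLike k (DualH k K))
  obtain ⟨Λ, hΛ, hΛ0, -⟩ := exists_leftInt (k := k) (K := DualH k F)
  have hInt : ∀ a, a * Λ = toDual a 1 • Λ := (mem_leftInt Λ).1 hΛ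
  have hsum : ∑ γ, e γ = 1 := by
    rw [← sub_eq_zero]
    refine eq_zero_of_charOf (k := k) hss hcomm fun δ => ?_
    simp [he]
  choose u hul hur hu1 using exists_twoSided (k := k) hss hcomm
  have hcomp : ∀ γ, lshift (e γ : F) Λ = u γ * lshift (e 1 : F) Λ := by
    intro γ
    have h1 := (hul γ).mul_lshift Λ (e γ)
    rw [hInt, hu1, one_smul] at h1
    rw [h1]
    congr 3
    rw [← sub_eq_zero]
    refine eq_zero_of_charOf (k := k) hss hcomm fun δ => ?_
    have h2 : ∀ z : K ⊗[k] K, charOf δ (TensorProduct.lid k K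
        ((charOf γ).toLinearMap.rTensor K z)) = ev2 (γ.val ⊗ₜ δ.val) z := by
      intro z
      induction z with
      | zero => simp
      | add u v hu hv => simp only [map_add, hu, hv]
      | tmul u v => rw [ev2_tmul]; simp [charOf_apply]
    rw [map_sub, h2, ← charOf_mul, he, he, sub_eq_zero]
    simp
  have hl1 : LChar K 1 (lshift (e 1 : F) Λ) := by
    intro y f
    have h1 : (e 1 : F) * y = charOf (1 : GroupLike k (DualH k K)) y • (e 1 : F) :=
      (congrArg Subtype.val (hcomm (e 1) y)).trans
        (congrArg Subtype.val (mul_idem (k := k) hss hcomm he y))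
    rw [lshift_apply, lshift_apply, ← mul_assoc, h1, smul_mul_assoc, map_smul, smul_eq_mul]
  obtain ⟨v, hv⟩ := hspan _ hl1
  set Λ₁ := lshift (e 1 : F) Λ with hΛ₁
  have htot : ∀ f, toDual Λ f = ∑ γ, toDual (u γ * Λ₁) f := by
    intro f
    simp only [← hcomp, lshift_apply]
    rw [← map_sum, ← Finset.sum_mul]
    have h1 : ∑ γ, (e γ : F) = 1 := by
      rw [← Subalgebra.coe_one K, ← hsum]
      exact (map_sum K.val e _).symm
    rw [h1, one_mul]
  have hne : Λ₁ ≠ 0 := by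
    intro h
    apply hΛ0
    refine dualH_ext fun f => ?_
    rw [htot, h]
    simp
  have hxΛ : x * Λ₁ = 0 := by
    rw [hΛ₁, ← mul_lshift_one hxl Λ (e 1), hInt, hx1, zero_smul]
    refine dualH_ext fun f => ?_
    rw [lshift_apply]; simp
  have hu0 : toDual Λ₁ 1 ≠ 0 := by
    intro h
    rw [h, zero_smul, zero_add] at hv
    rw [hv, mul_smul_comm, hxx, smul_smul] at hxΛ
    have : v = 0 := by simpa [hβ, hx] using hxΛ
    rw [this, zero_smul] at hv
    exact hne hv
  refine ⟨Λ, hΛ, ?_⟩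
  rw [dualH_counit, htot]
  simp only [toDual_mul_one, hu1, one_mul, Finset.sum_const, Finset.card_univ, nsmul_eq_mul]
  exact mul_ne_zero (Nat.cast_ne_zero.2 Fintype.card_ne_zero) hu0

include hss hcomm in
theorem integral_or_central (hdim : Module.finrank k F = 2 * Module.finrank k K) :
    (∃ Λ ∈ leftInt k (DualH k F), counit (R := k) Λ ≠ 0) ∨
    ∃ g : GroupLike k (DualH k K), (∀ γ, γ * g = g * γ) ∧ ∀ j : ℕ, Odd j → g ^ j ≠ 1 := by
  obtain ⟨x, hx, hxl, hx1, hspan⟩ := exists_skew_functional (k := k) hss hcomm hdim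
  obtain ⟨g, hg⟩ := exists_grading_char hx hxl hx1 hspan
  obtain ⟨β, hβ⟩ := hspan (x * x) (by simpa using hxl.mul hxl)
  rw [toDual_mul_one, hx1, mul_zero, zero_smul, zero_add] at hβ
  by_cases h0 : β = 0
  · rw [h0, zero_smul] at hβ
    have hord : ∀ j : ℕ, Odd j → resChar K g ^ j ≠ 1 := fun j hj =>
      skew_nilpotent_order hx hspan hg hβ hj
    refine Or.inr ⟨resChar K g, fun γ => ?_, hord⟩
    exact skew_nilpotent_central hss hcomm hx hxl hx1 hspan (rChar_of_skew hxl hx1 hg)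
      (by simpa using hord 1 odd_one) γ
  · exact Or.inl (skew_nondegenerate hss hcomm h0 hx hx1 hxl hspan hβ)

end Index

/-- A left integral on the double dual with nonzero counit forces semisimplicity. -/
theorem isSemisimpleRing_of_dual_dual {k H : Type} [Field k] [Ring H] [HopfAlgebra k H]
    [FiniteDimensional k H] {Λ : DualH k (DualH k H)} (hΛ : Λ ∈ leftInt k (DualH k (DualH k H)))
    (h0 : counit (R := k) Λ ≠ 0) : IsSemisimpleRing H := by
  obtain ⟨t, ht⟩ : ∃ t : H, ∀ f : DualH k H, toDual f t = toDual Λ f := by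
    obtain ⟨t, ht⟩ := (Module.evalEquiv k H).surjective (toDual Λ ∘ₗ toDual.symm.toLinearMap)
    refine ⟨t, fun f => ?_⟩
    have := congrArg (fun z => z (toDual f)) ht
    simpa using this
  have hInt : ∀ h : H, h * t = counit (R := k) h • t := by
    intro h
    rw [← sub_eq_zero]
    refine (Module.forall_dual_apply_eq_zero_iff k _).1 fun φ => ?_
    obtain ⟨f, rfl⟩ := (toDual (k := k) (H := H)).surjective φ
    let η : DualH k (DualH k H) := toDual.symm (LinearMap.applyₗ h ∘ₗ toDual.toLinearMap)
    have h1 := congrArg (fun z => toDual z f) ((mem_leftInt Λ).1 hΛ η)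
    have h2 : ∀ z : DualH k H ⊗[k] DualH k H, ev2 (η ⊗ₜ Λ) z = ev2 z (h ⊗ₜ t) := by
      intro z
      induction z with
      | zero => simp
      | add u v hu hv => simp only [map_add, hu, hv, LinearMap.add_apply]
      | tmul u v => rw [ev2_tmul, ev2_tmul, ht]; simp [η]
    simp only [dualH_mul_apply, h2, ev2_comul, dualH_counit, map_smul, LinearMap.smul_apply] at h1
    have h3 : toDual η 1 = counit (R := k) h := by simp [η, dualH_one]
    rw [map_sub, map_smul, h1, h3, ht, sub_self]
  have hc : counit (R := k) t = counit (R := k) Λ := by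
    rw [dualH_counit, ← ht, dualH_one]
  refine isSemisimpleRing_of_leftInt (k := k) (Λ := (counit (R := k) t)⁻¹ • t) ?_ ?_
  · refine (mem_leftInt _).2 fun a => ?_
    rw [mul_smul_comm, hInt, smul_comm]
  · rw [map_smul, smul_eq_mul, inv_mul_cancel₀ (hc ▸ h0)]

section Inner

theorem exists_fixed_matrix {k : Type} [Field k]
    (φ : Matrix (Fin 2) (Fin 2) k →ₐ[k] Matrix (Fin 2) (Fin 2) k) :
    ∃ M, φ M = M ∧ ¬ (M 0 1 = 0 ∧ M 1 0 = 0 ∧ M 0 0 = M 1 1) := by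
  have hinj : Function.Injective φ := φ.toRingHom.injective
  have hbij : Function.Bijective φ :=
    ⟨hinj, (LinearMap.injective_iff_surjective (f := φ.toLinearMap)).1 hinj⟩
  let τ := Matrix.toLinAlgEquiv' (R := k) (n := Fin 2)
  let f := (τ.symm.trans (AlgEquiv.ofBijective φ hbij)).trans τ
  obtain ⟨T, hT⟩ := f.eq_linearEquivConjAlgEquiv
  have hφ : ∀ M, τ (φ M) = T.toLinearMap ∘ₗ τ M ∘ₗ T.symm.toLinearMap := fun M => by
    have := congrArg (fun z => z (τ M)) hT
    simpa [f, LinearEquiv.conjAlgEquiv_apply] using this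
  set M := τ.symm T.toLinearMap with hM
  have hτM : τ M = T.toLinearMap := τ.apply_symm_apply _
  by_cases hs : M 0 1 = 0 ∧ M 1 0 = 0 ∧ M 0 0 = M 1 1
  · have h1 : T.toLinearMap = M 0 0 • LinearMap.id := by
      have : M = M 0 0 • (1 : Matrix (Fin 2) (Fin 2) k) := by
        ext i j
        fin_cases i <;> fin_cases j <;> simp [hs.1, hs.2.1, hs.2.2]
      rw [← hτM]
      conv_lhs => rw [this, map_smul, map_one]
      rfl
    refine ⟨!![0, 1; 0, 0], τ.injective ?_, by simp⟩
    rw [hφ]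
    have h2 : ∀ N : Module.End k (Fin 2 → k), T.toLinearMap ∘ₗ N = N ∘ₗ T.toLinearMap := fun N => by
      rw [h1, LinearMap.smul_comp, LinearMap.comp_smul, LinearMap.id_comp, LinearMap.comp_id]
    rw [← LinearMap.comp_assoc, h2, LinearMap.comp_assoc]
    ext1 v; simp
  · refine ⟨M, τ.injective ?_, hs⟩
    rw [hφ, hτM]
    ext v; simp

variable {k A : Type} [Field k] [Ring A] [HopfAlgebra k A] [FiniteDimensional k A]
  {K : Subalgebra k A} [IsSubHopf K] [IsAlgClosed k]

theorem not_cyclic (hss : IsSemisimpleRing K) (hcomm : ∀ x y : K, x * y = y * x)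
    (X Y : Matrix (Fin 2) (Fin 2) A) (hYX : Y * X = 1) (hXY : X * Y = 1)
    (hΔX : ∀ i j, comul (R := k) (X i j) = ∑ m, X i m ⊗ₜ[k] X m j)
    (hΔY : ∀ i j, comul (R := k) (Y i j) = ∑ m, Y m j ⊗ₜ[k] Y i m)
    (hεX : ∀ i j, counit (R := k) (X i j) = (1 : Matrix (Fin 2) (Fin 2) k) i j)
    (hεY : ∀ i j, counit (R := k) (Y i j) = (1 : Matrix (Fin 2) (Fin 2) k) i j)
    (hK : ∀ i m n j, Y i m * X n j ∈ K)
    (hli : LinearIndependent k ![X 0 0, X 0 1, X 1 0, X 1 1]) :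
    ¬ IsCyclic (GroupLike k (DualH k K)) := by
  intro hcyc
  let κ : Fin 2 → Fin 2 → Fin 2 → Fin 2 → K := fun i m n j => ⟨Y i m * X n j, hK i m n j⟩
  have hκ : ∀ i m n j, (κ i m n j : A) = Y i m * X n j := fun _ _ _ _ => rfl
  let Ψ₀ : Matrix (Fin 2) (Fin 2) k →ₗ[k] Matrix (Fin 2) (Fin 2) K :=
    { toFun := fun M => Matrix.of fun i j => ∑ m, ∑ n, M m n • κ i m n j
      map_add' := fun M N => Matrix.ext fun i j => by
        simp only [Matrix.add_apply, Matrix.of_apply, add_smul, Finset.sum_add_distrib]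
      map_smul' := fun c M => Matrix.ext fun i j => by
        simp only [Matrix.smul_apply, Matrix.of_apply, Finset.smul_sum, smul_assoc,
          RingHom.id_apply] }
  have hΨ₀ : ∀ M i j, Ψ₀ M i j = ∑ m, ∑ n, M m n • κ i m n j := fun _ _ _ => rfl
  have hval : ∀ M, (Ψ₀ M).map K.val = Y * M.map (algebraMap k A) * X := by
    intro M
    ext i j
    simp only [hΨ₀, Matrix.map_apply, map_sum, map_smul]
    simp only [Subalgebra.coe_val, hκ, Matrix.mul_apply, Finset.sum_mul, Matrix.map_apply]
    rw [Finset.sum_comm]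
    refine Finset.sum_congr rfl fun n _ => Finset.sum_congr rfl fun m _ => ?_
    rw [← Algebra.commutes, Algebra.smul_def, mul_assoc]
  have hinj : ∀ M N : Matrix (Fin 2) (Fin 2) K, M.map K.val = N.map K.val → M = N :=
    fun M N h => Matrix.map_injective Subtype.val_injective h
  let Ψ : Matrix (Fin 2) (Fin 2) k →ₐ[k] Matrix (Fin 2) (Fin 2) K :=
    AlgHom.ofLinearMap Ψ₀ (hinj _ _ (by
      rw [hval, Matrix.map_one _ (map_zero _) (map_one _), mul_one, hYX,
        Matrix.map_one _ (map_zero _) (map_one _)]))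
      (fun M N => hinj _ _ (by
        rw [hval, Matrix.map_mul, Matrix.map_mul, hval, hval]
        calc _ = Y * M.map (algebraMap k A) * 1 * N.map (algebraMap k A) * X := by
              simp only [mul_one, mul_assoc]
          _ = _ := by rw [← hXY]; simp only [mul_assoc]))
  obtain ⟨γ, hγ⟩ := hcyc.exists_generator
  obtain ⟨M, hM, hns⟩ := exists_fixed_matrix ((charOf γ).mapMatrix.comp Ψ)
  have hM' : ∀ i j, charOf γ (Ψ₀ M i j) = M i j := fun i j => congrFun (congrFun hM i) j
  have hκΔ : ∀ i m n j, comul (R := k) (κ i m n j) =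
      ∑ s, ∑ t, κ s m n t ⊗ₜ[k] κ i s t j := by
    intro i m n j
    refine subHopf_comul_eq ?_
    rw [hκ, Bialgebra.comul_mul, hΔX, hΔY, Finset.sum_mul_sum]
    simp only [map_sum, incl2_tmul, hκ, Algebra.TensorProduct.tmul_mul_tmul]
  have hstep : ∀ δ : GroupLike k (DualH k K), (∀ i j, charOf δ (Ψ₀ M i j) = M i j) →
      ∀ i j, charOf (γ * δ) (Ψ₀ M i j) = M i j := by
    intro δ hδ i j
    have h1 : ∀ N : Matrix (Fin 2) (Fin 2) k, (∀ s t, N s t = charOf γ (Ψ₀ M s t)) →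
        charOf (γ * δ) (Ψ₀ M i j) = charOf δ (Ψ₀ N i j) := by
      intro N hN
      rw [charOf_mul]
      simp only [hΨ₀, hN, map_sum, map_smul, hκΔ, ev2_tmul, charOf_apply, smul_eq_mul]
      simp only [Fin.sum_univ_two]
      ring
    rw [h1 M fun s t => (hM' s t).symm, hδ]
  have hpow : ∀ n : ℕ, ∀ i j, charOf (γ ^ n) (Ψ₀ M i j) = M i j := by
    intro n
    induction n with
    | zero =>
      intro i j
      rw [pow_zero, charOf_one, subHopf_counit]
      simp only [hΨ₀]
      rw [← Subalgebra.coe_val, map_sum, map_sum]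
      simp only [map_sum, map_smul]
      simp only [Subalgebra.coe_val, hκ, Bialgebra.counit_mul, hεX, hεY, Fin.sum_univ_two]
      revert i j
      simp [Fin.forall_fin_two]
    | succ n ih =>
      rw [pow_succ']
      exact hstep _ ih
  have hall : ∀ i j, Ψ₀ M i j = algebraMap k K (M i j) := by
    intro i j
    rw [← sub_eq_zero]
    refine eq_zero_of_charOf (k := k) hss hcomm fun δ => ?_
    obtain ⟨n, rfl⟩ := (mem_powers_iff_mem_zpowers.2 (hγ δ))
    rw [map_sub, AlgHom.commutes]
    simp [hpow]
  have hcom : M.map (algebraMap k A) * X = X * M.map (algebraMap k A) := by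
    have h1 : Y * M.map (algebraMap k A) * X = M.map (algebraMap k A) := by
      rw [← hval]
      ext i j
      simp [hall]
    calc _ = X * (Y * M.map (algebraMap k A) * X) := by
          rw [← mul_assoc, ← mul_assoc, hXY, one_mul]
      _ = _ := by rw [h1]
  have e00 := congrFun (congrFun hcom 0) 0
  have e01 := congrFun (congrFun hcom 0) 1
  simp only [Matrix.mul_apply, Fin.sum_univ_two, Matrix.map_apply, ← Algebra.commutes,
    ← Algebra.smul_def] at e00 e01
  rw [Fintype.linearIndependent_iff] at hli
  have l1 := hli ![0, -(M 1 0), M 0 1, 0] (by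
    simp only [Fin.sum_univ_four, Matrix.cons_val]
    rw [← sub_eq_zero] at e00
    rw [← e00]
    module)
  have l2 := hli ![-(M 0 1), M 0 0 - M 1 1, 0, M 0 1] (by
    simp only [Fin.sum_univ_four, Matrix.cons_val]
    rw [← sub_eq_zero] at e01
    rw [← e01]
    module)
  refine hns ⟨by simpa using l1 2, by simpa using l1 1, ?_⟩
  simpa [sub_eq_zero] using l2 1

end Inner

section Final

/-- `r`-commutation of an element with the entries of a quantum matrix at a sign `q`. -/
structure SignComm {k A : Type} [Field k] [Ring A] [Algebra k A] (q : k) (a b c d : A) (r : k)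
    (x : A) : Prop where
  sq : r * r = 1
  ca : x * a = r • (a * x)
  cd : x * d = r • (d * x)
  cb : x * b = (r * q) • (b * x)
  cc : x * c = (r * q) • (c * x)

variable {k A : Type} [Field k] [Ring A] [HopfAlgebra k A] {q : k} {a b c d : A}

theorem SignComm.mul {r s : k} {x y : A} (hq : q * q = 1) (hx : SignComm q a b c d r x)
    (hy : SignComm q a b c d s y) :
    (x * y) * a = (r * s) • (a * (x * y)) ∧ (x * y) * b = (r * s) • (b * (x * y)) ∧
    (x * y) * c = (r * s) • (c * (x * y)) ∧ (x * y) * d = (r * s) • (d * (x * y)) := by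
  have key : ∀ (e : A) (t u : k), x * e = t • (e * x) → y * e = u • (e * y) →
      (x * y) * e = (t * u) • (e * (x * y)) := by
    intro e t u h1 h2
    rw [mul_assoc, h2, mul_smul_comm, ← mul_assoc, h1, smul_mul_assoc, smul_smul, mul_assoc,
      mul_comm u]
  have hrq : r * q * (s * q) = r * s := by linear_combination r * s * hq
  refine ⟨key _ _ _ hx.ca hy.ca, ?_, ?_, key _ _ _ hx.cd hy.cd⟩
  · rw [← hrq]; exact key _ _ _ hx.cb hy.cb
  · rw [← hrq]; exact key _ _ _ hx.cc hy.cc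

theorem QMat.signComm (h : QMat q a b c d) (hq : q * q = 1) :
    SignComm q a b c d 1 a ∧ SignComm q a b c d q b ∧ SignComm q a b c d q c ∧
      SignComm q a b c d 1 d := by
  have hi : q⁻¹ = q := inv_eq_of_mul_eq_one_right hq
  have had : a * d = d * a := by rw [h.ad, h.da, hi]
  refine ⟨⟨one_mul 1, by simp, by simp [had], by simp [h.ab], by simp [h.ac]⟩,
    ⟨hq, ?_, h.bd, by simp [hq], by simp [hq, h.bc]⟩,
    ⟨hq, ?_, h.cd, by simp [hq, h.bc], by simp [hq]⟩,
    ⟨one_mul 1, by simp [had], by simp, ?_, ?_⟩⟩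
  · rw [h.ab, smul_smul, hq, one_smul]
  · rw [h.ac, smul_smul, hq, one_smul]
  · rw [h.bd, smul_smul, one_mul, hq, one_smul]
  · rw [h.cd, smul_smul, one_mul, hq, one_smul]

/-- The products of two entries. -/
def pairs (a b c d : A) : Set A :=
  {z | ∃ x ∈ ({a, b, c, d} : Set A), ∃ y ∈ ({a, b, c, d} : Set A), z = x * y}

theorem QMat.exists_signComm (h : QMat q a b c d) (hq : q * q = 1) {x : A}
    (hx : x ∈ ({a, b, c, d} : Set A)) : ∃ r, SignComm q a b c d r x := by
  obtain ⟨h1, h2, h3, h4⟩ := h.signComm hq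
  rcases hx with rfl | rfl | rfl | rfl
  exacts [⟨_, h1⟩, ⟨_, h2⟩, ⟨_, h3⟩, ⟨_, h4⟩]

theorem QMat.pairs_comm (h : QMat q a b c d) (hq : q * q = 1) {z w : A} (hz : z ∈ pairs a b c d)
    (hw : w ∈ pairs a b c d) : z * w = w * z := by
  obtain ⟨x, hx, y, hy, rfl⟩ := hz
  obtain ⟨u, hu, v, hv, rfl⟩ := hw
  obtain ⟨r, hr⟩ := h.exists_signComm hq hx
  obtain ⟨s, hs⟩ := h.exists_signComm hq hy
  obtain ⟨h1, h2, h3, h4⟩ := hr.mul hq hs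
  have key : ∀ e ∈ ({a, b, c, d} : Set A), (x * y) * e = (r * s) • (e * (x * y)) := by
    rintro e (rfl | rfl | rfl | rfl) <;> assumption
  rw [← mul_assoc, key u hu, smul_mul_assoc, mul_assoc, key v hv, mul_smul_comm, smul_smul,
    show r * s * (r * s) = 1 by linear_combination s * s * hr.sq + hs.sq, one_smul, mul_assoc]

theorem QMat.pairs_isSubHopf (h : QMat q a b c d) :
    IsSubHopf (Algebra.adjoin k (pairs a b c d)) := by
  have hm : ∀ x ∈ ({a, b, c, d} : Set A), ∀ y ∈ ({a, b, c, d} : Set A),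
      x * y ∈ Algebra.adjoin k (pairs a b c d) := fun x hx y hy =>
    Algebra.subset_adjoin ⟨x, hx, y, hy, rfl⟩
  have hΔ : ∀ x ∈ ({a, b, c, d} : Set A), ∃ x₁ ∈ ({a, b, c, d} : Set A),
      ∃ x₂ ∈ ({a, b, c, d} : Set A), ∃ x₃ ∈ ({a, b, c, d} : Set A),
      ∃ x₄ ∈ ({a, b, c, d} : Set A), comul (R := k) x = x₁ ⊗ₜ x₂ + x₃ ⊗ₜ x₄ := by
    rintro x (rfl | rfl | rfl | rfl)
    · exact ⟨_, by simp, _, by simp, _, by simp, _, by simp, h.comul_a⟩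
    · exact ⟨_, by simp, _, by simp, _, by simp, _, by simp, h.comul_b⟩
    · exact ⟨_, by simp, _, by simp, _, by simp, _, by simp, h.comul_c⟩
    · exact ⟨_, by simp, _, by simp, _, by simp, _, by simp, h.comul_d⟩
  have hS : ∀ x ∈ ({a, b, c, d} : Set A), ∃ x' ∈ ({a, b, c, d} : Set A), ∃ r : k,
      antipode k x = r • x' := by
    rintro x (rfl | rfl | rfl | rfl)
    · exact ⟨d, by simp, 1, by rw [h.antipode_a, one_smul]⟩
    · exact ⟨_, by simp, _, h.antipode_b⟩
    · exact ⟨_, by simp, _, h.antipode_c⟩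
    · exact ⟨a, by simp, 1, by rw [h.antipode_d, one_smul]⟩
  apply isSubHopf_adjoin
  · rintro _ ⟨x, hx, y, hy, rfl⟩
    obtain ⟨x₁, m₁, x₂, m₂, x₃, m₃, x₄, m₄, e⟩ := hΔ x hx
    obtain ⟨y₁, n₁, y₂, n₂, y₃, n₃, y₄, n₄, f⟩ := hΔ y hy
    rw [Bialgebra.comul_mul, e, f]
    simp only [add_mul, mul_add, Algebra.TensorProduct.tmul_mul_tmul]
    refine add_mem (add_mem ?_ ?_) (add_mem ?_ ?_) <;> apply tmul_mem_range_incl2 <;>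
      (apply hm <;> assumption)
  · rintro _ ⟨x, hx, y, hy, rfl⟩
    obtain ⟨x', hx', r, e⟩ := hS x hx
    obtain ⟨y', hy', s, f⟩ := hS y hy
    rw [HopfAlgebra.antipode_mul_antidistrib, e, f, smul_mul_smul_comm]
    exact Subalgebra.smul_mem _ (hm _ hy' _ hx') _

theorem QMat.antipode_antipode (h : QMat q a b c d) (hg : Algebra.adjoin k {a, b, c, d} = ⊤)
    (hq : q * q = 1) (x : A) : antipode k (antipode k x) = x := by
  have hi : q⁻¹ = q := inv_eq_of_mul_eq_one_right hq
  refine gen_induction (P := fun x => antipode k (antipode k x) = x) hg ?_ ?_ ?_ ?_ ?_ ?_ ?_ x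
  · rw [h.antipode_a, h.antipode_d]
  · rw [h.antipode_b, map_smul, h.antipode_b, smul_smul, hi, neg_mul_neg, hq, one_smul]
  · rw [h.antipode_c, map_smul, h.antipode_c, smul_smul, neg_mul_neg, hq, one_smul]
  · rw [h.antipode_d, h.antipode_a]
  · intro r
    rw [Algebra.algebraMap_eq_smul_one, map_smul, map_smul, HopfAlgebra.antipode_one,
      HopfAlgebra.antipode_one]
  · intro x y hx hy; rw [map_add, map_add, hx, hy]
  · intro x y hx hy
    rw [HopfAlgebra.antipode_mul_antidistrib, HopfAlgebra.antipode_mul_antidistrib, hx, hy]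

theorem isSemisimpleRing_of_antipode [CharZero k] {K : Type} [Ring K]
    [HopfAlgebra k K] [FiniteDimensional k K]
    (hS : ∀ x : K, antipode k (antipode k x) = x) : IsSemisimpleRing K := by
  have : Nontrivial K := ⟨⟨1, 0, fun h => by simpa using congrArg (counit (R := k)) h⟩⟩
  obtain ⟨Λ, hΛ, h1⟩ := exists_normalized_leftInt (k := k) hS
  exact isSemisimpleRing_of_leftInt hΛ h1

/-- At a sign `q`, the even part is a commutative semisimple Hopf subalgebra with noncyclic
character group. -/
theorem QMat.exists_even [IsAlgClosed k] [CharZero k] [FiniteDimensional k A] (h : QMat q a b c d)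
    (hg : Algebra.adjoin k {a, b, c, d} = ⊤) (hq : q * q = 1) (hli : LinearIndependent k ![a, b, c, d]) :
    ∃ (K : Subalgebra k A) (_ : IsSubHopf K), IsSemisimpleRing K ∧
      (∀ x y : K, x * y = y * x) ∧ ¬ IsCyclic (GroupLike k (DualH k K)) := by
  have := h.pairs_isSubHopf
  have hcomm : ∀ x y : Algebra.adjoin k (pairs a b c d), x * y = y * x := fun x y =>
    Subtype.ext (Algebra.commute_of_mem_adjoin_of_forall_mem_commute y.2 fun z hz =>
      (Algebra.commute_of_mem_adjoin_of_forall_mem_commute x.2 fun w hw =>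
        h.pairs_comm hq hz hw).symm)
  have hss : IsSemisimpleRing (Algebra.adjoin k (pairs a b c d)) :=
    isSemisimpleRing_of_antipode (k := k) fun x => Subtype.ext (by
      rw [subHopf_antipode, subHopf_antipode, h.antipode_antipode hg hq])
  refine ⟨_, inferInstance, hss, hcomm, ?_⟩
  have hm : ∀ x ∈ ({a, b, c, d} : Set A), ∀ y ∈ ({a, b, c, d} : Set A),
      x * y ∈ Algebra.adjoin k (pairs a b c d) := fun x hx y hy =>
    Algebra.subset_adjoin ⟨x, hx, y, hy, rfl⟩
  obtain ⟨⟨l1, l2, l3, l4⟩, ⟨r1, r2, r3, r4⟩⟩ := h.toIsComatrix.rels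
  rw [h.antipode_a, h.antipode_b] at l1 l2
  rw [h.antipode_c, h.antipode_d] at l3 l4
  rw [h.antipode_a, h.antipode_c] at r1 r3
  rw [h.antipode_b, h.antipode_d] at r2 r4
  refine not_cyclic hss hcomm !![a, b; c, d] !![d, -q⁻¹ • b; -q • c, a] ?_ ?_ ?_ ?_ ?_ ?_ ?_ ?_
  · rw [Matrix.mul_fin_two, l1, l2, l3, l4, Matrix.one_fin_two]
  · rw [Matrix.mul_fin_two, r1, r2, r3, r4, Matrix.one_fin_two]
  · simp [Fin.forall_fin_two, h.comul_a, h.comul_b, h.comul_c, h.comul_d]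
  · simp [Fin.forall_fin_two, h.comul_a, h.comul_b, h.comul_c, h.comul_d,
      TensorProduct.neg_tmul, TensorProduct.tmul_neg, ← TensorProduct.smul_tmul', smul_smul, h.q_ne,
      add_comm]
  · simp [Fin.forall_fin_two, h.counit_a, h.counit_b, h.counit_c, h.counit_d]
  · simp [Fin.forall_fin_two, h.counit_a, h.counit_b, h.counit_c, h.counit_d]
  · have hY : ∀ i m, ∃ x ∈ ({a, b, c, d} : Set A), ∃ r : k,
        !![d, -q⁻¹ • b; -q • c, a] i m = r • x := by
      simp only [Fin.forall_fin_two]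
      exact ⟨⟨⟨d, by simp, 1, by simp⟩, ⟨b, by simp, -q⁻¹, by simp⟩⟩,
        ⟨⟨c, by simp, -q, by simp⟩, ⟨a, by simp, 1, by simp⟩⟩⟩
    have hX : ∀ n j, !![a, b; c, d] n j ∈ ({a, b, c, d} : Set A) := by
      simp [Fin.forall_fin_two]
    intro i m n j
    obtain ⟨x, hx, r, e⟩ := hY i m
    rw [e, smul_mul_assoc]
    exact Subalgebra.smul_mem _ (hm _ hx _ (hX n j)) _
  · simpa using hli

end Final

section Groups

theorem cases_dvd_four_mul_prime {p m : ℕ} (hp : p.Prime) (hm : m ∣ 4 * p) :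
    m = 1 ∨ m = 2 ∨ m = 4 ∨ m = p ∨ m = 2 * p ∨ m = 4 * p := by
  obtain ⟨x, y, hx, hy, rfl⟩ := (Nat.dvd_mul).1 hm
  have hx4 : x ≤ 4 := Nat.le_of_dvd (by norm_num) hx
  rcases (Nat.dvd_prime hp).1 hy with rfl | rfl <;> interval_cases x <;> omega

theorem eq_of_dvd_four_mul_prime {p m n : ℕ} (hp : p.Prime) (hodd : Odd p) (hmn : m ∣ n)
    (hn : n ∣ 4 * p) (hn4 : n ≠ 4 * p) (h1 : m ≠ 1) (h2 : m ≠ 2) (hmp : m ≠ p) :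
    m = n ∧ (n = 2 ^ 2 ∨ n = 2 * p) := by
  have hp2 := hp.two_le
  have hpodd := Nat.odd_iff.1 hodd
  have hn0 : 0 < n := Nat.pos_of_dvd_of_pos hn (by omega)
  have hle := Nat.le_of_dvd hn0 hmn
  rcases cases_dvd_four_mul_prime hp (hmn.trans hn) with e | e | e | e | e | e
  · exact absurd e h1
  · exact absurd e h2
  · rw [e] at hmn
    rcases cases_dvd_four_mul_prime hp hn with f | f | f | f | f | f <;> omega
  · exact absurd e hmp
  · rcases cases_dvd_four_mul_prime hp hn with f | f | f | f | f | f <;> omega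
  · rcases cases_dvd_four_mul_prime hp hn with f | f | f | f | f | f <;> omega

theorem mul_comm_of_isCyclic {G : Type} [Group G] (h : IsCyclic G) (x y : G) : x * y = y * x :=
  (IsCyclic.commGroup (α := G)).mul_comm x y

/-- A noncommutative group of order `2p` has no central element without odd powers equal to
one. -/
theorem mul_comm_of_central {G : Type} [Group G] [Finite G] {p : ℕ} (hp : p.Prime) (hodd : Odd p)
    (hG : Nat.card G = 2 * p) {g : G} (hg : ∀ x, x * g = g * x) (hj : ∀ j : ℕ, Odd j → g ^ j ≠ 1)
    (x y : G) : x * y = y * x := by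
  have : Fact p.Prime := ⟨hp⟩
  obtain ⟨s, hs⟩ := exists_prime_orderOf_dvd_card' (G := G) p (hG ▸ Dvd.intro_left 2 rfl)
  have heven : 2 ∣ orderOf g := by
    by_contra h
    exact hj _ (Nat.not_even_iff_odd.1 fun he => h he.two_dvd) (pow_orderOf_eq_one g)
  have h2p : orderOf g ∣ 2 * p := hG ▸ orderOf_dvd_natCard g
  obtain ⟨t, ht⟩ := heven
  rw [ht] at h2p
  rcases (Nat.dvd_prime hp).1 (Nat.dvd_of_mul_dvd_mul_left two_pos h2p) with rfl | rfl
  · have hc : Commute g s := (hg s).symm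
    have h := hc.orderOf_mul_eq_mul_orderOf_of_coprime (by
      rw [ht, hs]; exact (Nat.coprime_two_left).2 hodd)
    rw [ht, hs, mul_one, ← hG] at h
    exact mul_comm_of_isCyclic (isCyclic_of_orderOf_eq_card _ h) x y
  · rw [← hG] at ht
    exact mul_comm_of_isCyclic (isCyclic_of_orderOf_eq_card _ ht) x y

end Groups

section Main

variable {k : Type} [Field k]

theorem subalgebra_eq_top {A : Type} [Ring A] [Algebra k A] [FiniteDimensional k A]
    {K : Subalgebra k A} (h : Module.finrank k K = Module.finrank k A) : K = ⊤ :=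
  Algebra.toSubmodule_eq_top.1 (Submodule.eq_top_of_finrank_eq h)

theorem QMat.not_mul_comm [IsAlgClosed k] {A : Type} [Ring A] [HopfAlgebra k A] [FiniteDimensional k A] {q : k}
    {a b c d : A} (h : QMat q a b c d) (hli : LinearIndependent k ![a, b, c, d])
    (hss : IsSemisimpleRing A) (hcomm : ∀ x y : A, x * y = y * x) :
    ¬ ∀ x y : GroupLike k (DualH k A), x * y = y * x := by
  intro hG
  have h1 : ∀ γ δ : GroupLike k (DualH k A),
      charOf γ b * charOf δ c = charOf δ b * charOf γ c := by
    intro γ δ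
    have e := congrArg (fun z => charOf z a) (hG γ δ)
    simp only [charOf_mul, h.comul_a, map_add, ev2_tmul, ← charOf_apply] at e
    linear_combination e
  have h2 : ∀ δ : GroupLike k (DualH k A), charOf δ c • b - charOf δ b • c = 0 := fun δ =>
    eq_zero_of_charOf (k := k) hss hcomm fun γ => by
      simp only [map_sub, map_smul, smul_eq_mul]
      linear_combination h1 γ δ
  rw [Fintype.linearIndependent_iff] at hli
  have h3 : c = 0 := eq_zero_of_charOf (k := k) hss hcomm fun δ => by
    have := hli ![0, charOf δ c, -charOf δ b, 0] (by
      simp only [Fin.sum_univ_four, Matrix.cons_val]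
      rw [← h2 δ]
      module) 1
    simpa using this
  have := hli ![0, 0, 1, 0] (by simp [Fin.sum_univ_four, h3]) 2
  simp at this

theorem antipode_antipode_of_dual {H : Type} [Ring H] [HopfAlgebra k H] [FiniteDimensional k H]
    (h : ∀ f : DualH k H, antipode k (antipode k f) = f) (x : H) :
    antipode k (antipode k x) = x := by
  rw [← sub_eq_zero]
  refine (Module.forall_dual_apply_eq_zero_iff k _).1 fun f => ?_
  have := dualH_antipode (antipode k (toDual.symm f : DualH k H)) x
  rw [h, dualH_antipode] at this
  simpa [sub_eq_zero] using this.symm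

/-- A Hopf algebra of dimension `4p` whose dual contains a quantum matrix with linearly
independent entries is semisimple. -/
theorem QMat.isSemisimpleRing [IsAlgClosed k] [CharZero k] {p : ℕ} (hp : p.Prime) (hodd : Odd p) {H : Type} [Ring H]
    [HopfAlgebra k H] [FiniteDimensional k H] (hdim : Module.finrank k H = 4 * p) {q : k}
    {a b c d : DualH k H} (h : QMat q a b c d) (hli : LinearIndependent k ![a, b, c, d]) :
    IsSemisimpleRing H := by
  have : Nontrivial (DualH k H) :=
    ⟨⟨1, 0, fun h => by simpa using congrArg (counit (R := k)) h⟩⟩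
  have hF : Module.finrank k (DualH k H) = 4 * p := finrank_dualH.trans hdim
  obtain ⟨A, hA, a', b', c', d', h', rfl, rfl, rfl, rfl, hg⟩ := h.exists_subHopf
  have hli' : LinearIndependent k ![a', b', c', d'] := by
    refine LinearIndependent.of_comp A.val.toLinearMap ?_
    convert hli using 1
    ext i
    fin_cases i <;> rfl
  have hAF : Module.finrank k A ∣ 4 * p := hF ▸ subHopf_finrank_dvd
  have : Nontrivial A := ⟨⟨1, 0, fun h => by simpa using congrArg (counit (R := k)) h⟩⟩
  have hq : q * q = 1 := by
    rw [← pow_two]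
    exact h'.sq_eq_one hp hodd hAF hg (hli'.ne_zero 1)
  have hSA := h'.antipode_antipode hg hq
  have hssA : IsSemisimpleRing A := isSemisimpleRing_of_antipode (k := k) hSA
  by_cases hAp : Module.finrank k A = 4 * p
  · have htop := subalgebra_eq_top (hAp.trans hF.symm)
    refine isSemisimpleRing_of_antipode (k := k) (antipode_antipode_of_dual fun f => ?_)
    have hf : f ∈ A := htop ▸ trivial
    have := congrArg Subtype.val (hSA ⟨f, hf⟩)
    rwa [subHopf_antipode, subHopf_antipode] at this
  obtain ⟨K, hK, hssK, hcommK, hcyc⟩ := h'.exists_even hg hq hli'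
  have hcard := (charOf_bijective (k := k) hssK hcommK).1
  have hKA : Module.finrank k K ∣ Module.finrank k A := subHopf_finrank_dvd
  have hnp : ∀ r : ℕ, r.Prime → Module.finrank k K ≠ r := fun r hr h => by
    have : Fact r.Prime := ⟨hr⟩
    exact hcyc (isCyclic_of_prime_card (hcard.trans h))
  have hn1 : Module.finrank k K ≠ 1 := fun h => by
    have : Subsingleton (GroupLike k (DualH k K)) :=
      (Nat.card_eq_one_iff_unique.1 (hcard.trans h)).1
    exact hcyc inferInstance
  have hn := eq_of_dvd_four_mul_prime hp hodd hKA hAF hAp hn1 (hnp 2 Nat.prime_two) (hnp p hp)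
  have htop := subalgebra_eq_top hn.1
  have hcommA : ∀ x y : A, x * y = y * x := fun x y =>
    congrArg Subtype.val (hcommK ⟨x, htop ▸ trivial⟩ ⟨y, htop ▸ trivial⟩)
  have hcardA := (charOf_bijective (k := k) hssA hcommA).1
  have hnc := h'.not_mul_comm hli' hssA hcommA
  rcases hn.2 with h4 | h2p
  · have : Fact (Nat.Prime 2) := ⟨Nat.prime_two⟩
    exact absurd (IsPGroup.isMulCommutative_of_card_eq_prime_sq
      (hcardA.trans h4)).is_comm.comm hnc
  rcases integral_or_central (k := k) (K := A) hssA hcommA (by rw [hF, h2p]; ring) with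
    ⟨Λ, hΛ, h0⟩ | ⟨g, hgc, hgj⟩
  · exact isSemisimpleRing_of_dual_dual hΛ h0
  · exact absurd (mul_comm_of_central hp hodd (hcardA.trans h2p) hgc hgj) hnc

end Main

end SmallHopf

/-- over an algebraically closed field of characteristic zero, a non-semisimple
Hopf algebra `H` of dimension `4p` (`p` an odd prime) has no self-dual `2`-dimensional simple
module.  An `H`-module isomorphism `V ≅ V^∨` is the same thing as a perfect `k`-bilinear
pairing `B` on `V` satisfying `B (h • v) w = B v (S h • w)`; we state the non-existence of
such a pairing. -/
theorem nonsemisimple_dim_4p_two_dim_simple_not_self_dual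
    (k : Type) [Field k] [IsAlgClosed k] [CharZero k]
    (p : ℕ) (hp : p.Prime) (hodd : Odd p)
    (H : Type) [Ring H] [HopfAlgebra k H]
    (hdim : Module.finrank k H = 4 * p)
    (hns : ¬ IsSemisimpleRing H)
    (V : Type) [AddCommGroup V] [Module k V] [Module H V] [IsScalarTower k H V]
    (hsimple : IsSimpleModule H V) (hV : Module.finrank k V = 2) :
    ¬ ∃ B : V →ₗ[k] V →ₗ[k] k,
        (∀ v : V, (∀ w : V, B v w = 0) → v = 0) ∧
        (∀ w : V, (∀ v : V, B v w = 0) → w = 0) ∧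
        (∀ (h : H) (v w : V),
          B (h • v) w = B v (HopfAlgebra.antipode (R := k) h • w)) := by
  rintro ⟨B, h1, h2, hB⟩
  have : FiniteDimensional k H := FiniteDimensional.of_finrank_pos (by
    rw [hdim]; exact Nat.mul_pos four_pos hp.pos)
  obtain ⟨a, b, c, d, q, hq, hli, hX, ha, hb, hc, hd⟩ := SmallHopf.exists_comatrix hV B h1 h2 hB
  exact hns (SmallHopf.QMat.isSemisimpleRing hp hodd hdim ⟨hX, hq, ha, hb, hc, hd⟩ hli)
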